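/- Trace bound: there is an absolute constant C > 0 with the following property. Let N, H_0, H ≥ 1 with H_0 ≤ H, H ≥ 3, and log H_0 ≥ (log H)^{1/2} (log log H)^2. Let 𝐏 be a set of primes contained in [H_0, H] with 𝓛 = ∑_{p ∈ 𝐏} 1/p ≥ e and log H ≤ √((log N)/𝓛), and let 1 ≤ K ≤ (log N)/(𝓛 (log H)^2). Then there exist a subset X ⊆ 𝐍 with |𝐍 ∖ X| ≤ C·(N·e^{−K𝓛·log K} + N/√H_0) and an integer k ≥ log H such that Tr((A|_X)^{2k}) ≤ (C·K·𝓛)^k · N. -/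

import Mathlib

set_option linter.all false
namespace TB
open Finset
def wds {α : Type*} [DecidableEq α] (S : Finset α) : ℕ → Finset (List α)
  | 0 => {[]}
  | n + 1 => (wds S n ×ˢ S).image (fun x => x.2 :: x.1)
theorem mem_wds {α : Type*} [DecidableEq α] {S : Finset α} {n : ℕ} {l : List α} :
    l ∈ wds S n ↔ l.length = n ∧ ∀ x ∈ l, x ∈ S := by
  induction n generalizing l with
  | zero =>
    simp only [wds, mem_singleton, List.length_eq_zero_iff]
    grind
  | succ n ih =>
    simp only [wds, mem_image, mem_product, Prod.exists]
    constructor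
    · grind
    · rintro ⟨h1, h2⟩
      cases l with
      | nil => simp at h1
      | cons p l =>
        grind
theorem sum_wds_succ {α : Type*} [DecidableEq α] {β : Type*} [AddCommMonoid β] (S : Finset α) (n : ℕ)
    (f : List α → β) : ∑ l ∈ wds S (n+1), f l = ∑ l ∈ wds S n, ∑ p ∈ S, f (p :: l) := by
  rw [wds, sum_image, sum_product]
  rintro ⟨a, b⟩ _ ⟨c, d⟩ _ h
  simp at h
  simp [h]
theorem sum_wds_zero {α : Type*} [DecidableEq α] {β : Type*} [AddCommMonoid β] (S : Finset α)
    (f : List α → β) : ∑ l ∈ wds S 0, f l = f [] := by simp [wds]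
theorem sum_wds_add {α : Type*} [DecidableEq α] {β : Type*} [AddCommMonoid β] (S : Finset α) (k n : ℕ)
    (f : List α → β) : ∑ l ∈ wds S (k+n), f l = ∑ l ∈ wds S n, ∑ c ∈ wds S k, f (c ++ l) := by
  induction k generalizing f with
  | zero => simp [wds]
  | succ k ih =>
    have : k + 1 + n = (k + n) + 1 := by ring
    rw [this, sum_wds_succ, ih]
    refine sum_congr rfl fun l _ => ?_
    rw [sum_wds_succ]
    rfl
theorem sum_wds_reverse {α : Type*} [DecidableEq α] {β : Type*} [AddCommMonoid β] (S : Finset α) (n : ℕ)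
    (f : List α → β) : ∑ l ∈ wds S n, f l.reverse = ∑ l ∈ wds S n, f l := by
  refine sum_bij' (fun l _ => l.reverse) (fun l _ => l.reverse) ?_ ?_ ?_ ?_ ?_ <;>
    simp [mem_wds]
theorem card_wds {α : Type*} [DecidableEq α] (S : Finset α) (n : ℕ) : (wds S n).card = S.card ^ n := by
  induction n with
  | zero => simp [wds]
  | succ n ih =>
    have := sum_wds_succ S n (fun _ => 1)
    aesop
def SS (U : Finset ℕ) : ℕ → Finset ℤ
  | 0 => {0}
  | n + 1 => image₂ (· + ·) (insert 0 (U.image (fun x : ℕ => (x:ℤ)) ∪ U.image (fun x : ℕ => -(x:ℤ)))) (SS U n)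
theorem card_SS (U : Finset ℕ) (n : ℕ) : (SS U n).card ≤ (2 * U.card + 1) ^ n := by
  induction n with
  | zero => simp [SS]
  | succ n ih =>
    rw [SS, pow_succ, mul_comm]
    refine (card_image₂_le _ _ _).trans (Nat.mul_le_mul ?_ ih)
    grind
theorem SS_abs (U : Finset ℕ) (n : ℕ) (B : ℤ) (hB : ∀ x ∈ U, (x:ℤ) ≤ B) (hB0 : 0 ≤ B) : ∀ a ∈ SS U n, |a| ≤ n * B := by
  induction n with
  | zero => simp [SS]
  | succ n ih =>
    intro a ha
    rw [SS, mem_image₂] at ha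
    grind
def val (lam : List (ℤ × ℕ)) : ℤ := (lam.map (fun x => x.1 * (x.2:ℤ))).sum
def coef (lam : List (ℤ × ℕ)) (y : ℕ) : ℤ := (lam.map (fun x => if x.2 = y then x.1 else 0)).sum
@[simp] theorem val_nil : val [] = 0 := rfl
@[simp] theorem val_cons (a) (l) : val (a :: l) = a.1 * (a.2:ℤ) + val l := by simp [val]
@[simp] theorem coef_nil (y) : coef [] y = 0 := rfl
@[simp] theorem coef_cons (a) (l) (y) : coef (a :: l) y = (if a.2 = y then a.1 else 0) + coef l y := by simp [coef]
theorem val_append (a b) : val (a ++ b) = val a + val b := by simp [val]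
theorem coef_append (a b y) : coef (a ++ b) y = coef a y + coef b y := by simp [coef]
theorem val_filter (lam : List (ℤ × ℕ)) (p : ℕ) :
    val lam = coef lam p * p + val (lam.filter (fun x => x.2 ≠ p)) := by
  induction lam with
  | nil => simp
  | cons a l ih =>
    by_cases h : a.2 = p
    · simp [h] at ih ⊢; rw [ih]; ring
    · simp [h] at ih ⊢; rw [ih]; ring
theorem coef_filter (lam : List (ℤ × ℕ)) (p x : ℕ) (h : x ≠ p) :
    coef (lam.filter (fun x => x.2 ≠ p)) x = coef lam x := by
  induction lam with
  | nil => simp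
  | cons a l ih =>
    by_cases h' : a.2 = p
    · aesop
    · simp_all
theorem coef_filter_self (lam : List (ℤ × ℕ)) (p : ℕ) :
    coef (lam.filter (fun x => x.2 ≠ p)) p = 0 := by
  induction lam with
  | nil => simp
  | cons a l ih =>
    by_cases h' : a.2 = p
    · grind
    · simp_all
theorem coef_ne_mem {lam : List (ℤ × ℕ)} {y : ℕ} (h : coef lam y ≠ 0) : ∃ a ∈ lam, a.2 = y := by
  induction lam with
  | nil => simp at h
  | cons a l ih =>
    aesop
theorem coef_eq_zero {lam : List (ℤ × ℕ)} {y : ℕ} (h : ∀ a ∈ lam, a.2 ≠ y) : coef lam y = 0 := by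
  by_contra h'
  obtain ⟨a, ha, ha'⟩ := coef_ne_mem h'
  exact h a ha ha'
theorem coef_abs (lam : List (ℤ × ℕ)) (y : ℕ) (h : ∀ a ∈ lam, |a.1| = 1) : |coef lam y| ≤ lam.length := by
  induction lam with
  | nil => simp
  | cons a l ih =>
    have h1 := ih (fun b hb => h b (by simp [hb]))
    have h2 := h a (by simp)
    simp only [coef_cons, List.length_cons]
    grind
theorem val_mem_SS (U : Finset ℕ) (n : ℕ) (lam : List (ℤ × ℕ)) (h1 : ∀ a ∈ lam, |a.1| = 1)
    (h2 : ∀ a ∈ lam, a.2 ∈ U) (h3 : lam.length ≤ n) : val lam ∈ SS U n := by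
  induction n generalizing lam with
  | zero => simp at h3; subst h3; simp [SS]
  | succ n ih =>
    rw [SS, mem_image₂]
    cases lam with
    | nil => exact ⟨0, by simp, 0, by simpa using ih [] (by simp) (by simp) (by simp), by simp⟩
    | cons a l =>
      refine ⟨a.1 * a.2, ?_, val l, ih l (fun b hb => h1 b (by simp [hb])) (fun b hb => h2 b (by simp [hb])) (by simpa using h3), by simp⟩
      grind
theorem val_of_coef_zero (n : ℕ) (lam : List (ℤ × ℕ)) (hn : lam.length ≤ n) (h : ∀ x, coef lam x = 0) : val lam = 0 := by
  induction n generalizing lam with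
  | zero => simp at hn; subst hn; simp
  | succ n ih =>
    cases lam with
    | nil => simp
    | cons a l =>
      rw [val_filter _ a.2, h]
      simp only [zero_mul, zero_add]
      apply ih
      · grind
      · intro x
        by_cases hx : x = a.2
        · rw [hx]; exact coef_filter_self _ _
        · rw [coef_filter _ _ _ hx]; exact h x
end TB
namespace TB
open Finset
section core
variable (ε : ℕ → ℤ) (rs D : ℕ → Bool) (h : ℕ)
def bp : List ℕ → ℤ
  | [] => 0
  | p :: l => if rs (l.length + 1) then 0 else bp l + ε l.length * p
def poss : List ℕ → Finset ℤ
  | [] => {0}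
  | p :: l => insert (bp ε rs (p :: l)) (poss l)
def facts (n : ℤ) : List ℕ → Prop
  | [] => True
  | p :: l => facts n l ∧ (D l.length = true → (p:ℤ) ∣ n + bp ε rs l)
def seen (p : ℕ) : List ℕ → Prop
  | [] => False
  | x :: l => seen p l ∨ (x = p ∧ D l.length = true)
def cons (p : ℕ) (b : ℤ) : List ℕ → Prop
  | [] => True
  | x :: l => cons p b l ∧ (x = p → D l.length = true → (p:ℤ) ∣ b - bp ε rs l)
open Classical in
noncomputable def Wt : List ℕ → ℝ
  | [] => 1
  | p :: l => Wt l * (if D l.length = true ∧ seen D p l then (if cons ε rs D p (bp ε rs l) l then 1 else 0) else 1 / (p:ℝ))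
def Bad (l : List ℕ) (x : ℕ) : Prop :=
  ∃ σ ∈ SS l.toFinset h, ∃ β ∈ poss ε rs l, ∃ β' ∈ poss ε rs l,
    (σ + β - β' ≠ 0 ∧ (x:ℤ) ∣ σ + β - β') ∨
    ∃ y ∈ l, y ≠ x ∧ ∃ c : ℤ, c ≠ 0 ∧ |c| ≤ h ∧ (y:ℤ) ∣ c * x + (σ + β - β')
def special : List ℕ → ℕ → Prop
  | [], _ => False
  | p :: l, z => (z ∈ l ∧ special l z) ∨ (z ∉ l ∧ z = p ∧ Bad ε rs h l p)
theorem zero_mem_poss (l : List ℕ) : (0:ℤ) ∈ poss ε rs l := by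
  induction l with
  | nil => simp [poss]
  | cons p l ih => simp [poss, ih]
theorem bp_mem_poss (l : List ℕ) : bp ε rs l ∈ poss ε rs l := by
  cases l <;> simp [poss, bp]
theorem poss_append (s l : List ℕ) : poss ε rs l ⊆ poss ε rs (s ++ l) := by
  induction s with
  | nil => simp
  | cons p s ih => exact ih.trans (by simp [poss])
theorem card_poss (l : List ℕ) : (poss ε rs l).card ≤ l.length + 1 := by
  induction l with
  | nil => simp [poss]
  | cons p l ih => exact (card_insert_le _ _).trans (by simpa using ih)
theorem Wt_nonneg (l : List ℕ) : 0 ≤ Wt ε rs D l := by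
  induction l with
  | nil => simp [Wt]
  | cons p l ih => 
    rw [Wt]; refine mul_nonneg ih ?_
    split_ifs <;> positivity
variable {ε rs D h}
theorem special_cons_of_mem {p z : ℕ} {l : List ℕ} (hz : z ∈ l) : special ε rs h (p :: l) z ↔ special ε rs h l z := by
  simp [special, hz]
theorem special_append_of_mem {z : ℕ} {s l : List ℕ} (hz : z ∈ l) : special ε rs h (s ++ l) z ↔ special ε rs h l z := by
  induction s with
  | nil => rfl
  | cons p s ih => rw [List.cons_append, special_cons_of_mem (by simp [hz]), ih]
theorem special_cons_self {p : ℕ} {l : List ℕ} (hz : p ∉ l) : special ε rs h (p :: l) p ↔ Bad ε rs h l p := by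
  simp [special, hz]
theorem coin (rl : List ℕ) (hpos : ∀ x ∈ rl, 0 < x) (lam : List (ℤ × ℕ)) (h1 : ∀ a ∈ lam, |a.1| = 1)
    (h2 : ∀ a ∈ lam, a.2 ∈ rl) (h3 : ∀ a ∈ lam, ¬ special ε rs h rl a.2) (hlen : lam.length ≤ h)
    (y : ℕ) (hy : y ∈ rl) (hys : ¬ special ε rs h rl y) (hc : coef lam y = 0)
    (hne : ∃ x, coef lam x ≠ 0) (hdvd : (y:ℤ) ∣ val lam) : False := by
  induction rl generalizing lam y with
  | nil => simp at hy
  | cons p rl ih =>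
    have hpos' : ∀ x ∈ rl, 0 < x := fun x hx => hpos x (by simp [hx])
    by_cases hp : p ∈ rl
    · have hm : ∀ z, z ∈ p :: rl → z ∈ rl := by
        grind
      exact ih hpos' lam h1 (fun a ha => hm _ (h2 a ha))
        (fun a ha => by rw [← special_cons_of_mem (hm _ (h2 a ha))]; exact h3 a ha) hlen y (hm _ hy)
        (by rw [← special_cons_of_mem (hm _ hy)]; exact hys) hc hne hdvd
    · set lam' := lam.filter (fun x => x.2 ≠ p) with hlam'
      have hsub : ∀ a ∈ lam', a ∈ lam := fun a ha => List.mem_of_mem_filter ha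
      have h1' : ∀ a ∈ lam', |a.1| = 1 := fun a ha => h1 a (hsub a ha)
      have h2' : ∀ a ∈ lam', a.2 ∈ rl := by
        grind
      have h3' : ∀ a ∈ lam', ¬ special ε rs h rl a.2 := by
        intro a ha
        rw [← special_cons_of_mem (h2' a ha)]
        exact h3 a (hsub a ha)
      have hlen' : lam'.length ≤ h := (List.length_filter_le _ _).trans hlen
      have hSS : val lam' ∈ SS rl.toFinset h :=
        val_mem_SS _ _ _ h1' (fun a ha => by simpa using h2' a ha) hlen'
      have hz := zero_mem_poss ε rs rl
      have hval := val_filter lam p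
      rw [← hlam'] at hval
      by_cases hcp : coef lam p = 0
      · rw [hcp, zero_mul, zero_add] at hval
        obtain ⟨x, hx⟩ := hne
        have hxp : x ≠ p := fun hh => hx (hh ▸ hcp)
        have hx' : coef lam' x ≠ 0 := by rw [coef_filter _ _ _ hxp]; exact hx
        by_cases hyp : y = p
        · subst hyp
          rw [special_cons_self hp] at hys
          have hv0 : val lam' = 0 := by
            by_contra hv
            exact hys ⟨val lam', hSS, 0, hz, 0, hz, Or.inl ⟨by simpa using hv, by rw [hval] at hdvd; simpa using hdvd⟩⟩
          obtain ⟨a, ha, hax⟩ := coef_ne_mem hx'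
          have hxr : x ∈ rl := hax ▸ h2' a ha
          have hxs : ¬ special ε rs h rl x := hax ▸ h3' a ha
          set lam'' := lam'.filter (fun z => z.2 ≠ x) with hlam''
          have hval2 := val_filter lam' x
          rw [← hlam'', hv0] at hval2
          have hsub2 : ∀ a ∈ lam'', a ∈ lam' := fun a ha => List.mem_of_mem_filter ha
          by_cases hne2 : ∃ z, coef lam'' z ≠ 0
          · exact ih hpos' lam'' (fun a ha => h1' a (hsub2 a ha)) (fun a ha => h2' a (hsub2 a ha))
              (fun a ha => h3' a (hsub2 a ha)) ((List.length_filter_le _ _).trans hlen') x hxr hxs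
              (coef_filter_self _ _) hne2 ⟨-coef lam' x, by linarith⟩
          · push Not at hne2
            have := val_of_coef_zero _ lam'' le_rfl hne2
            rw [this] at hval2
            have h6 : (x:ℤ) ≠ 0 := by have := hpos' x hxr; positivity
            have : coef lam' x * (x:ℤ) ≠ 0 := mul_ne_zero hx' h6
            exact this (by linarith)
        · have hyr : y ∈ rl := by simp at hy; tauto
          exact ih hpos' lam' h1' h2' h3' hlen' y hyr (by rw [← special_cons_of_mem hyr]; exact hys)
            (by rw [coef_filter _ _ _ hyp]; exact hc) ⟨x, hx'⟩ (hval ▸ hdvd)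
      · obtain ⟨a, ha, hap⟩ := coef_ne_mem hcp
        have hpb := h3 a ha
        rw [hap, special_cons_self hp] at hpb
        have hyp : y ≠ p := fun hh => hcp (hh ▸ hc)
        have hyr : y ∈ rl := by simp at hy; tauto
        refine hpb ⟨val lam', hSS, 0, hz, 0, hz, Or.inr ⟨y, hyr, hyp, coef lam p, hcp, ?_, ?_⟩⟩
        · exact (coef_abs _ _ h1).trans (by exact_mod_cast hlen)
        · rw [hval] at hdvd; simpa using hdvd
theorem coin2 (seg rest : List ℕ) (lam : List (ℤ × ℕ)) (h1 : ∀ a ∈ lam, |a.1| = 1)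
    (h2 : ∀ a ∈ lam, a.2 ∈ seg ∧ a.2 ∉ rest) (h3 : ∀ a ∈ lam, ¬ special ε rs h (seg ++ rest) a.2) (hlen : lam.length ≤ h)
    (y : ℕ) (hy : y ∈ rest) (β β' : ℤ) (hβ : β ∈ poss ε rs rest) (hβ' : β' ∈ poss ε rs rest)
    (hne : ∃ x, coef lam x ≠ 0) (hdvd : (y:ℤ) ∣ val lam + β - β') : False := by
  induction seg generalizing lam with
  | nil =>
    obtain ⟨x, hx⟩ := hne
    obtain ⟨a, ha, _⟩ := coef_ne_mem hx
    simpa using (h2 a ha).1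
  | cons p seg ih =>
    by_cases hp : p ∈ seg ++ rest
    · have hm : ∀ a ∈ lam, a.2 ∈ seg := by
        grind
      refine ih lam h1 (fun a ha => ⟨hm a ha, (h2 a ha).2⟩) ?_ hlen hne hdvd
      intro a ha
      rw [← special_cons_of_mem (p := p) (by simp [hm a ha])]
      exact h3 a ha
    · set lam' := lam.filter (fun x => x.2 ≠ p) with hlam'
      have hsub : ∀ a ∈ lam', a ∈ lam := fun a ha => List.mem_of_mem_filter ha
      have h1' : ∀ a ∈ lam', |a.1| = 1 := fun a ha => h1 a (hsub a ha)
      have h2' : ∀ a ∈ lam', a.2 ∈ seg ∧ a.2 ∉ rest := by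
        grind
      have h3' : ∀ a ∈ lam', ¬ special ε rs h (seg ++ rest) a.2 := by
        intro a ha
        rw [← special_cons_of_mem (p := p) (by simp [(h2' a ha).1])]
        exact h3 a (hsub a ha)
      have hlen' : lam'.length ≤ h := (List.length_filter_le _ _).trans hlen
      have hSS : val lam' ∈ SS (seg ++ rest).toFinset h :=
        val_mem_SS _ _ _ h1' (fun a ha => by simp [(h2' a ha).1]) hlen'
      have hval := val_filter lam p
      rw [← hlam'] at hval
      by_cases hcp : coef lam p = 0
      · rw [hcp, zero_mul, zero_add] at hval
        obtain ⟨x, hx⟩ := hne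
        have hxp : x ≠ p := fun hh => hx (hh ▸ hcp)
        have hx' : coef lam' x ≠ 0 := by rw [coef_filter _ _ _ hxp]; exact hx
        exact ih lam' h1' h2' h3' hlen' ⟨x, hx'⟩ (hval ▸ hdvd)
      · obtain ⟨a, ha, hap⟩ := coef_ne_mem hcp
        have hpb := h3 a ha
        rw [hap, List.cons_append, special_cons_self hp] at hpb
        have hyp : y ≠ p := by rintro rfl; exact hp (by simp [hy])
        refine hpb ⟨val lam', hSS, β, poss_append _ _ _ _ hβ, β', poss_append _ _ _ _ hβ', Or.inr ⟨y, by simp [hy], hyp, coef lam p, hcp, ?_, ?_⟩⟩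
        · exact (coef_abs _ _ h1).trans (by exact_mod_cast hlen)
        · grind
end core
end TB
namespace TB
open Finset
theorem sum_biUnion_le {α β : Type*} [DecidableEq α] (s : Finset α) (t : Finset β) (f : α → ℝ) (hf : ∀ x, 0 ≤ f x)
    (p : α → Prop) [DecidablePred p] (q : β → α → Prop) [∀ b, DecidablePred (q b)]
    (hpq : ∀ x ∈ s, p x → ∃ b ∈ t, q b x) (c : ℝ) (hc : ∀ b ∈ t, ∑ x ∈ s.filter (q b), f x ≤ c) :
    ∑ x ∈ s.filter p, f x ≤ t.card * c := by
  calc ∑ x ∈ s.filter p, f x ≤ ∑ x ∈ s.filter p, ∑ b ∈ t, (if q b x then f x else 0) := by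
        refine sum_le_sum fun x hx => ?_
        rw [mem_filter] at hx
        obtain ⟨b, hb, hq⟩ := hpq x hx.1 hx.2
        have hnn : ∀ b ∈ t, 0 ≤ (if q b x then f x else 0) := fun b _ => by
          grind
        refine le_trans ?_ (single_le_sum hnn hb)
        simp [hq]
    _ ≤ ∑ x ∈ s, ∑ b ∈ t, (if q b x then f x else 0) := by
        refine sum_le_sum_of_subset_of_nonneg (filter_subset _ _) fun x _ _ => ?_
        exact sum_nonneg fun b _ => by split_ifs; exact hf x; exact le_rfl
    _ = ∑ b ∈ t, ∑ x ∈ s.filter (q b), f x := by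
        rw [sum_comm]
        exact sum_congr rfl fun b _ => by rw [sum_filter]
    _ ≤ t.card * c := by
        refine (sum_le_card_nsmul _ _ _ hc).trans (by simp)
theorem sum_union_le' {α : Type*} [DecidableEq α] (s t : Finset α) (f : α → ℝ) (hf : ∀ x, 0 ≤ f x) :
    ∑ x ∈ s ∪ t, f x ≤ ∑ x ∈ s, f x + ∑ x ∈ t, f x := by
  rw [← sum_union_inter]
  have := sum_nonneg (s := s ∩ t) (f := f) (fun x _ => hf x)
  linarith
theorem harm_bound (n : ℕ) (hn : 1 ≤ n) : ∑ k ∈ range (n+1), (1:ℝ) / (max k 1 : ℕ) ≤ 2 + Real.log n := by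
  rw [sum_range_succ']
  have h := harmonic_le_one_add_log n
  rw [harmonic] at h
  push_cast at h
  have : ∑ k ∈ range n, (1:ℝ) / (max (k+1) 1 : ℕ) = ∑ i ∈ range n, ((i:ℝ)+1)⁻¹ := by
    refine sum_congr rfl fun i _ => ?_
    simp
  rw [this]
  simp
  linarith
section bs
variable {P : Finset ℕ} {H0 H : ℝ}
theorem ap_sum (hH0 : 0 < H0) (hP : ∀ p ∈ P, Nat.Prime p ∧ H0 ≤ (p : ℝ) ∧ (p : ℝ) ≤ H) (h : ℕ) (hh : (h:ℝ) < H0)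
    (y : ℕ) (hy : y ∈ P) (c a : ℤ) (hc : c ≠ 0) (hch : |c| ≤ h) :
    ∑ x ∈ P.filter (fun x : ℕ => (y:ℤ) ∣ c * x + a), (1:ℝ) / x ≤ (2 + Real.log H) / H0 := by
  have hyP := hP y hy
  have hypos : 0 < y := hyP.1.pos
  set S := P.filter (fun x : ℕ => (y:ℤ) ∣ c * x + a)
  set n := ⌊H⌋₊
  have hle : ∀ p ∈ P, p ≤ n := fun p hp => Nat.le_floor (hP p hp).2.2
  have hn1 : 1 ≤ n := hypos.trans_le (hle y hy)
  have hinj : Set.InjOn (fun x : ℕ => x / y) S := by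
    intro x hx x' hx' hxx
    simp only [S, coe_filter, Set.mem_setOf_eq] at hx hx'
    have h1 : (y:ℤ) ∣ c * ((x:ℤ) - x') := by
      have h0 : c * ((x:ℤ) - x') = (c * x + a) - (c * x' + a) := by ring
      rw [h0]; exact dvd_sub hx.2 hx'.2
    have hyp : Prime (y:ℤ) := Nat.prime_iff_prime_int.1 hyP.1
    rcases hyp.dvd_or_dvd h1 with h2 | h2
    · exfalso
      have h3 := Int.le_of_dvd (abs_pos.2 hc) ((dvd_abs _ _).2 h2)
      have h4 : (y:ℤ) ≤ h := h3.trans hch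
      have h5 : (y:ℝ) ≤ h := by exact_mod_cast h4
      linarith [hyP.2.1]
    · have h3 : x % y = x' % y := by
        have : x' ≡ x [MOD y] := (Nat.modEq_iff_dvd).2 h2
        exact this.symm
      have := Nat.div_add_mod x y
      have h5 := Nat.div_add_mod x' y
      grind
  calc ∑ x ∈ S, (1:ℝ) / x ≤ ∑ x ∈ S, (1:ℝ) / (max (x / y) 1 : ℕ) / H0 := by
        refine sum_le_sum fun x hx => ?_
        have hxP := hP x (mem_filter.1 hx).1
        rw [div_div]
        have h6 : (0:ℝ) < (max (x/y) 1 : ℕ) := by positivity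
        refine one_div_le_one_div_of_le (by positivity) ?_
        by_cases h7 : x / y ≤ 1
        · simp_all
        · push Not at h7
          rw [max_eq_left h7.le]
          have h8 : x / y * y ≤ x := Nat.div_mul_le_self x y
          calc ((x/y : ℕ):ℝ) * H0 ≤ ((x/y : ℕ):ℝ) * y := by gcongr; exact hyP.2.1
            _ ≤ x := by exact_mod_cast h8
    _ = (∑ k ∈ S.image (fun x => x / y), (1:ℝ) / (max k 1 : ℕ)) / H0 := by
        rw [sum_image hinj, sum_div]
    _ ≤ (∑ k ∈ range (n+1), (1:ℝ) / (max k 1 : ℕ)) / H0 := by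
        refine div_le_div_of_nonneg_right (sum_le_sum_of_subset_of_nonneg ?_ fun _ _ _ => by positivity) hH0.le
        intro k hk
        rw [mem_image] at hk
        obtain ⟨x, hx, rfl⟩ := hk
        have := hle x (mem_filter.1 hx).1
        have h8 := Nat.div_le_self x y
        simp only [mem_range]; omega
    _ ≤ (2 + Real.log H) / H0 := by
        gcongr
        refine (harm_bound n hn1).trans ?_
        gcongr
        exact Nat.floor_le (by have := hyP.2.2; have : (0:ℝ) < y := by exact_mod_cast hypos
                               linarith)
theorem card_dvd (hP : ∀ p ∈ P, Nat.Prime p ∧ H0 ≤ (p : ℝ) ∧ (p : ℝ) ≤ H) (a : ℤ) (ha : a ≠ 0) (B : ℕ) (hB : |a| < 2 ^ B) :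
    (P.filter (fun x : ℕ => (x:ℤ) ∣ a)).card ≤ B := by
  set S := P.filter (fun x : ℕ => (x:ℤ) ∣ a)
  have h1 : ∏ x ∈ S, x ∣ a.natAbs := by
    refine Finset.prod_primes_dvd _ (fun x hx => (hP x (mem_filter.1 hx).1).1.prime) fun x hx => ?_
    exact Int.natCast_dvd.1 (mem_filter.1 hx).2
  have h2 : 2 ^ S.card ≤ ∏ x ∈ S, x := by
    rw [← prod_const]
    exact prod_le_prod' fun x hx => (hP x (mem_filter.1 hx).1).1.two_le
  have h3 := Nat.le_of_dvd (Int.natAbs_pos.2 ha) h1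
  have h4 : a.natAbs < 2 ^ B := by zify; exact hB
  by_contra h5
  push Not at h5
  have := Nat.pow_lt_pow_right (a := 2) (by norm_num) h5
  omega
theorem dvd_sum (hH0 : 0 < H0) (hP : ∀ p ∈ P, Nat.Prime p ∧ H0 ≤ (p : ℝ) ∧ (p : ℝ) ≤ H) (a : ℤ) (ha : a ≠ 0) (B : ℕ) (hB : |a| < 2 ^ B) :
    ∑ x ∈ P.filter (fun x : ℕ => (x:ℤ) ∣ a), (1:ℝ) / x ≤ B / H0 := by
  have h1 := card_dvd hP a ha B hB
  calc ∑ x ∈ P.filter (fun x : ℕ => (x:ℤ) ∣ a), (1:ℝ) / x ≤ ∑ x ∈ P.filter (fun x : ℕ => (x:ℤ) ∣ a), 1 / H0 := by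
        refine sum_le_sum fun x hx => one_div_le_one_div_of_le hH0 (hP x (mem_filter.1 hx).1).2.1
    _ ≤ B / H0 := by
        rw [sum_const, nsmul_eq_mul, mul_one_div]
        gcongr
variable {ε : ℕ → ℤ} {rs : ℕ → Bool}
theorem poss_abs (hε : ∀ i, |ε i| = 1) (Hn : ℤ) (hHn : 0 ≤ Hn) (l : List ℕ) (hl : ∀ x ∈ l, (x:ℤ) ≤ Hn) :
    ∀ b ∈ poss ε rs l, |b| ≤ l.length * Hn := by
  induction l with
  | nil => simp [poss]
  | cons p l ih =>
    have ih' := ih (fun x hx => hl x (by simp [hx]))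
    have hp := hl p (by simp)
    intro b hb
    rw [poss, mem_insert] at hb
    simp only [List.length_cons]
    push_cast
    rcases hb with rfl | hb
    · rw [bp]
      split_ifs
      · simp; positivity
      · refine (abs_add_le _ _).trans ?_
        have := ih' _ (bp_mem_poss ε rs l)
        grind
    · have := ih' b hb
      linarith
open Classical in
theorem bad_sum (hH0 : 0 < H0) (hP : ∀ p ∈ P, Nat.Prime p ∧ H0 ≤ (p : ℝ) ∧ (p : ℝ) ≤ H) (h : ℕ) (hh : (h:ℝ) < H0)
    (hε : ∀ i, |ε i| = 1) (m : ℕ) (l : List ℕ) (hl : ∀ x ∈ l, x ∈ P) (hm : l.length ≤ m) (hH1 : 1 ≤ H) (B : ℕ)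
    (hB : ((h:ℝ) + 2 * m) * H < 2 ^ B) :
    ∑ x ∈ P.filter (fun x => Bad ε rs h l x), (1:ℝ) / x ≤
      ((2 * m + 1) ^ h * (m+1) * (m+1) : ℕ) * (B / H0 + (m * (2 * h + 1) : ℕ) * ((2 + Real.log H) / H0)) := by
  have hlog : 0 ≤ Real.log H := Real.log_nonneg hH1
  set n : ℤ := ⌊H⌋
  have hn : ∀ x ∈ P, (x:ℤ) ≤ n := fun x hx => Int.le_floor.2 (by simpa using (hP x hx).2.2)
  have hn0 : 0 ≤ n := Int.floor_nonneg.2 (by linarith)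
  have key : ∀ b ∈ SS l.toFinset h ×ˢ (poss ε rs l ×ˢ poss ε rs l), 
     ∑ x ∈ P.filter (fun x : ℕ => (b.1 + b.2.1 - b.2.2 ≠ 0 ∧ (x:ℤ) ∣ b.1 + b.2.1 - b.2.2) ∨
    ∃ y ∈ l, y ≠ x ∧ ∃ c : ℤ, c ≠ 0 ∧ |c| ≤ h ∧ (y:ℤ) ∣ c * x + (b.1 + b.2.1 - b.2.2)), (1:ℝ)/x ≤ (B / H0 + (m * (2 * h + 1) : ℕ) * ((2 + Real.log H) / H0)) := by
    rintro ⟨σ, β, β'⟩ hb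
    simp only [mem_product] at hb
    obtain ⟨hσ, hβ, hβ'⟩ := hb
    dsimp only
    set a := σ + β - β'
    rw [filter_or]
    refine (sum_union_le' _ _ _ (fun x => by positivity)).trans (add_le_add ?_ ?_)
    · by_cases ha : a = 0
      · simp [ha]; positivity
      · simp only [ha, ne_eq, not_false_eq_true, true_and]
        refine dvd_sum hH0 hP a ha B ?_
        have h1 := SS_abs l.toFinset h n (fun x hx => hn x (hl x (by simpa using hx))) hn0 σ hσ
        have h2 := poss_abs (rs := rs) hε n hn0 l (fun x hx => hn x (hl x hx)) β hβ
        have h3 := poss_abs (rs := rs) hε n hn0 l (fun x hx => hn x (hl x hx)) β' hβ'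
        have h4 : |a| ≤ h * n + l.length * n + l.length * n := by
          grind
        have h5 : (|a| : ℝ) ≤ (h + 2 * m) * H := by
          have h6 : ((|a| : ℤ) : ℝ) ≤ ((h * n + l.length * n + l.length * n : ℤ) : ℝ) := by exact_mod_cast h4
          push_cast at h6
          have h7 : (n:ℝ) ≤ H := Int.floor_le H
          have h8 : (l.length:ℝ) ≤ m := by exact_mod_cast hm
          nlinarith
        have : (|a| : ℝ) < 2 ^ B := h5.trans_lt hB
        exact_mod_cast this
    · have hcard : ((l.toFinset ×ˢ Icc (-(h:ℤ)) h).card : ℝ) ≤ (m * (2 * h + 1) : ℕ) := by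
        have : (l.toFinset ×ˢ Icc (-(h:ℤ)) h).card ≤ (m * (2 * h + 1) : ℕ) := by
          rw [card_product]
          refine Nat.mul_le_mul ((List.toFinset_card_le l).trans hm) ?_
          simp; omega
        exact_mod_cast this
      refine le_trans (sum_biUnion_le P (l.toFinset ×ˢ (Icc (-(h:ℤ)) h)) _ (fun x => by positivity) _
        (fun b x => b.2 ≠ 0 ∧ (b.1:ℤ) ∣ b.2 * x + a) ?_ ((2 + Real.log H) / H0) ?_) ?_
      · rintro x hx ⟨y, hy, hyx, c, hc, hch, hd⟩
        exact ⟨(y, c), by simp [hy]; exact abs_le.1 hch, hc, hd⟩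
      · rintro ⟨y, c⟩ hb
        simp only [mem_product, List.mem_toFinset, mem_Icc] at hb
        by_cases hc : c = 0
        · simp [hc]; positivity
        · simp only [hc, ne_eq, not_false_eq_true, true_and]
          exact ap_sum hH0 hP h hh y (hl y hb.1) c a hc (abs_le.2 hb.2)
      · gcongr
  refine (sum_biUnion_le P (SS l.toFinset h ×ˢ (poss ε rs l ×ˢ poss ε rs l)) _ (fun x => by positivity) _
        _ ?_ _ key).trans ?_
  · rintro x hx ⟨σ, hσ, β, hβ, β', hβ', hh⟩
    exact ⟨(σ, β, β'), by simp [hσ, hβ, hβ'], hh⟩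
  · gcongr
    rw [card_product, card_product, mul_assoc]
    have h1 := card_poss ε rs l
    have h2 : (poss ε rs l).card ≤ m + 1 := by omega
    refine Nat.mul_le_mul ((card_SS _ _).trans ?_) (Nat.mul_le_mul h2 h2)
    have := (List.toFinset_card_le l).trans hm
    gcongr
end bs
end TB
namespace TB
open Finset
section tl
variable {ε : ℕ → ℤ} {rs D : ℕ → Bool} {h : ℕ}
def sg (ε : ℕ → ℤ) (n0 : ℕ) : List ℕ → List (ℤ × ℕ)
  | [] => []
  | p :: e => (ε (e.length + n0), p) :: sg ε n0 e
theorem sg_length (n0 : ℕ) (e : List ℕ) : (sg ε n0 e).length = e.length := by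
  induction e with
  | nil => rfl
  | cons p e ih => simp [sg, ih]
theorem sg_append (n0 : ℕ) (f s : List ℕ) : sg ε n0 (f ++ s) = sg ε (s.length + n0) f ++ sg ε n0 s := by
  induction f with
  | nil => rfl
  | cons p e ih => simp [sg, ih, add_assoc]
theorem sg_abs (hε : ∀ i, |ε i| = 1) (n0 : ℕ) (e : List ℕ) : ∀ a ∈ sg ε n0 e, |a.1| = 1 := by
  induction e with
  | nil => simp [sg]
  | cons p e ih => simp [sg, hε]; exact fun a b hab => ih (a, b) hab
theorem sg_mem (n0 : ℕ) (e : List ℕ) : ∀ a ∈ sg ε n0 e, a.2 ∈ e := by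
  induction e with
  | nil => simp [sg]
  | cons p e ih => simp [sg]; exact fun a b hab => Or.inr (ih (a, b) hab)
theorem coef_sg_notMem (n0 : ℕ) (e : List ℕ) (y : ℕ) (hy : y ∉ e) : coef (sg ε n0 e) y = 0 :=
  coef_eq_zero fun a ha hh => hy (hh ▸ sg_mem n0 e a ha)
theorem coef_sg_nodup (hε : ∀ i, |ε i| = 1) (n0 : ℕ) (e : List ℕ) (he : e.Nodup) (y : ℕ) (hy : y ∈ e) : coef (sg ε n0 e) y ≠ 0 := by
  induction e with
  | nil => simp at hy
  | cons p e ih =>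
    rw [List.nodup_cons] at he
    rw [sg, coef_cons]
    by_cases hp : p = y
    · subst hp
      rw [coef_sg_notMem _ _ _ he.1]
      grind
    · grind
theorem bp_append (e l0 : List ℕ) (hr : ∀ i, l0.length < i → i ≤ l0.length + e.length → rs i = false) :
    bp ε rs (e ++ l0) = bp ε rs l0 + val (sg ε l0.length e) := by
  induction e with
  | nil => simp [sg]
  | cons p e ih =>
    rw [List.cons_append, bp, ih (fun i h1 h2 => hr i h1 (by simp <;> omega)), hr _ (by simp <;> omega) (by simp <;> omega)]
    simp [sg]; ring
theorem seen_cons_dvd {p : ℕ} {b b' : ℤ} {l : List ℕ} (hs : seen D p l) (h1 : cons ε rs D p b l) (h2 : cons ε rs D p b' l) :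
    (p:ℤ) ∣ b - b' := by
  induction l with
  | nil => simp [seen] at hs
  | cons x l ih =>
    rw [cons] at h1 h2
    rcases hs with hs | ⟨hx, hD⟩
    · simp_all
    · have := dvd_sub (h1.2 hx hD) (h2.2 hx hD)
      simpa using this
theorem seen_occ {p : ℕ} {b : ℤ} {l : List ℕ} (hs : seen D p l) (h1 : cons ε rs D p b l) :
    ∃ b' ∈ poss ε rs l, (p:ℤ) ∣ b - b' := by
  induction l with
  | nil => simp [seen] at hs
  | cons x l ih =>
    rw [cons] at h1
    rcases hs with hs | ⟨hx, hD⟩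
    · obtain ⟨b', hb', hd⟩ := ih hs h1.1
      exact ⟨b', by simp [poss, hb'], hd⟩
    · exact ⟨bp ε rs l, by simp [poss, bp_mem_poss], h1.2 hx hD⟩
theorem seen_mem {p : ℕ} {l : List ℕ} (hs : seen D p l) : p ∈ l := by
  induction l with
  | nil => simp [seen] at hs
  | cons x l ih =>
    rcases hs with hs | ⟨hx, hD⟩
    · simp [ih hs]
    · simp [hx]
theorem seen_append_notMem {p : ℕ} {c l : List ℕ} (hc : p ∉ c) : seen D p (c ++ l) ↔ seen D p l := by
  induction c with
  | nil => rfl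
  | cons x c ih =>
    simp only [List.mem_cons, not_or] at hc
    simp [seen, ih hc.2, Ne.symm hc.1]
theorem cons_append {p : ℕ} {b : ℤ} {c l : List ℕ} (hc : cons ε rs D p b (c ++ l)) : cons ε rs D p b l := by
  induction c with
  | nil => exact hc
  | cons x c ih => exact ih hc.1
def GoodC (ε : ℕ → ℤ) (rs D : ℕ → Bool) (h : ℕ) (l0 : List ℕ) : List ℕ → Prop
  | [] => True
  | p :: e => GoodC ε rs D h l0 e ∧ p ∉ e ∧ p ∈ l0 ∧ ¬ special ε rs h l0 p ∧ seen D p l0 ∧ cons ε rs D p (bp ε rs (e ++ l0)) l0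
theorem GoodC_append {l0 f e : List ℕ} (hg : GoodC ε rs D h l0 (f ++ e)) : GoodC ε rs D h l0 e := by
  induction f with
  | nil => exact hg
  | cons x c ih => exact ih hg.1
theorem GoodC_nodup {l0 e : List ℕ} (hg : GoodC ε rs D h l0 e) : e.Nodup := by
  induction e with
  | nil => simp
  | cons x c ih => exact List.nodup_cons.2 ⟨hg.2.1, ih hg.1⟩
theorem GoodC_mem {l0 e : List ℕ} (hg : GoodC ε rs D h l0 e) : ∀ x ∈ e, x ∈ l0 ∧ ¬ special ε rs h l0 x := by
  induction e with
  | nil => simp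
  | cons x c ih =>
    intro z hz
    simp at hz
    rcases hz with rfl | hz
    · exact ⟨hg.2.2.1, hg.2.2.2.1⟩
    · exact ih hg.1 z hz
theorem first_diff {e e' : List ℕ} (hl : e.length = e'.length) (hne : e ≠ e') :
    ∃ f f' s p p', p ≠ p' ∧ e = f ++ p :: s ∧ e' = f' ++ p' :: s := by
  induction e generalizing e' with
  | nil => simp at hl; exact absurd (List.eq_nil_of_length_eq_zero hl.symm).symm hne
  | cons a t ih =>
    cases e' with
    | nil => simp at hl
    | cons a' t' =>
      by_cases ht : t = t'
      · subst ht
        exact ⟨[], [], t, a, a', by rintro rfl; exact hne rfl, rfl, rfl⟩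
      · grind
def ng (lam : List (ℤ × ℕ)) : List (ℤ × ℕ) := lam.map (fun a => (-a.1, a.2))
theorem val_ng (lam) : val (ng lam) = - val lam := by
  induction lam with
  | nil => rfl
  | cons a l ih => simp only [ng, List.map_cons, val_cons] at *; rw [ih]; ring
theorem coef_ng (lam) (y) : coef (ng lam) y = - coef lam y := by
  induction lam with
  | nil => rfl
  | cons a l ih => simp only [ng, List.map_cons, coef_cons] at *; rw [ih]; split_ifs <;> ring
theorem GoodC_unique (hε : ∀ i, |ε i| = 1) {l0 e e' : List ℕ} {y : ℕ} (hpos : ∀ x ∈ l0, 0 < x)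
    (hr : ∀ i, l0.length < i → i ≤ l0.length + e.length → rs i = false)
    (h1 : GoodC ε rs D h l0 (y :: e)) (h2 : GoodC ε rs D h l0 (y :: e')) (hl : e.length = e'.length)
    (hh : 2 * e.length ≤ h) : e = e' := by
  by_contra hne
  obtain ⟨f, f', s, p, p', hpp, he, he'⟩ := first_diff hl hne
  have hps : p ∉ s := by
    have : GoodC ε rs D h l0 (p :: s) := GoodC_append (he ▸ h1.1)
    exact this.2.1
  have hpe : p ∈ e := by simp [he]
  have hpG := GoodC_mem h1.1 p hpe
  by_cases hp : p ∈ e'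
  · have hpf : p ∈ f' := by rw [he'] at hp; simp at hp; tauto
    obtain ⟨f2, f1, hf⟩ := List.append_of_mem hpf
    have hG1 : GoodC ε rs D h l0 (p :: s) := GoodC_append (he ▸ h1.1)
    have hG2 : GoodC ε rs D h l0 (p :: (f1 ++ p' :: s)) := by
      have := h2.1
      rw [he', hf, List.append_assoc] at this
      exact GoodC_append this
    have hd := seen_cons_dvd hG1.2.2.2.2.1 hG2.2.2.2.2.2 hG1.2.2.2.2.2
    have hle1 : s.length ≤ e.length := by simp [he]; omega
    have hle2 : (f1 ++ p' :: s).length ≤ e.length := by simp [hl, he', hf]; omega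
    rw [bp_append _ _ (fun i h3 h4 => hr i h3 (by omega)), bp_append _ _ (fun i h3 h4 => hr i h3 (by omega))] at hd
    have hsp : f1 ++ p' :: s = (f1 ++ [p']) ++ s := by simp
    rw [hsp, sg_append, val_append] at hd
    have hd' : (p:ℤ) ∣ val (sg ε (s.length + l0.length) (f1 ++ [p'])) := by
      convert hd using 1; ring
    have hnd : (f1 ++ [p']).Nodup := by
      have := GoodC_nodup hG2.1
      grind
    have hmem : ∀ x ∈ f1 ++ [p'], x ∈ f1 ++ p' :: s := by intro x hx; rw [hsp]; exact List.mem_append_left _ hx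
    refine coin l0 hpos _ (sg_abs hε _ _) (fun a ha => (GoodC_mem hG2.1 _ (hmem _ (sg_mem _ _ a ha))).1)
      (fun a ha => (GoodC_mem hG2.1 _ (hmem _ (sg_mem _ _ a ha))).2) ?_ p hpG.1 hpG.2 ?_ ⟨p', ?_⟩ hd'
    · rw [sg_length]; simp at hle2 ⊢; omega
    · exact coef_sg_notMem _ _ _ (fun hx => hG2.2.1 (hmem _ hx))
    · exact coef_sg_nodup hε _ _ hnd _ (by simp)
  · have hd := seen_cons_dvd h1.2.2.2.2.1 h1.2.2.2.2.2 h2.2.2.2.2.2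
    rw [bp_append _ _ (fun i h3 h4 => hr i h3 (by omega)), bp_append _ _ (fun i h3 h4 => hr i h3 (by omega))] at hd
    have hd' : (y:ℤ) ∣ val (sg ε l0.length e ++ ng (sg ε l0.length e')) := by
      rw [val_append, val_ng]; convert hd using 1; ring
    refine coin l0 hpos _ ?_ ?_ ?_ ?_ y h1.2.2.1 h1.2.2.2.1 ?_ ⟨p, ?_⟩ hd'
    · intro a ha
      simp only [List.mem_append, ng, List.mem_map] at ha
      rcases ha with ha | ⟨b, hb, rfl⟩
      · exact sg_abs hε _ _ a ha
      · simpa using sg_abs hε _ _ b hb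
    · intro a ha
      simp only [List.mem_append, ng, List.mem_map] at ha
      rcases ha with ha | ⟨b, hb, rfl⟩
      · exact (GoodC_mem h1.1 _ (sg_mem _ _ a ha)).1
      · exact (GoodC_mem h2.1 _ (sg_mem _ _ b hb)).1
    · intro a ha
      simp only [List.mem_append, ng, List.mem_map] at ha
      rcases ha with ha | ⟨b, hb, rfl⟩
      · exact (GoodC_mem h1.1 _ (sg_mem _ _ a ha)).2
      · exact (GoodC_mem h2.1 _ (sg_mem _ _ b hb)).2
    · simp [ng, sg_length]; omega
    · rw [coef_append, coef_ng, coef_sg_notMem _ _ _ h1.2.1, coef_sg_notMem _ _ _ h2.2.1]; simp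
    · rw [coef_append, coef_ng, coef_sg_notMem _ _ _ hp]
      simpa using coef_sg_nodup hε _ _ (GoodC_nodup h1.1) p hpe
open Classical in
noncomputable def typ (ε : ℕ → ℤ) (rs D : ℕ → Bool) (h : ℕ) (l : List ℕ) (p : ℕ) : Fin 5 :=
  if p ∈ l then (if D l.length = true ∧ seen D p l then (if special ε rs h l p then 3 else 4) else 2)
  else if Bad ε rs h l p then 1 else 0
noncomputable def tys (ε : ℕ → ℤ) (rs D : ℕ → Bool) (h : ℕ) : List ℕ → List (Fin 5)
  | [] => []
  | p :: l => typ ε rs D h l p :: tys ε rs D h l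
theorem tys_length (l : List ℕ) : (tys ε rs D h l).length = l.length := by
  induction l with
  | nil => rfl
  | cons p l ih => simp [tys, ih]
theorem tys_append_inj {c l : List ℕ} {k : ℕ} {τ : List (Fin 5)} (hc : c.length = k) 
    (ht : tys ε rs D h (c ++ l) = List.replicate k 4 ++ τ) : tys ε rs D h l = τ := by
  induction c generalizing k with
  | nil => simp at hc; subst hc; simpa using ht
  | cons p c ih =>
    simp at hc; subst hc
    simp only [List.cons_append, tys, List.replicate_succ, List.cons.injEq] at ht
    exact ih rfl ht.2
def SD (J : ℕ) : List ℕ → Prop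
  | [] => True
  | p :: l => SD J l ∧ p ∉ l.take (l.length % J)
theorem SD_append {J : ℕ} {c l : List ℕ} (hs : SD J (c ++ l)) : SD J l := by
  induction c with
  | nil => exact hs
  | cons p c ih => exact ih hs.1
open Classical in
noncomputable def wf (ε : ℕ → ℤ) (rs D : ℕ → Bool) (l : List ℕ) (p : ℕ) : ℝ :=
  if D l.length = true ∧ seen D p l then (if cons ε rs D p (bp ε rs l) l then 1 else 0) else 1 / (p:ℝ)
theorem Wt_cons (p : ℕ) (l : List ℕ) : Wt ε rs D (p :: l) = Wt ε rs D l * wf ε rs D l p := rfl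
theorem typ4 {l : List ℕ} {p : ℕ} (ht : typ ε rs D h l p = 4) : p ∈ l ∧ D l.length = true ∧ seen D p l ∧ ¬ special ε rs h l p := by
  unfold typ at ht
  grind
theorem typ3 {l : List ℕ} {p : ℕ} (ht : typ ε rs D h l p = 3) : p ∈ l ∧ D l.length = true ∧ seen D p l ∧ special ε rs h l p := by
  unfold typ at ht
  grind
theorem typ2 {l : List ℕ} {p : ℕ} (ht : typ ε rs D h l p = 2) : p ∈ l ∧ ¬ (D l.length = true ∧ seen D p l) := by
  unfold typ at ht
  grind
theorem typ1 {l : List ℕ} {p : ℕ} (ht : typ ε rs D h l p = 1) : p ∉ l ∧ Bad ε rs h l p := by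
  unfold typ at ht
  grind
theorem typ0 {l : List ℕ} {p : ℕ} (ht : typ ε rs D h l p = 0) : p ∉ l ∧ ¬ Bad ε rs h l p := by
  unfold typ at ht
  grind
theorem GoodC_of {J k : ℕ} {c l0 : List ℕ} (hmod : ∀ i < c.length, (l0.length + i) % J = l0.length % J + i)
    (hS : SD J (c ++ l0)) (hk : c.length = k) {τ : List (Fin 5)} (ht : tys ε rs D h (c ++ l0) = List.replicate k 4 ++ τ)
    (hW : Wt ε rs D (c ++ l0) ≠ 0) : GoodC ε rs D h l0 c := by
  induction c generalizing k with
  | nil => trivial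
  | cons p c ih =>
    simp at hk; subst hk
    simp only [List.cons_append, tys, List.replicate_succ, List.cons.injEq] at ht
    rw [List.cons_append, Wt_cons] at hW
    have ih' := ih (fun i hi => hmod i (by simp; omega)) hS.1 rfl ht.2 (left_ne_zero_of_mul hW)
    obtain ⟨t1, t2, t3, t4⟩ := typ4 ht.1
    have hpc : p ∉ c := by
      intro hp
      apply hS.2
      have := hmod c.length (by simp)
      change p ∈ List.take ((c ++ l0).length % J) (c ++ l0)
      rw [List.length_append, add_comm, this, List.take_append]
      rw [List.take_of_length_le (by omega)]
      exact List.mem_append_left _ hp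
    have hp0 : p ∈ l0 := by simp at t1; tauto
    refine ⟨ih', hpc, hp0, by rwa [special_append_of_mem hp0] at t4, (seen_append_notMem hpc).1 t3, ?_⟩
    have := right_ne_zero_of_mul hW
    unfold wf at this
    rw [if_pos ⟨t2, t3⟩] at this
    split_ifs at this with h5
    · exact cons_append h5
    · simp at this
end tl
end TB
namespace TB
open Finset
section tl
variable {ε : ℕ → ℤ} {rs D : ℕ → Bool} {h : ℕ} {P : Finset ℕ} {H0 H δ : ℝ} {m : ℕ}
theorem wf_nonneg (l : List ℕ) (p : ℕ) : 0 ≤ wf ε rs D l p := by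
  unfold wf; split_ifs <;> positivity
theorem wf_le_one (l : List ℕ) (p : ℕ) : wf ε rs D l p ≤ 1 := by
  unfold wf; split_ifs
  · exact le_rfl
  · norm_num
  · rw [one_div]; exact Nat.cast_inv_le_one p
noncomputable def lc (P : Finset ℕ) (H0 δ : ℝ) (m : ℕ) (t : Fin 5) : ℝ :=
  if t = 0 then ∑ p ∈ P, (1:ℝ) / p else if t = 1 then δ else if t = 2 then m / H0 else m
open Classical in
theorem lc_bound (hH0 : 0 < H0) (hP : ∀ p ∈ P, H0 ≤ (p : ℝ)) (l : List ℕ) (hl : l.length ≤ m) 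
    (hδ : ∑ x ∈ P.filter (fun x => Bad ε rs h l x), (1:ℝ) / x ≤ δ) (t : Fin 5) :
    ∑ p ∈ P, (if typ ε rs D h l p = t then wf ε rs D l p else 0) ≤ lc P H0 δ m t := by
  have hnew : ∀ p, p ∉ l → wf ε rs D l p = 1 / (p:ℝ) := by
    intro p hp
    unfold wf
    rw [if_neg]
    rintro ⟨_, hs⟩
    exact hp (seen_mem hs)
  have hcard : ∀ c : ℝ, 0 ≤ c → (∀ p ∈ P, typ ε rs D h l p = t → p ∈ l ∧ wf ε rs D l p ≤ c) →
      ∑ p ∈ P, (if typ ε rs D h l p = t then wf ε rs D l p else 0) ≤ m * c := by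
    intro c hc hh
    rw [← sum_filter]
    calc _ ≤ ∑ p ∈ P.filter (fun p => typ ε rs D h l p = t), c := 
          sum_le_sum fun p hp => (hh p (mem_filter.1 hp).1 (mem_filter.1 hp).2).2
      _ ≤ _ := by
        rw [sum_const, nsmul_eq_mul]
        gcongr
        refine le_trans (card_le_card (t := l.toFinset) ?_) ((List.toFinset_card_le l).trans hl)
        intro p hp
        simp_all
  unfold lc
  split_ifs with h0 h1 h2
  · subst h0
    refine sum_le_sum fun p hp => ?_
    split_ifs with ht
    · rw [hnew p (typ0 ht).1]
    · positivity
  · subst h1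
    refine le_trans ?_ hδ
    rw [sum_filter]
    refine sum_le_sum fun p hp => ?_
    split_ifs with ht h5
    · rw [hnew p (typ1 ht).1]
    · exact absurd (typ1 ht).2 h5
    · positivity
    · positivity
  · subst h2
    have := hcard (1 / H0) (by positivity) ?_
    · convert this using 1; ring
    · intro p hp ht
      refine ⟨(typ2 ht).1, ?_⟩
      unfold wf
      rw [if_neg (typ2 ht).2]
      exact one_div_le_one_div_of_le hH0 (hP p hp)
  · have := hcard 1 (by positivity) ?_
    · simpa using this
    · intro p hp ht
      refine ⟨?_, wf_le_one _ _⟩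
      have : t = 3 ∨ t = 4 := (by decide : ∀ t : Fin 5, ¬ t = 0 → ¬ t = 1 → ¬ t = 2 → t = 3 ∨ t = 4) t h0 h1 h2
      rcases this with rfl | rfl
      · exact (typ3 ht).1
      · exact (typ4 ht).1
noncomputable def cst (P : Finset ℕ) (H0 δ : ℝ) (m J : ℕ) : List (Fin 5) → ℝ
  | [] => 1
  | t :: τ => cst P H0 δ m J τ * (if t = 4 then (if τ.length % J = 0 ∨ τ.head? ≠ some 4 then (m:ℝ) else 1) else lc P H0 δ m t)
theorem block_exists (J : ℕ) (hJ : 0 < J) (τ : List (Fin 5)) (ht : τ.head? = some 4) :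
    ∃ k τ0, 1 ≤ k ∧ τ = List.replicate k 4 ++ τ0 ∧ (∀ i < k, (τ0.length + i) % J = τ0.length % J + i) ∧
      cst P H0 δ m J τ = cst P H0 δ m J τ0 * m := by
  induction τ with
  | nil => simp at ht
  | cons t τ ih =>
    simp at ht; subst ht
    by_cases hst : τ.length % J = 0 ∨ τ.head? ≠ some 4
    · refine ⟨1, τ, le_rfl, by simp, ?_, ?_⟩
      · grind
      · rw [cst, if_pos rfl, if_pos hst]
    · push Not at hst
      obtain ⟨k, τ0, hk, h1, h2, h3⟩ := ih hst.2
      refine ⟨k + 1, τ0, by omega, by rw [h1]; simp [List.replicate_succ], ?_, ?_⟩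
      · intro i hi
        by_cases hik : i < k
        · exact h2 i hik
        · have hik' : i = k := by omega
          subst hik'
          have h4 := h2 (i-1) (by omega)
          have h5 : τ.length = (τ0.length + (i - 1)) + 1 := by rw [h1]; simp; omega
          have h6 := hst.1
          have h7 : τ0.length + i = (τ0.length + (i - 1)) + 1 := by omega
          rw [h5] at h6
          rw [h7]
          have h8 : (τ0.length + (i - 1) + 1) % J = ((τ0.length + (i-1)) % J + 1) % J := by simp [Nat.add_mod]
          rw [h8] at h6 ⊢
          have h9 := Nat.mod_lt (τ0.length + (i-1)) hJ
          by_cases h10 : (τ0.length + (i-1)) % J + 1 = J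
          · rw [h10] at h6; simp at h6
          · rw [Nat.mod_eq_of_lt (by omega), h4]; omega
      · rw [cst, if_pos rfl, if_neg (by push Not; exact hst), h3, mul_one]
theorem Wt_append_le (c l : List ℕ) : Wt ε rs D (c ++ l) ≤ Wt ε rs D l := by
  induction c with
  | nil => exact le_rfl
  | cons p c ih =>
    rw [List.cons_append, Wt_cons]
    exact (mul_le_of_le_one_right (Wt_nonneg _ _ _ _) (wf_le_one _ _)).trans ih
theorem list_ne_nil_of {c : List ℕ} {k : ℕ} (hk : 1 ≤ k) (hc : c.length = k) : ∃ y e, c = y :: e ∧ e.length + 1 = k := by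
  cases c with
  | nil => simp at hc; omega
  | cons y e => exact ⟨y, e, rfl, by simpa using hc⟩
open Classical in
theorem T_lemma (hH0 : 0 < H0) (hP : ∀ p ∈ P, H0 ≤ (p : ℝ)) (hε : ∀ i, |ε i| = 1) (hrs : ∀ i, rs i = false) (J : ℕ) (hJ : 0 < J)
    (hJh : 2 * J ≤ h) (hδ0 : 0 ≤ δ)
    (hδ : ∀ l : List ℕ, (∀ x ∈ l, x ∈ P) → l.length ≤ m → ∑ x ∈ P.filter (fun x => Bad ε rs h l x), (1:ℝ) / x ≤ δ)
    (n : ℕ) (τ : List (Fin 5)) (hτ : τ.length = n) (hn : n ≤ m) :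
    ∑ l ∈ wds P n, (if SD J l ∧ tys ε rs D h l = τ then Wt ε rs D l else 0) ≤ cst P H0 δ m J τ := by
  have hlcn : ∀ t, 0 ≤ lc P H0 δ m t := by
    intro t; unfold lc; split_ifs <;> positivity
  induction n using Nat.strong_induction_on generalizing τ with
  | _ n ih =>
    cases τ with
    | nil =>
      simp at hτ; subst hτ
      rw [sum_wds_zero]; simp [SD, tys, Wt, cst]
    | cons t τ =>
      by_cases ht : t = 4
      · subst ht
        obtain ⟨k, τ0, hk, h1, h2, h3⟩ := block_exists (P := P) (H0 := H0) (δ := δ) (m := m) J hJ (4 :: τ) (by simp)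
        have hn' : n = k + τ0.length := by rw [← hτ, h1]; simp
        rw [h3, hn', sum_wds_add]
        have ih' := ih τ0.length (by omega) τ0 rfl (by omega)
        have hkJ : k ≤ J := by
          have := h2 (k-1) (by omega)
          have h4 := Nat.mod_lt (τ0.length + (k-1)) hJ
          omega
        calc _ ≤ ∑ l ∈ wds P τ0.length, (if SD J l ∧ tys ε rs D h l = τ0 then Wt ε rs D l else 0) * m := by
              refine sum_le_sum fun l hl => ?_
              rw [mem_wds] at hl
              by_cases hv : SD J l ∧ tys ε rs D h l = τ0
              · rw [if_pos hv]
                rw [h1]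
                set V := (wds P k).filter (fun c => (SD J (c ++ l) ∧ tys ε rs D h (c ++ l) = List.replicate k 4 ++ τ0) ∧ Wt ε rs D (c ++ l) ≠ 0) with hV
                have hVc : V.card ≤ m := by
                  refine le_trans (card_le_card_of_injOn (t := l.toFinset) (fun c => c.headD 0) ?_ ?_) ((List.toFinset_card_le l).trans (by omega))
                  · intro c hc
                    simp only [hV, coe_filter, Set.mem_setOf_eq, mem_wds] at hc
                    obtain ⟨⟨hc1, hc2⟩, ⟨hc3, hc4⟩, hc5⟩ := hc
                    have hG := GoodC_of (J := J) (k := k) (by rw [hl.1, hc1]; exact h2) hc3 hc1 hc4 hc5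
                    obtain ⟨y, e, rfl, he⟩ := list_ne_nil_of hk hc1
                    simpa using hG.2.2.1
                  · intro c hc c' hc' hcc
                    simp only [hV, coe_filter, Set.mem_setOf_eq, mem_wds] at hc hc'
                    obtain ⟨⟨hc1, hc2⟩, ⟨hc3, hc4⟩, hc5⟩ := hc
                    obtain ⟨⟨hc1', hc2'⟩, ⟨hc3', hc4'⟩, hc5'⟩ := hc'
                    have hG := GoodC_of (J := J) (k := k) (by rw [hl.1, hc1]; exact h2) hc3 hc1 hc4 hc5
                    have hG' := GoodC_of (J := J) (k := k) (by rw [hl.1, hc1']; exact h2) hc3' hc1' hc4' hc5'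
                    obtain ⟨y, e, rfl, he⟩ := list_ne_nil_of hk hc1
                    obtain ⟨y', e', rfl, he'⟩ := list_ne_nil_of hk hc1'
                    simp at hcc; subst hcc
                    rw [GoodC_unique hε (fun x hx => ?_) (fun i _ _ => hrs i) hG hG' (by omega) (by omega)]
                    have := hP x (hl.2 x hx)
                    have h7 : (0:ℝ) < x := by linarith
                    exact_mod_cast h7
                calc _ = ∑ c ∈ V, Wt ε rs D (c ++ l) := by
                      rw [hV, sum_filter]
                      grind
                  _ ≤ ∑ c ∈ V, Wt ε rs D l := sum_le_sum fun c _ => Wt_append_le c l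
                  _ ≤ _ := by
                      rw [sum_const, nsmul_eq_mul, mul_comm]
                      have := Wt_nonneg ε rs D l
                      gcongr
              · rw [if_neg hv, zero_mul]
                refine (sum_nonpos fun c hc => ?_)
                rw [if_neg]
                rintro ⟨h5, h6⟩
                exact hv ⟨SD_append h5, tys_append_inj (mem_wds.1 hc).1 (h1 ▸ h6)⟩
          _ ≤ _ := by
              rw [← sum_mul]
              gcongr
      · simp at hτ
        subst hτ
        rw [sum_wds_succ]
        have ih' := ih τ.length (by omega) τ rfl (by omega)
        rw [cst, if_neg ht]
        calc _ ≤ ∑ l ∈ wds P τ.length, (if SD J l ∧ tys ε rs D h l = τ then Wt ε rs D l else 0) * lc P H0 δ m t := by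
              refine sum_le_sum fun l hl => ?_
              rw [mem_wds] at hl
              refine le_trans ?_ (mul_le_mul_of_nonneg_left (lc_bound (ε := ε) (rs := rs) (D := D) (h := h) hH0 hP l (by omega) (hδ l hl.2 (by omega)) t) ?_)
              · rw [mul_sum]
                refine sum_le_sum fun p hp => ?_
                by_cases hv : SD J (p :: l) ∧ tys ε rs D h (p :: l) = t :: τ
                · rw [if_pos hv]
                  simp only [SD, tys, List.cons.injEq] at hv
                  rw [if_pos ⟨hv.1.1, hv.2.2⟩, if_pos hv.2.1, Wt_cons]
                · rw [if_neg hv]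
                  refine mul_nonneg ?_ ?_
                  · split_ifs; exact Wt_nonneg _ _ _ _; exact le_rfl
                  · split_ifs; exact wf_nonneg _ _; exact le_rfl
              · split_ifs; exact Wt_nonneg _ _ _ _; exact le_rfl
          _ ≤ _ := by
              rw [← sum_mul]
              exact mul_le_mul_of_nonneg_right ih' (hlcn t)
end tl
end TB
namespace TB
open Finset
section tl
variable {ε : ℕ → ℤ} {rs D : ℕ → Bool} {h : ℕ} {P : Finset ℕ} {H0 H δ : ℝ} {m : ℕ}
def stc (J : ℕ) : List (Fin 5) → ℕ
  | [] => 0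
  | t :: τ => stc J τ + (if t = 4 ∧ (τ.length % J = 0 ∨ τ.head? ≠ some 4) then 1 else 0)
theorem cst_eq (J : ℕ) (τ : List (Fin 5)) : cst P H0 δ m J τ =
    (∑ p ∈ P, (1:ℝ)/p) ^ (τ.count 0) * δ ^ (τ.count 1) * (m / H0) ^ (τ.count 2) * (m:ℝ) ^ (τ.count 3 + stc J τ) := by
  induction τ with
  | nil => simp [cst, stc]
  | cons t τ ih =>
    rw [cst, ih, stc]
    have : t = 0 ∨ t = 1 ∨ t = 2 ∨ t = 3 ∨ t = 4 := by revert t; decide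
    rcases this with rfl | rfl | rfl | rfl | rfl
    · simp [lc]; ring
    · simp [lc]; ring
    · simp [lc]; ring
    · simp [lc]; ring
    · by_cases hq : τ.length % J = 0 ∨ τ.head? ≠ some 4
      · simp only [hq, if_true, true_and, List.count_cons]; simp; ring
      · simp_all
def brk (J n : ℕ) : ℕ := ((range n).filter (fun i => i % J = 0)).card
theorem brk_succ (J n : ℕ) : brk J (n+1) = brk J n + (if n % J = 0 then 1 else 0) := by
  unfold brk
  rw [range_add_one, filter_insert]
  grind
theorem brk_mul (J g : ℕ) (hJ : 0 < J) : brk J (g * J) ≤ g := by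
  unfold brk
  refine (card_le_card_of_injOn (t := range g) (fun i => i / J) ?_ ?_).trans (by simp)
  · intro i hi
    simp only [coe_filter, Set.mem_setOf_eq, mem_range] at hi
    simp only [coe_range, Set.mem_Iio]
    exact Nat.div_lt_of_lt_mul (by rw [mul_comm]; exact hi.1)
  · intro i hi j hj hij
    simp only [coe_filter, Set.mem_setOf_eq, mem_range] at hi hj
    have h1 := Nat.div_add_mod i J
    have h2 := Nat.div_add_mod j J
    grind
theorem no_new_rep (hε : ∀ i, |ε i| = 1) (hh : 1 ≤ h) {l0 : List ℕ} {x p : ℕ} (hrs : rs (l0.length + 1) = false)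
    (hx : ¬ Bad ε rs h l0 x) (hpx : p ≠ x) (hs : seen D p (x :: l0)) (hc : cons ε rs D p (bp ε rs (x :: l0)) (x :: l0)) : False := by
  rw [bp, hrs] at hc
  have hs' : seen D p l0 := by
    rcases hs with hs | ⟨h1, _⟩
    · exact hs
    · exact absurd h1.symm hpx
  obtain ⟨b, hb, hd⟩ := seen_occ hs' hc.1
  refine hx ⟨0, ?_, bp ε rs l0, bp_mem_poss _ _ _, b, hb, Or.inr ⟨p, seen_mem hs', hpx, ε l0.length, ?_, ?_, ?_⟩⟩
  · exact val_mem_SS _ _ [] (by simp) (by simp) (by simp)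
  · grind
  · rw [hε]; exact_mod_cast hh
  · simp at hd
    convert hd using 1; ring
theorem stc_bound (hε : ∀ i, |ε i| = 1) (hh : 1 ≤ h) (hrs : ∀ i, rs i = false) (J : ℕ) (l : List ℕ) (hS : SD J l) (hW : Wt ε rs D l ≠ 0) :
    stc J (tys ε rs D h l) + (if (tys ε rs D h l).head? = some 1 ∨ (tys ε rs D h l).head? = some 2 ∨ (tys ε rs D h l).head? = some 3 then 1 else 0)
      ≤ brk J l.length + (tys ε rs D h l).count 1 + (tys ε rs D h l).count 2 + (tys ε rs D h l).count 3 := by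
  induction l with
  | nil => simp [tys, stc]
  | cons p l ih =>
    rw [Wt_cons] at hW
    have ih' := ih hS.1 (left_ne_zero_of_mul hW)
    rw [List.length_cons, brk_succ]
    simp only [tys, stc, tys_length]
    set τ := tys ε rs D h l with hτ
    have h5 : typ ε rs D h l p = 0 ∨ typ ε rs D h l p = 1 ∨ typ ε rs D h l p = 2 ∨ typ ε rs D h l p = 3 ∨ typ ε rs D h l p = 4 := by
      grind
    rcases h5 with h5 | h5 | h5 | h5 | h5
    · simp [h5]; omega
    · simp [h5]; omega
    · simp [h5]; omega
    · simp [h5]; omega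
    · simp only [h5, List.head?_cons]
      by_cases hb : l.length % J = 0
      · simp [hb]; omega
      · by_cases hd : τ.head? = some 4
        · simp_all
        · cases l with
          | nil => simp at hb
          | cons x l0 =>
            have h6 : τ.head? = some (typ ε rs D h l0 x) := by simp [hτ, tys]
            rw [h6] at hd ih' ⊢
            have h7 : typ ε rs D h l0 x ≠ 0 := by
              intro h0
              obtain ⟨t1, t2, t3, t4⟩ := typ4 h5
              have hw := right_ne_zero_of_mul hW
              unfold wf at hw
              rw [if_pos ⟨t2, t3⟩] at hw
              have hc : cons ε rs D p (bp ε rs (x :: l0)) (x :: l0) := by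
                grind
              refine no_new_rep hε hh (hrs _) (typ0 h0).2 ?_ t3 hc
              rintro rfl
              apply hS.2
              obtain ⟨r, hr⟩ := Nat.exists_eq_succ_of_ne_zero hb
              rw [hr]; simp
            have h8 : typ ε rs D h l0 x = 1 ∨ typ ε rs D h l0 x = 2 ∨ typ ε rs D h l0 x = 3 := by
              revert h7 hd; generalize typ ε rs D h l0 x = t; clear * -; revert t; decide
            simp_all
theorem count_SD (J : ℕ) (hJ : 0 < J) (z : ℕ) (l : List ℕ) (hS : SD J l) :
    l.count z ≤ l.length / J + (if z ∈ l.take (l.length % J) then 1 else 0) := by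
  induction l with
  | nil => simp
  | cons p l ih =>
    have ih' := ih hS.1
    have hp := hS.2
    rw [List.count_cons, List.length_cons]
    have hlt := Nat.mod_lt l.length hJ
    have hz : (if (p == z) = true then 1 else 0) + (if z ∈ l.take (l.length % J) then 1 else 0) ≤ 1 := by
      grind
    by_cases hr : l.length % J + 1 = J
    · have h1 : (l.length + 1) / J = l.length / J + 1 := by
        have := Nat.div_add_mod l.length J
        have h2 : l.length + 1 = J * (l.length / J + 1) := by rw [mul_add]; omega
        simp_all
      rw [h1]; omega
    · have h3 := Nat.div_add_mod l.length J
      have h1 : (l.length + 1) % J = l.length % J + 1 := by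
        rw [Nat.add_mod, Nat.mod_eq_of_lt (a := 1) (by omega), Nat.mod_eq_of_lt (by omega)]
      have h4 := Nat.div_add_mod (l.length+1) J
      have h5 : (l.length + 1) / J = l.length / J := by
        rw [h1] at h4
        have : J * ((l.length + 1) / J) = J * (l.length / J) := by omega
        exact Nat.eq_of_mul_eq_mul_left hJ this
      grind
open Classical in
theorem count3_bound (l : List ℕ) : (tys ε rs D h l).count 3 ≤ (l.filter (fun z => special ε rs h l z)).length := by
  induction l with
  | nil => simp [tys]
  | cons p l ih =>
    rw [tys, List.count_cons]
    have h1 : l.filter (fun z => decide (special ε rs h (p :: l) z)) = l.filter (fun z => decide (special ε rs h l z)) := by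
      refine List.filter_congr fun z hz => ?_
      simp [special_cons_of_mem hz]
    rw [List.filter_cons, h1]
    by_cases h3 : typ ε rs D h l p = 3
    · obtain ⟨t1, _, _, t4⟩ := typ3 h3
      have := (special_cons_of_mem (p := p) t1).2 t4
      simp [h3, this]; simpa using ih
    · grind
open Classical in
theorem count1_eq (l : List ℕ) : (l.toFinset.filter (fun z => special ε rs h l z)).card ≤ (tys ε rs D h l).count 1 := by
  induction l with
  | nil => simp [tys]
  | cons p l ih =>
    rw [tys, List.count_cons, List.toFinset_cons]
    have h1 : l.toFinset.filter (fun z => special ε rs h (p :: l) z) = l.toFinset.filter (fun z => special ε rs h l z) := by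
      refine filter_congr fun z hz => ?_
      exact special_cons_of_mem (by simpa using hz)
    by_cases hp : p ∈ l
    · rw [insert_eq_of_mem (by simpa using hp), h1]; omega
    · rw [filter_insert, h1]
      split_ifs with h2 h3 h3
      · grind
      · exfalso
        apply h3
        rw [special_cons_self hp] at h2
        simp [typ, hp, h2]
      · omega
      · omega
theorem count01 (l : List ℕ) : (tys ε rs D h l).count 0 + (tys ε rs D h l).count 1 = l.toFinset.card := by
  induction l with
  | nil => simp [tys]
  | cons p l ih =>
    rw [tys, List.count_cons, List.count_cons, List.toFinset_cons]
    by_cases hp : p ∈ l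
    · rw [insert_eq_of_mem (by simpa using hp), ← ih]
      have : typ ε rs D h l p ≠ 0 ∧ typ ε rs D h l p ≠ 1 := 
        ⟨fun h0 => (typ0 h0).1 hp, fun h0 => (typ1 h0).1 hp⟩
      simp [this]
    · rw [card_insert_of_notMem (by simpa using hp), ← ih]
      by_cases hb : Bad ε rs h l p
      · have : typ ε rs D h l p = 1 := by simp [typ, hp, hb]
        simp [this]; omega
      · have : typ ε rs D h l p = 0 := by simp [typ, hp, hb]
        simp [this]; omega
def nonlone (l : List ℕ) : Prop := ∀ z ∈ l, 2 ≤ l.count z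
open Classical in
theorem T_sum (hH0 : 0 < H0) (hP : ∀ p ∈ P, H0 ≤ (p : ℝ)) (hε : ∀ i, |ε i| = 1) (hrs : ∀ i, rs i = false) (J g : ℕ) (hJ : 0 < J)
    (hJh : 2 * J ≤ h) (hδ0 : 0 ≤ δ) (hm : m = g * J) (hm1 : 1 ≤ m)
    (hδ : ∀ l : List ℕ, (∀ x ∈ l, x ∈ P) → l.length ≤ m → ∑ x ∈ P.filter (fun x => Bad ε rs h l x), (1:ℝ) / x ≤ δ)
    (hL : 1 ≤ ∑ p ∈ P, (1:ℝ) / p) (hd1 : δ * (m:ℝ) ^ (2 * g + 1) ≤ 1) (hd2 : (m:ℝ) ^ 2 / H0 ≤ 1) :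
    ∑ l ∈ wds P m, (if SD J l ∧ nonlone l then Wt ε rs D l else 0) ≤ 5 ^ m * ((∑ p ∈ P, (1:ℝ) / p) ^ (m / 2) * (m:ℝ) ^ g) := by
  set L := ∑ p ∈ P, (1:ℝ) / p
  have hm1' : (1:ℝ) ≤ m := by exact_mod_cast hm1
  have hreal : ∀ l, l.length = m → SD J l → nonlone l → Wt ε rs D l ≠ 0 → cst P H0 δ m J (tys ε rs D h l) ≤ L ^ (m / 2) * (m:ℝ) ^ g := by
    intro l hlm hS hn hW
    rw [cst_eq]
    set c0 := (tys ε rs D h l).count 0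
    set c1 := (tys ε rs D h l).count 1
    set c2 := (tys ε rs D h l).count 2
    set c3 := (tys ε rs D h l).count 3
    set st := stc J (tys ε rs D h l)
    have h1 : st ≤ g + c1 + c2 + c3 := by
      have h2 := stc_bound (D := D) (h := h) hε (by omega) hrs J l hS hW
      have h3 := brk_mul J g hJ
      grind
    have h4 : c3 ≤ c1 * g := by
      have h5 := count3_bound (ε := ε) (rs := rs) (D := D) (h := h) l
      have h6 := count1_eq (ε := ε) (rs := rs) (D := D) (h := h) l
      refine h5.trans (le_trans ?_ (Nat.mul_le_mul_right g h6))
      rw [← List.sum_toFinset_count_eq_length, List.toFinset_filter]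
      have h7 : (filter (fun z => special ε rs h l z) l.toFinset) = filter (fun x => decide (special ε rs h l x) = true) l.toFinset := by
        simp
      rw [h7, ← smul_eq_mul]
      refine sum_le_card_nsmul _ _ _ fun z hz => ?_
      refine ((List.filter_sublist (l := l)).count_le z).trans ?_
      have h8 := count_SD J hJ z l hS
      rw [hlm, hm] at h8
      simpa [Nat.mul_div_cancel _ hJ] using h8
    have h9 : c0 + c1 ≤ m / 2 := by
      have h10 := count01 (ε := ε) (rs := rs) (D := D) (h := h) l
      have h11 := List.sum_toFinset_count_eq_length l
      have h12 : l.toFinset.card * 2 ≤ ∑ a ∈ l.toFinset, l.count a := by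
        rw [← smul_eq_mul]
        exact card_nsmul_le_sum _ _ _ fun z hz => hn z (by simpa using hz)
      grind
    calc L ^ c0 * δ ^ c1 * (m / H0) ^ c2 * (m:ℝ) ^ (c3 + st) 
        ≤ L ^ c0 * δ ^ c1 * (m / H0) ^ c2 * (m:ℝ) ^ (g + (2 * g + 1) * c1 + c2) := by
          have : c3 + st ≤ g + (2 * g + 1) * c1 + c2 := by nlinarith
          gcongr
      _ = L ^ c0 * (δ * (m:ℝ) ^ (2 * g + 1)) ^ c1 * ((m:ℝ) ^ 2 / H0) ^ c2 * (m:ℝ) ^ g := by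
          rw [pow_add, pow_add, mul_pow, pow_mul, div_pow, div_pow]; ring
      _ ≤ L ^ c0 * 1 * 1 * (m:ℝ) ^ g := by
          gcongr
          · exact pow_le_one₀ (by positivity) hd1
          · exact pow_le_one₀ (by positivity) hd2
      _ ≤ L ^ (m/2) * (m:ℝ) ^ g := by
          rw [mul_one, mul_one]
          have := pow_le_pow_right₀ hL (show c0 ≤ m / 2 by omega)
          gcongr
  calc ∑ l ∈ wds P m, (if SD J l ∧ nonlone l then Wt ε rs D l else 0) 
      = ∑ τ ∈ wds (univ : Finset (Fin 5)) m, ∑ l ∈ wds P m, (if (SD J l ∧ nonlone l) ∧ tys ε rs D h l = τ then Wt ε rs D l else 0) := by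
        rw [sum_comm]
        refine sum_congr rfl fun l hl => ?_
        rw [sum_eq_single (tys ε rs D h l)]
        · simp
        · grind
        · intro h2
          exact absurd (mem_wds.2 ⟨by rw [tys_length, (mem_wds.1 hl).1], by simp⟩) h2
    _ ≤ ∑ τ ∈ wds (univ : Finset (Fin 5)) m, L ^ (m / 2) * (m:ℝ) ^ g := by
        refine sum_le_sum fun τ hτ => ?_
        by_cases hex : ∃ l, l.length = m ∧ SD J l ∧ nonlone l ∧ Wt ε rs D l ≠ 0 ∧ tys ε rs D h l = τ
        · obtain ⟨l, h1, h2, h3, h4, h5⟩ := hex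
          refine le_trans ?_ (h5 ▸ hreal l h1 h2 h3 h4)
          refine le_trans ?_ (T_lemma (ε := ε) (rs := rs) (D := D) hH0 hP hε hrs J hJ hJh hδ0 hδ m τ (mem_wds.1 hτ).1 le_rfl)
          refine sum_le_sum fun l _ => ?_
          split_ifs with h6 h7 h7
          · exact le_rfl
          · grind
          · exact Wt_nonneg _ _ _ _
          · exact le_rfl
        · refine le_trans (sum_nonpos fun l hl => ?_) (by positivity)
          split_ifs with h6
          · by_contra h7
            exact hex ⟨l, (mem_wds.1 hl).1, h6.1.1, h6.1.2, by linarith, h6.2⟩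
          · exact le_rfl
    _ = _ := by
        rw [sum_const, card_wds, nsmul_eq_mul]; simp
end tl
end TB
namespace TB
open Finset
section mom
variable {ε : ℕ → ℤ} {rs D : ℕ → Bool} {h : ℕ} {P : Finset ℕ} {H0 δ : ℝ} {m : ℕ}
open Classical in
noncomputable def gn (ε : ℕ → ℤ) (rs D : ℕ → Bool) (h : ℕ) : List ℕ → ℕ
  | [] => 0
  | p :: l => gn ε rs D h l + (if typ ε rs D h l p = 1 ∨ typ ε rs D h l p = 2 then 1 else 0)
theorem gn_append (e l : List ℕ) : gn ε rs D h l ≤ gn ε rs D h (e ++ l) := by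
  induction e with
  | nil => simp
  | cons p e ih => simp only [List.cons_append, gn]; omega
open Classical in
theorem gf_bound (hH0 : 0 < H0) (hP : ∀ p ∈ P, H0 ≤ (p : ℝ)) (hδ0 : 0 < δ) (hmδ : m / H0 ≤ δ)
    (hδ : ∀ l : List ℕ, (∀ x ∈ l, x ∈ P) → l.length ≤ m → ∑ x ∈ P.filter (fun x => Bad ε rs h l x), (1:ℝ) / x ≤ δ)
    (n : ℕ) (hn : n ≤ m) :
    ∑ l ∈ wds P n, Wt ε rs D l * (1/δ) ^ gn ε rs D h l ≤ (∑ p ∈ P, (1:ℝ) / p + 2 + 2 * m) ^ n := by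
  induction n with
  | zero => simp [sum_wds_zero, Wt, gn]
  | succ n ih =>
    rw [sum_wds_succ, pow_succ]
    refine le_trans (b := ∑ l ∈ wds P n, (Wt ε rs D l * (1/δ) ^ gn ε rs D h l) * (∑ p ∈ P, (1:ℝ) / p + 2 + 2 * m)) ?_ ?_
    · refine sum_le_sum fun l hl => ?_
      obtain ⟨hl1, hl2⟩ := mem_wds.1 hl
      have key : ∀ p, Wt ε rs D (p :: l) * (1/δ) ^ gn ε rs D h (p :: l) =
          (Wt ε rs D l * (1/δ) ^ gn ε rs D h l) * ∑ t : Fin 5, (if typ ε rs D h l p = t then wf ε rs D l p else 0) * (if t = 1 ∨ t = 2 then 1/δ else 1) := by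
        intro p
        rw [Wt_cons, gn, pow_add]
        simp only [ite_mul, zero_mul, sum_ite_eq, mem_univ, if_true]
        split_ifs <;> simp <;> ring
      simp_rw [key]
      rw [← mul_sum, sum_comm]
      refine mul_le_mul_of_nonneg_left ?_ (mul_nonneg (Wt_nonneg _ _ _ _) (by positivity))
      simp_rw [← sum_mul]
      have hb := fun t => lc_bound (ε := ε) (rs := rs) (D := D) (h := h) hH0 hP l (by omega : l.length ≤ m) (hδ l hl2 (by omega)) t
      have h0 := hb 0
      have h1 := hb 1
      have h2 := hb 2
      have h3 := hb 3
      have h4 := hb 4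
      simp [Fin.sum_univ_five]
      simp [lc] at h0 h1 h2 h3 h4
      have h1' := mul_le_mul_of_nonneg_right h1 (inv_nonneg.2 hδ0.le)
      have h2' := mul_le_mul_of_nonneg_right (h2.trans hmδ) (inv_nonneg.2 hδ0.le)
      rw [mul_inv_cancel₀ hδ0.ne'] at h1' h2'
      linarith
    · rw [← sum_mul]
      refine mul_le_mul_of_nonneg_right (ih (by omega)) ?_
      positivity
def Sh (q : ℕ) (w : List ℕ) : Prop :=
  (∃ q' y u, w = q' :: (y ++ q' :: u) ∧ y ≠ [] ∧ y.Nodup ∧ q' ∉ y) ∨ w.head? = some q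
def AllSh (q ℓ : ℕ) : ℕ → List ℕ → Prop
  | 0, l => l = []
  | v+1, l => ∃ w x l', l = w ++ x :: l' ∧ w.length = ℓ ∧ Sh q w ∧ AllSh q ℓ v l'
theorem AllSh_length {q ℓ v : ℕ} {l : List ℕ} (hA : AllSh q ℓ v l) : l.length = v * (ℓ + 1) := by
  induction v generalizing l with
  | zero => simp [AllSh] at hA; simp [hA]
  | succ v ih =>
    obtain ⟨w, x, l', rfl, hw, _, hA'⟩ := hA
    simp [ih hA', hw]; ring
def rsS (ℓ : ℕ) : ℕ → Bool := fun i => decide (i % (ℓ + 1) = 0)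
def DS (ℓ : ℕ) : ℕ → Bool := fun i => decide (i % (ℓ + 1) ≠ 0)
theorem Wt_ne_append {c l : List ℕ} (hw : Wt ε rs D (c ++ l) ≠ 0) : Wt ε rs D l ≠ 0 := by
  intro h0
  exact hw (le_antisymm ((Wt_append_le c l).trans h0.le) (Wt_nonneg _ _ _ _))
theorem cons_of_Wt {p : ℕ} {l : List ℕ} (hw : Wt ε rs D (p :: l) ≠ 0) (hD : D l.length = true) (hs : seen D p l) :
    cons ε rs D p (bp ε rs l) l := by
  by_contra hc
  apply hw
  rw [Wt_cons, wf, if_pos ⟨hD, hs⟩, if_neg hc, mul_zero]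
theorem gn_cons_eq {p : ℕ} {l : List ℕ} (hg : ¬ (typ ε rs D h l p = 1 ∨ typ ε rs D h l p = 2)) :
    typ ε rs D h l p = 0 ∨ typ ε rs D h l p = 3 ∨ typ ε rs D h l p = 4 := by
  grind
theorem seg_inv {ℓ v : ℕ} (hε : ∀ i, |ε i| = 1) (hh : ℓ + 1 ≤ h) (x : ℕ) (r e : List ℕ) (hr : r.length = v * (ℓ + 1)) (he : e.length ≤ ℓ)
    (hW : Wt ε (rsS ℓ) (DS ℓ) (e ++ x :: r) ≠ 0) (hg : gn ε (rsS ℓ) (DS ℓ) h (e ++ x :: r) = gn ε (rsS ℓ) (DS ℓ) h r) :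
    x ∉ r ∧ (∀ p ∈ e, p ∉ r ∧ p ≠ x) ∧ ∀ p ∈ e ++ [x], ¬ special ε (rsS ℓ) h (e ++ x :: r) p := by
  induction e with
  | nil =>
    have hD : DS ℓ r.length = false := by simp [DS, hr]
    have ht : typ ε (rsS ℓ) (DS ℓ) h r x = 0 := by
      simp only [List.nil_append, gn] at hg
      have := gn_cons_eq (ε := ε) (rs := rsS ℓ) (D := DS ℓ) (h := h) (p := x) (l := r) (by intro hc; rw [if_pos hc] at hg; omega)
      rcases this with h0 | h0 | h0
      · exact h0
      · have := (typ3 h0).2.1; simp [hD] at this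
      · have := (typ4 h0).2.1; simp [hD] at this
    obtain ⟨h1, h2⟩ := typ0 ht
    refine ⟨h1, by simp, ?_⟩
    intro p hp; simp at hp; subst hp
    simpa [special, h1] using h2
  | cons p e ih =>
    simp only [List.cons_append, List.length_cons] at *
    have hg1 := gn_append (ε := ε) (rs := rsS ℓ) (D := DS ℓ) (h := h) (e ++ [x]) r
    simp only [List.append_assoc, List.singleton_append] at hg1
    have hge : gn ε (rsS ℓ) (DS ℓ) h (e ++ x :: r) = gn ε (rsS ℓ) (DS ℓ) h r := by
      simp only [gn] at hg; omega
    have ht := gn_cons_eq (ε := ε) (rs := rsS ℓ) (D := DS ℓ) (h := h) (p := p) (l := e ++ x :: r) (by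
      intro hc; simp only [gn] at hg; rw [if_pos hc] at hg; omega)
    obtain ⟨i1, i2, i3⟩ := ih (by omega) (Wt_ne_append (c := [p]) hW) hge
    have hlen : (e ++ x :: r).length = v * (ℓ+1) + (e.length + 1) := by simp [hr]; ring
    have hD : DS ℓ (e ++ x :: r).length = true := by
      simp [DS, hlen, Nat.mod_eq_of_lt (show e.length + 1 < ℓ + 1 by omega)]
    have hDr : DS ℓ r.length = false := by simp [DS, hr]
    have hxe : x ∉ e := fun hx => (i2 x hx).2 rfl
    refine ⟨i1, ?_⟩
    have hpx : p ≠ x := by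
      rintro rfl
      have hns : ¬ seen (DS ℓ) p (e ++ p :: r) := by
        rw [seen_append_notMem hxe, seen]
        simp [hDr]
        exact fun hs => i1 (seen_mem hs)
      rcases ht with h0 | h0 | h0
      · exact (typ0 h0).1 (by simp)
      · exact hns (typ3 h0).2.2.1
      · exact hns (typ4 h0).2.2.1
    have hns : ¬ special ε (rsS ℓ) h (p :: (e ++ x :: r)) p ∧ p ∉ r := by
      by_cases hpn : p ∈ e ++ x :: r
      · have hseen : seen (DS ℓ) p (e ++ x :: r) := by
          rcases ht with h0 | h0 | h0
          · exact absurd hpn (typ0 h0).1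
          · exact (typ3 h0).2.2.1
          · exact (typ4 h0).2.2.1
        have hpr : p ∉ r := by
          intro hpr
          have hpe : p ∉ e := fun hpe => (i2 p hpe).1 hpr
          have hc := cons_of_Wt hW hD hseen
          have hs' : seen (DS ℓ) p r := by
            rw [seen_append_notMem hpe] at hseen
            rcases hseen with hs | ⟨h1, _⟩
            · exact hs
            · exact absurd h1.symm hpx
          have hc' : cons ε (rsS ℓ) (DS ℓ) p (bp ε (rsS ℓ) (e ++ x :: r)) r := (cons_append hc).1
          obtain ⟨b', hb', hd⟩ := seen_occ hs' hc'
          have hbp := bp_append (ε := ε) (rs := rsS ℓ) (e ++ [x]) r (by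
            intro i hi1 hi2
            simp [hr] at hi1 hi2
            obtain ⟨j, rfl⟩ := Nat.exists_eq_add_of_lt hi1
            have : (v * (ℓ+1) + j + 1) % (ℓ+1) = j + 1 := by
              rw [show v * (ℓ+1) + j + 1 = (j+1) + v * (ℓ+1) by ring, Nat.add_mul_mod_self_right]
              exact Nat.mod_eq_of_lt (by omega)
            simp [rsS, this])
          simp only [List.append_assoc, List.singleton_append] at hbp
          rw [hbp] at hd
          refine coin2 (ε := ε) (rs := rsS ℓ) (h := h) (e ++ [x]) r (sg ε r.length (e ++ [x])) (sg_abs hε _ _) ?_ ?_ ?_ p hpr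
            (bp ε (rsS ℓ) r) b' (bp_mem_poss _ _ _) hb' ⟨x, ?_⟩ (by convert hd using 1; ring)
          · intro a ha
            have := sg_mem _ _ a ha
            grind
          · intro a ha
            have := i3 _ (sg_mem _ _ a ha)
            simpa using this
          · simp [sg_length]; omega
          · rw [sg_append, coef_append, coef_sg_notMem _ _ _ hxe]
            simpa using coef_sg_nodup hε r.length [x] (by simp) x (by simp)
        refine ⟨?_, hpr⟩
        rw [special_cons_of_mem hpn]
        grind
      · rcases ht with h0 | h0 | h0
        · rw [special_cons_self hpn]
          refine ⟨(typ0 h0).2, ?_⟩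
          simp at hpn; tauto
        · exact absurd (typ3 h0).1 hpn
        · exact absurd (typ4 h0).1 hpn
    constructor
    · grind
    · intro z hz
      rcases List.mem_cons.1 hz with rfl | hz
      · exact hns.1
      · rw [special_cons_of_mem]
        · exact i3 z hz
        · simp at hz ⊢; tauto
theorem seg_gain {ℓ v q : ℕ} (hε : ∀ i, |ε i| = 1) (hh : ℓ + 1 ≤ h) (x : ℕ) (r w : List ℕ) (hr : r.length = v * (ℓ + 1)) (hw : w.length = ℓ)
    (hpos : ∀ z ∈ w ++ x :: r, 0 < z)
    (hW : Wt ε (rsS ℓ) (DS ℓ) (w ++ x :: r) ≠ 0) (hg : gn ε (rsS ℓ) (DS ℓ) h (w ++ x :: r) = gn ε (rsS ℓ) (DS ℓ) h r) (hS : Sh q w) :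
    q ∉ r ∧ q ∈ w := by
  rcases hS with ⟨q', y, u, rfl, hy, hyn, hqy⟩ | hq
  · exfalso
    simp only [List.length_cons, List.length_append] at hw
    have hg1 := gn_append (ε := ε) (rs := rsS ℓ) (D := DS ℓ) (h := h) (y ++ q' :: u ++ [x]) r
    have hg2 : gn ε (rsS ℓ) (DS ℓ) h ((y ++ q' :: u) ++ x :: r) = gn ε (rsS ℓ) (DS ℓ) h r := by
      simp only [List.append_assoc, List.cons_append, gn, List.nil_append] at hg hg1 ⊢; omega
    have ht := gn_cons_eq (ε := ε) (rs := rsS ℓ) (D := DS ℓ) (h := h) (p := q') (l := (y ++ q' :: u) ++ x :: r) (by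
      intro hc; simp only [List.cons_append, gn] at hg; rw [if_pos hc] at hg
      simp only [List.append_assoc, List.cons_append, gn, List.nil_append] at hg hg1 ⊢; omega)
    obtain ⟨i1, i2, i3⟩ := seg_inv hε hh x r (y ++ q' :: u) hr (by simp; omega) (Wt_ne_append (c := [q']) hW) hg2
    have hmem : q' ∈ (y ++ q' :: u) ++ x :: r := by simp
    have hseen : seen (DS ℓ) q' ((y ++ q' :: u) ++ x :: r) := by
      rcases ht with h0 | h0 | h0
      · exact absurd hmem (typ0 h0).1
      · exact (typ3 h0).2.2.1
      · exact (typ4 h0).2.2.1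
    have hD : DS ℓ ((y ++ q' :: u) ++ x :: r).length = true := by
      have : ((y ++ q' :: u) ++ x :: r).length = (y.length + u.length + 2) + v * (ℓ+1) := by simp [hr]; ring
      rw [this]; simp [DS, Nat.mod_eq_of_lt (show y.length + u.length + 2 < ℓ + 1 by omega)]
    have hc : cons ε (rsS ℓ) (DS ℓ) q' (bp ε (rsS ℓ) ((y ++ q' :: u) ++ x :: r)) ((y ++ q' :: u) ++ x :: r) := cons_of_Wt hW hD hseen
    have hrw : (y ++ q' :: u) ++ x :: r = (y ++ [q']) ++ (u ++ x :: r) := by simp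
    have hl1 : (u ++ x :: r).length = (u.length + 1) + v * (ℓ+1) := by simp [hr]; ring
    have hbp := bp_append (ε := ε) (rs := rsS ℓ) (y ++ [q']) (u ++ x :: r) (by
      intro i hi1 hi2
      simp [hr] at hi1 hi2
      obtain ⟨j, rfl⟩ := Nat.exists_eq_add_of_lt (show v * (ℓ+1) < i by omega)
      have : (v * (ℓ+1) + j + 1) % (ℓ+1) = j + 1 := by
        rw [show v * (ℓ+1) + j + 1 = (j+1) + v * (ℓ+1) by ring, Nat.add_mul_mod_self_right]
        exact Nat.mod_eq_of_lt (by omega)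
      simp [rsS, this])
    rw [hrw, hbp] at hc
    have hc2 : cons ε (rsS ℓ) (DS ℓ) q' (bp ε (rsS ℓ) (u ++ x :: r) + val (sg ε (u ++ x :: r).length (y ++ [q']))) (q' :: (u ++ x :: r)) :=
      cons_append (c := y) (by simpa using hc)
    have hd := hc2.2 rfl (by simp only [hl1]; simp [DS, Nat.mod_eq_of_lt (show u.length + 1 < ℓ + 1 by omega)])
    rw [add_sub_cancel_left, sg_append, val_append] at hd
    have hd2 : (q' : ℤ) ∣ val (sg ε ([q'].length + (u ++ x :: r).length) y) := by
      refine (dvd_add_left ?_).1 hd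
      simp [sg, val]
    refine coin (ε := ε) (rs := rsS ℓ) (h := h) ((y ++ q' :: u) ++ x :: r) (fun z hz => hpos z (by simp at hz ⊢; tauto))
      (sg ε ([q'].length + (u ++ x :: r).length) y) (sg_abs hε _ _) ?_ ?_ (by rw [sg_length]; omega) q' hmem
      (i3 q' (by simp)) (coef_sg_notMem _ _ _ hqy) ?_ hd2
    · intro a ha; have := sg_mem _ _ a ha; simp [this]
    · intro a ha; have := sg_mem _ _ a ha; exact i3 _ (by simp [this])
    · obtain ⟨z, hz⟩ := List.exists_mem_of_ne_nil _ hy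
      exact ⟨z, coef_sg_nodup hε _ _ hyn z hz⟩
  · obtain ⟨i1, i2, i3⟩ := seg_inv hε hh x r w hr hw.le hW hg
    have : q ∈ w := List.mem_of_mem_head? hq
    grind
open Classical in
theorem AllSh_gain {ℓ v q : ℕ} (hε : ∀ i, |ε i| = 1) (hh : ℓ + 1 ≤ h) (l : List ℕ) (hpos : ∀ z ∈ l, 0 < z)
    (hA : AllSh q ℓ v l) (hW : Wt ε (rsS ℓ) (DS ℓ) l ≠ 0) : v ≤ gn ε (rsS ℓ) (DS ℓ) h l + (if q ∈ l then 1 else 0) := by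
  induction v generalizing l with
  | zero => omega
  | succ v ih =>
    obtain ⟨w, x, r, rfl, hw, hS, hA'⟩ := hA
    have h1 := ih r (fun z hz => hpos z (by simp [hz])) hA' (Wt_ne_append (c := w ++ [x]) (by simpa using hW))
    have hg1 := gn_append (ε := ε) (rs := rsS ℓ) (D := DS ℓ) (h := h) (w ++ [x]) r
    simp only [List.append_assoc, List.singleton_append] at hg1
    rcases hg1.lt_or_eq with hlt | heq
    · grind
    · obtain ⟨h2, h3⟩ := seg_gain (q := q) hε hh x r w (AllSh_length hA') hw hpos hW heq.symm hS
      grind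
open Classical in
theorem mom_bound (hH0 : 0 < H0) (hP : ∀ p ∈ P, H0 ≤ (p : ℝ)) (hδ0 : 0 < δ) (hδ1 : δ ≤ 1) (hmδ : m / H0 ≤ δ) {ℓ v q : ℕ} (hε : ∀ i, |ε i| = 1) (hh : ℓ + 1 ≤ h)
    (hδ : ∀ l : List ℕ, (∀ x ∈ l, x ∈ P) → l.length ≤ m → ∑ x ∈ P.filter (fun x => Bad ε (rsS ℓ) h l x), (1:ℝ) / x ≤ δ)
    (hn : v * (ℓ + 1) ≤ m) (v' : ℕ) (hv' : v' + (if q ∈ P then 1 else 0) ≤ v) :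
    ∑ l ∈ wds P (v * (ℓ + 1)), (if AllSh q ℓ v l then Wt ε (rsS ℓ) (DS ℓ) l else 0) ≤ δ ^ v' * (∑ p ∈ P, (1:ℝ) / p + 2 + 2 * m) ^ (v * (ℓ + 1)) := by
  have := gf_bound (ε := ε) (rs := rsS ℓ) (D := DS ℓ) (h := h) hH0 hP hδ0 hmδ hδ _ hn
  refine le_trans ?_ (mul_le_mul_of_nonneg_left this (by positivity))
  rw [mul_sum]
  refine sum_le_sum fun l hl => ?_
  obtain ⟨hl1, hl2⟩ := mem_wds.1 hl
  have hW0 := Wt_nonneg ε (rsS ℓ) (DS ℓ) l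
  by_cases hA : AllSh q ℓ v l
  · rw [if_pos hA]
    by_cases hW : Wt ε (rsS ℓ) (DS ℓ) l = 0
    · rw [hW]; simp
    have hg := AllSh_gain (q := q) hε hh l (fun z hz => by
      have := hP z (hl2 z hz)
      exact_mod_cast hH0.trans_le this) hA hW
    have hg3 : v - (if q ∈ P then 1 else 0) ≤ gn ε (rsS ℓ) (DS ℓ) h l := by
      grind
    have hg4 : v' ≤ gn ε (rsS ℓ) (DS ℓ) h l := by omega
    have h5 : 1 ≤ δ ^ v' * (1 / δ) ^ gn ε (rsS ℓ) (DS ℓ) h l := by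
      obtain ⟨k, hk⟩ := Nat.exists_eq_add_of_le hg4
      rw [hk, pow_add, ← mul_assoc, ← mul_pow, mul_one_div_cancel hδ0.ne', one_pow, one_mul]
      exact one_le_pow₀ (by rw [le_div_iff₀ hδ0]; linarith)
    nlinarith
  · rw [if_neg hA]; positivity
end mom
end TB
namespace TB
open Finset
section cnt
variable {ε : ℕ → ℤ} {rs D : ℕ → Bool} {h : ℕ} {P : Finset ℕ} {H0 δ : ℝ} {m : ℕ}
open Classical in
noncomputable def QQ (D : ℕ → Bool) : List ℕ → ℕ
  | [] => 1
  | p :: l => if D l.length = true ∧ ¬ seen D p l then p * QQ D l else QQ D l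
noncomputable def Fp (D : ℕ → Bool) : List ℕ → ℝ
  | [] => 1
  | p :: l => if D l.length = true then Fp D l else 1 / (p:ℝ) * Fp D l
theorem Fp_nonneg (l : List ℕ) : 0 ≤ Fp D l := by
  induction l with
  | nil => simp [Fp]
  | cons p l ih => rw [Fp]; split_ifs <;> positivity
theorem QQ_prime {l : List ℕ} (hl : ∀ x ∈ l, x.Prime) {p : ℕ} (hp : p.Prime) (hd : p ∣ QQ D l) : seen D p l := by
  induction l with
  | nil => simp [QQ] at hd; exact absurd hd hp.one_lt.ne'
  | cons x l ih =>
    have ih' := ih (fun z hz => hl z (by simp [hz]))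
    rw [QQ] at hd
    split_ifs at hd with hc
    · rcases (hp.dvd_mul).1 hd with h1 | h1
      · exact Or.inr ⟨((Nat.prime_dvd_prime_iff_eq hp (hl x (by simp))).1 h1).symm, hc.1⟩
      · exact Or.inl (ih' h1)
    · exact Or.inl (ih' hd)
theorem QQ_pos {l : List ℕ} (hl : ∀ x ∈ l, x.Prime) : 0 < QQ D l := by
  induction l with
  | nil => simp [QQ]
  | cons x l ih =>
    have ih' := ih (fun z hz => hl z (by simp [hz]))
    have := (hl x (by simp)).pos
    rw [QQ]; split_ifs <;> positivity
theorem QQ_le {l : List ℕ} {H : ℝ} (hH : 1 ≤ H) (hl : ∀ x ∈ l, (x:ℝ) ≤ H) : (QQ D l : ℝ) ≤ H ^ l.length := by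
  induction l with
  | nil => simp [QQ]
  | cons x l ih =>
    have ih' := ih (fun z hz => hl z (by simp [hz]))
    have hx := hl x (by simp)
    rw [QQ, List.length_cons, pow_succ]
    split_ifs
    · push_cast; rw [mul_comm]; exact mul_le_mul ih' hx (by positivity) (by positivity)
    · nlinarith
theorem facts_seen {n : ℤ} {l : List ℕ} (hf : facts ε rs D n l) {p : ℕ} {n' : ℤ} (hf' : facts ε rs D n' l) (hs : seen D p l) : (p:ℤ) ∣ n - n' := by
  induction l with
  | nil => exact hs.elim
  | cons x l ih =>
    rcases hs with hs | ⟨rfl, hD⟩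
    · exact ih hf.1 hf'.1 hs
    · have := dvd_sub (hf.2 hD) (hf'.2 hD)
      simpa using this
theorem facts_QQ {n n' : ℤ} {l : List ℕ} (hl : ∀ x ∈ l, x.Prime) (hf : facts ε rs D n l) (hf' : facts ε rs D n' l) : (QQ D l : ℤ) ∣ n - n' := by
  induction l with
  | nil => simp [QQ]
  | cons x l ih =>
    have hl' : ∀ z ∈ l, z.Prime := fun z hz => hl z (by simp [hz])
    have ih' := ih hl' hf.1 hf'.1
    rw [QQ]
    split_ifs with hc
    · push_cast
      refine IsCoprime.mul_dvd ?_ (facts_seen hf hf' (Or.inr ⟨rfl, hc.1⟩)) ih'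
      rw [Nat.isCoprime_iff_coprime, Nat.Prime.coprime_iff_not_dvd (hl x (by simp))]
      exact fun hd => hc.2 (QQ_prime hl' (hl x (by simp)) hd)
    · exact ih'
theorem facts_cons {n : ℤ} {l : List ℕ} (hf : facts ε rs D n l) {p : ℕ} {b : ℤ} (hb : (p:ℤ) ∣ n + b) : cons ε rs D p b l := by
  induction l with
  | nil => trivial
  | cons x l ih =>
    refine ⟨ih hf.1, ?_⟩
    rintro rfl hD
    have := dvd_sub hb (hf.2 hD)
    simpa using this
theorem facts_Wt {n : ℤ} {l : List ℕ} (hl : ∀ x ∈ l, x.Prime) (hf : facts ε rs D n l) : Wt ε rs D l = Fp D l / QQ D l := by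
  induction l with
  | nil => simp [Wt, Fp, QQ]
  | cons x l ih =>
    have hl' : ∀ z ∈ l, z.Prime := fun z hz => hl z (by simp [hz])
    have hx : (x:ℝ) ≠ 0 := by exact_mod_cast (hl x (by simp)).ne_zero
    have hq : (QQ D l : ℝ) ≠ 0 := by exact_mod_cast (QQ_pos hl').ne'
    rw [Wt_cons, ih hl' hf.1, wf, Fp, QQ]
    by_cases hD : D l.length = true
    · by_cases hs : seen D x l
      · simp [hD, hs, facts_cons hf.1 (hf.2 hD)]
      · simp [hD, hs]; field_simp
    · simp [hD]; field_simp
theorem card_mod_le (a : ℤ) (M Q : ℕ) (hQ : 0 < Q) (s : Finset ℤ) (hs : s ⊆ Ioc a (a + M)) (hd : ∀ n ∈ s, ∀ n' ∈ s, (Q:ℤ) ∣ n - n') :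
    (s.card : ℝ) ≤ M / Q + 1 := by
  rcases s.eq_empty_or_nonempty with rfl | ⟨n0, hn0⟩
  · simp; positivity
  have hsub : s ⊆ (Ioc a (a + M)).filter (fun x => x ≡ n0 [ZMOD Q]) := by
    intro n hn
    exact mem_filter.2 ⟨hs hn, (Int.modEq_iff_dvd.2 (hd n0 hn0 n hn))⟩
  have h1 := card_le_card hsub
  have h2 := Int.Ioc_filter_modEq_card a (a + M) (r := (Q:ℤ)) (by exact_mod_cast hQ) n0
  have hQ' : (0:ℝ) < Q := by exact_mod_cast hQ
  have h3 : (((Ioc a (a + M)).filter (fun x => x ≡ n0 [ZMOD Q])).card : ℝ) = ((max (⌊((a + M : ℤ) - n0) / (Q:ℚ)⌋ - ⌊(a - n0) / (Q:ℚ)⌋) 0 : ℤ) : ℝ) := by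
    have := congrArg (fun z : ℤ => (z:ℝ)) h2
    simpa using this
  refine le_trans (Nat.cast_le.2 h1) ?_
  rw [h3]
  push_cast
  refine max_le ?_ (by positivity)
  have h4 := Int.floor_le ((((a + M : ℤ) : ℚ) - n0) / (Q:ℚ))
  have h5 := Int.lt_floor_add_one (((a:ℚ) - n0) / (Q:ℚ))
  have h6 : ((⌊(((a + M : ℤ):ℚ) - n0) / (Q:ℚ)⌋ : ℚ) - (⌊((a:ℚ) - n0) / (Q:ℚ)⌋ : ℚ)) ≤ M / Q + 1 := by
    have : ((((a + M : ℤ) : ℚ) - n0) / (Q:ℚ)) - (((a:ℚ) - n0) / (Q:ℚ)) = M / Q := by push_cast; ring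
    linarith
  have h7 : (((⌊(((a + M : ℤ):ℚ) - n0) / (Q:ℚ)⌋ : ℚ) - (⌊((a:ℚ) - n0) / (Q:ℚ)⌋ : ℚ) : ℚ) : ℝ) ≤ ((M / Q + 1 : ℚ) : ℝ) := by exact_mod_cast h6
  push_cast at h7
  exact h7
open Classical in
theorem count_facts {H : ℝ} (hH : 1 ≤ H) (a : ℤ) (M : ℕ) (l : List ℕ) (hl : ∀ x ∈ l, x.Prime ∧ (x:ℝ) ≤ H) (hM : H ^ l.length ≤ M) :
    (((Ioc a (a + M)).filter (fun n => facts ε rs D n l)).card : ℝ) * Fp D l ≤ 2 * M * Wt ε rs D l := by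
  have hl1 : ∀ x ∈ l, x.Prime := fun x hx => (hl x hx).1
  rcases ((Ioc a (a + M)).filter (fun n => facts ε rs D n l)).eq_empty_or_nonempty with h0 | ⟨n0, hn0⟩
  · rw [h0]; simp; exact mul_nonneg (by positivity) (Wt_nonneg _ _ _ _)
  have h1 := card_mod_le a M (QQ D l) (QQ_pos hl1) _ (filter_subset _ _) (fun n hn n' hn' =>
    facts_QQ (ε := ε) (rs := rs) hl1 (mem_filter.1 hn).2 (mem_filter.1 hn').2)
  rw [facts_Wt hl1 (mem_filter.1 hn0).2]
  have hQ0 : (0:ℝ) < QQ D l := by exact_mod_cast QQ_pos hl1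
  have hQ : (QQ D l : ℝ) ≤ M := (QQ_le hH (fun x hx => (hl x hx).2)).trans hM
  have h2 : (1:ℝ) ≤ M / QQ D l := by rw [le_div_iff₀ hQ0]; linarith
  calc _ ≤ (2 * (M / QQ D l : ℝ)) * Fp D l := mul_le_mul_of_nonneg_right (by linarith) (Fp_nonneg l)
    _ = _ := by ring
def es (s : Bool) (ℓ : ℕ) : ℕ → ℤ := fun i => (if s then 1 else -1) * (-1) ^ (i % (ℓ + 1))
theorem es_abs (s : Bool) (ℓ i : ℕ) : |es s ℓ i| = 1 := by
  rw [es]; cases s <;> simp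
theorem bp_per {s ℓ k} (c r : List ℕ) (hr : r.length = k * (ℓ + 1)) : bp (es s ℓ) (rsS ℓ) (c ++ r) = bp (es s ℓ) (rsS ℓ) c := by
  induction c with
  | nil =>
    cases r with
    | nil => rfl
    | cons x r =>
      simp only [List.length_cons] at hr
      simp [bp, rsS, hr]
  | cons p c ih =>
    simp only [List.cons_append, bp, ih, List.length_append, hr]
    rw [show rsS ℓ (c.length + k * (ℓ + 1) + 1) = rsS ℓ (c.length + 1) by
      simp only [rsS]; rw [show c.length + k * (ℓ + 1) + 1 = c.length + 1 + k * (ℓ + 1) by ring, Nat.add_mul_mod_self_right]]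
    simp only [es, Nat.add_mul_mod_self_right]
theorem facts_per {s ℓ k n} (c r : List ℕ) (hr : r.length = k * (ℓ + 1)) : facts (es s ℓ) (rsS ℓ) (DS ℓ) n (c ++ r) ↔
    facts (es s ℓ) (rsS ℓ) (DS ℓ) n c ∧ facts (es s ℓ) (rsS ℓ) (DS ℓ) n r := by
  induction c with
  | nil => simp [facts]
  | cons p c ih =>
    simp only [List.cons_append, facts, ih, bp_per c r hr, List.length_append, hr]
    rw [show DS ℓ (c.length + k * (ℓ + 1)) = DS ℓ c.length by simp only [DS, Nat.add_mul_mod_self_right]]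
    tauto
theorem Fp_per {ℓ k} (c r : List ℕ) (hr : r.length = k * (ℓ + 1)) : Fp (DS ℓ) (c ++ r) = Fp (DS ℓ) c * Fp (DS ℓ) r := by
  induction c with
  | nil => simp [Fp]
  | cons p c ih =>
    simp only [List.cons_append, Fp, ih, List.length_append, hr]
    rw [show DS ℓ (c.length + k * (ℓ + 1)) = DS ℓ c.length by simp only [DS, Nat.add_mul_mod_self_right]]
    split_ifs <;> ring
open Classical in
noncomputable def eL (P : Finset ℕ) (s : Bool) (q ℓ v : ℕ) (n : ℤ) : ℝ :=
  ∑ l ∈ wds P (v * (ℓ+1)), if AllSh q ℓ v l ∧ facts (es s ℓ) (rsS ℓ) (DS ℓ) n l then Fp (DS ℓ) l else 0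
theorem AllSh_append {q ℓ v : ℕ} {c r : List ℕ} (hc : c.length = ℓ + 1) : AllSh q ℓ (v+1) (c ++ r) ↔ AllSh q ℓ 1 c ∧ AllSh q ℓ v r := by
  constructor
  · rintro ⟨w, x, l', hl, hw, hS, hA⟩
    have : c ++ r = (w ++ [x]) ++ l' := by simp [hl]
    obtain ⟨rfl, rfl⟩ := List.append_inj this (by simp [hc, hw])
    exact ⟨⟨w, x, [], rfl, hw, hS, rfl⟩, hA⟩
  · rintro ⟨⟨w, x, l', rfl, hw, hS, hA⟩, hA'⟩
    cases (show l' = [] from hA)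
    exact ⟨w, x, r, by simp, hw, hS, hA'⟩
theorem eL_pow (s : Bool) (q ℓ v : ℕ) (n : ℤ) : eL P s q ℓ v n = (eL P s q ℓ 1 n) ^ v := by
  induction v with
  | zero => simp [eL, sum_wds_zero, AllSh, facts, Fp]
  | succ v ih =>
    rw [pow_succ, ← ih, eL, eL, eL, show (v+1) * (ℓ+1) = (ℓ+1) + v * (ℓ+1) by ring, sum_wds_add, sum_mul]
    refine sum_congr rfl fun r hr => ?_
    rw [mul_sum, one_mul]
    refine sum_congr rfl fun c hc => ?_
    have hr' := (mem_wds.1 hr).1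
    rw [AllSh_append (mem_wds.1 hc).1, facts_per c r hr', Fp_per c r hr']
    grind
open Classical in
theorem eL_moment {H : ℝ} (hH : 1 ≤ H) (hH0 : 0 < H0) (hP : ∀ p ∈ P, Nat.Prime p ∧ H0 ≤ (p : ℝ) ∧ (p : ℝ) ≤ H) (hδ0 : 0 < δ) (hδ1 : δ ≤ 1) (hmδ : m / H0 ≤ δ) {ℓ v q : ℕ} (s : Bool) (hh : ℓ + 1 ≤ h)
    (hδ : ∀ l : List ℕ, (∀ x ∈ l, x ∈ P) → l.length ≤ m → ∑ x ∈ P.filter (fun x => Bad (es s ℓ) (rsS ℓ) h l x), (1:ℝ) / x ≤ δ)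
    (hn : v * (ℓ + 1) ≤ m) (v' : ℕ) (hv' : v' + (if q ∈ P then 1 else 0) ≤ v) (a : ℤ) (M : ℕ) (hM : H ^ m ≤ M) :
    ∑ n ∈ Ioc a (a + M), (eL P s q ℓ 1 n) ^ v ≤ 2 * M * (δ ^ v' * (∑ p ∈ P, (1:ℝ) / p + 2 + 2 * m) ^ (v * (ℓ + 1))) := by
  simp_rw [← eL_pow]
  have h1 := mom_bound (q := q) hH0 (fun p hp => (hP p hp).2.1) hδ0 hδ1 hmδ (es_abs s ℓ) hh hδ hn v' hv'
  refine le_trans ?_ (mul_le_mul_of_nonneg_left h1 (by positivity))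
  simp only [eL]
  rw [sum_comm, mul_sum]
  refine sum_le_sum fun l hl => ?_
  obtain ⟨hl1, hl2⟩ := mem_wds.1 hl
  by_cases hA : AllSh q ℓ v l
  · simp only [hA, true_and, if_true]
    rw [← sum_filter, sum_const, nsmul_eq_mul]
    exact count_facts hH a M l (fun x hx => ⟨(hP x (hl2 x hx)).1, (hP x (hl2 x hx)).2.2⟩)
      ((pow_le_pow_right₀ hH (by omega)).trans hM)
  · simp [hA]
end cnt
end TB
namespace TB
open Finset
section vert
variable {P : Finset ℕ}
def stp (p : ℕ) (u : ℤ × Bool) : ℤ × Bool := (if u.2 then u.1 + p else u.1 - p, !u.2)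
theorem stp_stp (p : ℕ) (u : ℤ × Bool) : stp p (stp p u) = u := by
  obtain ⟨n, s⟩ := u; cases s <;> simp [stp]
theorem stp_dvd (p q : ℕ) (u : ℤ × Bool) (hq : q = p) : (q:ℤ) ∣ (stp p u).1 ↔ (q:ℤ) ∣ u.1 := by
  subst hq
  obtain ⟨n, s⟩ := u; cases s <;> simp [stp]
def wk (l : List ℕ) (u : ℤ × Bool) : ℤ × Bool := l.foldr stp u
@[simp] theorem wk_nil (u) : wk [] u = u := rfl
@[simp] theorem wk_cons (p l u) : wk (p :: l) u = stp p (wk l u) := rfl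
theorem wk_append (a b u) : wk (a ++ b) u = wk a (wk b u) := by simp [wk]
theorem wk_reverse (l u) : wk l.reverse (wk l u) = u := by
  induction l with
  | nil => rfl
  | cons p l ih => simp [wk_append, stp_stp, ih]
def dw : List ℕ → ℤ × Bool → Prop
  | [], _ => True
  | p :: l, u => dw l u ∧ (p:ℤ) ∣ (wk l u).1
theorem dw_append (a b u) : dw (a ++ b) u ↔ dw b u ∧ dw a (wk b u) := by
  induction a with
  | nil => simp [dw]
  | cons p a ih => simp [dw, ih, wk_append]; tauto
theorem wk_bp (s : Bool) (ℓ : ℕ) (n : ℤ) (l : List ℕ) (hl : l.length ≤ ℓ) :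
    wk l (n, s) = (n + bp (es s ℓ) (rsS ℓ) l, if l.length % 2 = 0 then s else !s) := by
  induction l with
  | nil => simp [bp]
  | cons p l ih =>
    simp only [List.length_cons] at hl ⊢
    rw [wk_cons, ih (by omega), stp, bp]
    have h1 : rsS ℓ (l.length + 1) = false := by simp [rsS, Nat.mod_eq_of_lt (show l.length + 1 < ℓ + 1 by omega)]
    have h2 : l.length % (ℓ + 1) = l.length := Nat.mod_eq_of_lt (by omega)
    rw [h1, es, h2]
    rcases Nat.even_or_odd l.length with he | ho
    · have : (l.length + 1) % 2 = 1 := by rcases he with ⟨k, hk⟩; omega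
      simp only [this, Nat.even_iff.1 he, he.neg_one_pow]
      cases s <;> simp <;> ring
    · have : (l.length + 1) % 2 = 0 := by rcases ho with ⟨k, hk⟩; omega
      simp only [this, Nat.odd_iff.1 ho, ho.neg_one_pow]
      cases s <;> simp <;> ring
theorem facts_dw (s : Bool) (ℓ : ℕ) (n : ℤ) (x : ℕ) (w : List ℕ) (hw : w.length ≤ ℓ) :
    facts (es s ℓ) (rsS ℓ) (DS ℓ) n (w ++ [x]) ↔ dw w (stp x (n, s)) := by
  induction w with
  | nil => simp [facts, dw, DS]
  | cons p w ih =>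
    simp only [List.length_cons] at hw
    simp only [List.cons_append, facts, dw, ih (by omega)]
    have h2 : DS ℓ (w ++ [x]).length = true := by
      simp [DS, Nat.mod_eq_of_lt (show w.length + 1 < ℓ + 1 by omega)]
    have h3 := wk_bp s ℓ n (w ++ [x]) (by simp; omega)
    rw [wk_append] at h3
    simp_all
def BadL (P : Finset ℕ) (Lm : ℕ) (q : ℕ) (u : ℤ × Bool) : Prop :=
  ∃ l : List ℕ, l.length ≤ Lm ∧ (∀ x ∈ l, x ∈ P) ∧ dw l u ∧ Sh q l
theorem Fp_seg (ℓ x : ℕ) (w : List ℕ) (hw : w.length ≤ ℓ) : Fp (DS ℓ) (w ++ [x]) = 1 / (x:ℝ) := by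
  induction w with
  | nil => simp [Fp, DS]
  | cons p w ih =>
    simp only [List.length_cons] at hw
    rw [List.cons_append, Fp, ih (by omega)]
    simp [DS, Nat.mod_eq_of_lt (show w.length + 1 < ℓ + 1 by omega)]
theorem eL_nonneg (s q ℓ v n) : 0 ≤ eL P s q ℓ v n := sum_nonneg fun l _ => by
  split_ifs
  · exact Fp_nonneg l
  · exact le_rfl
open Classical in
theorem BadL_le (Lm q : ℕ) (u : ℤ × Bool) :
    ∑ x ∈ P, (if BadL P Lm q (stp x u) then (1:ℝ) / x else 0) ≤ ∑ ℓ ∈ range (Lm + 1), eL P u.2 q ℓ 1 u.1 := by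
  have key : ∀ x ∈ P, (if BadL P Lm q (stp x u) then (1:ℝ) / x else 0) ≤
      ∑ ℓ ∈ range (Lm + 1), ∑ w ∈ wds P ℓ, if AllSh q ℓ 1 (w ++ [x]) ∧ facts (es u.2 ℓ) (rsS ℓ) (DS ℓ) u.1 (w ++ [x]) then Fp (DS ℓ) (w ++ [x]) else 0 := by
    intro x hx
    have hnn : ∀ ℓ ∈ range (Lm + 1), ∀ w ∈ wds P ℓ, (0:ℝ) ≤ if AllSh q ℓ 1 (w ++ [x]) ∧ facts (es u.2 ℓ) (rsS ℓ) (DS ℓ) u.1 (w ++ [x]) then Fp (DS ℓ) (w ++ [x]) else 0 := by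
      intro ℓ _ w _; split_ifs
      · exact Fp_nonneg _
      · exact le_rfl
    split_ifs with hB
    · obtain ⟨l, h1, h2, h3, h4⟩ := hB
      have hm : l.length ∈ range (Lm + 1) := mem_range.2 (by omega)
      refine le_trans ?_ (single_le_sum (fun ℓ hℓ => sum_nonneg (hnn ℓ hℓ)) hm)
      refine le_trans ?_ (single_le_sum (hnn _ hm) (mem_wds.2 ⟨rfl, h2⟩))
      rw [if_pos, Fp_seg _ _ _ le_rfl]
      exact ⟨⟨l, x, [], rfl, rfl, h4, rfl⟩, (facts_dw u.2 _ u.1 x l le_rfl).2 h3⟩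
    · exact sum_nonneg fun ℓ hℓ => sum_nonneg (hnn ℓ hℓ)
  refine (sum_le_sum key).trans ?_
  rw [sum_comm]
  refine sum_le_sum fun ℓ _ => ?_
  rw [eL, one_mul, sum_wds_add P ℓ 1, sum_wds_succ, sum_wds_zero]
end vert
end TB
namespace TB
open Finset
section alg
variable {𝓡 : Type*} [Ring 𝓡] [Algebra ℝ 𝓡] (P : Finset ℕ) (B T : ℕ → 𝓡)
def red : List (ℕ × Bool) → Prop
  | [] => True
  | a :: w => red w ∧ ¬ (a.2 = true ∧ w.head? = some a)
noncomputable def mt (a : ℕ × Bool) : 𝓡 := if a.2 then B a.1 else -((1 / (a.1:ℝ)) • T a.1)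
def lets : Finset (ℕ × Bool) := P ×ˢ Finset.univ
theorem sum_lets {β : Type*} [AddCommMonoid β] (f : ℕ × Bool → β) : ∑ a ∈ lets P, f a = ∑ p ∈ P, f (p, true) + ∑ p ∈ P, f (p, false) := by
  rw [lets, sum_product, ← sum_add_distrib]
  refine sum_congr rfl fun p _ => ?_
  simp
open Classical in
noncomputable def RR (j : ℕ) : 𝓡 := ∑ w ∈ wds (lets P) j, if red w then (w.map (mt B T)).prod else 0
open Classical in
noncomputable def AA (q : ℕ) (j : ℕ) : 𝓡 := ∑ w ∈ wds (lets P) j, if red w ∧ w.head? ≠ some (q, true) then (w.map (mt B T)).prod else 0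
noncomputable def EE : 𝓡 := ∑ p ∈ P, (1 / (p:ℝ)) • T p
noncomputable def BB : 𝓡 := ∑ p ∈ P, B p
noncomputable def DD : 𝓡 := ∑ p ∈ P, B p ^ 2
theorem RR_zero : RR P B T 0 = 1 := by simp [RR, sum_wds_zero, red]
theorem AA_zero (q) : AA P B T q 0 = 1 := by simp [AA, sum_wds_zero, red]
theorem RR_succ (j) : RR P B T (j+1) = ∑ q ∈ P, B q * AA P B T q j - EE P T * RR P B T j := by
  classical
  rw [RR, sum_wds_succ, sum_comm, sum_lets, sub_eq_add_neg]
  congr 1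
  · refine sum_congr rfl fun q _ => ?_
    rw [AA, mul_sum]
    refine sum_congr rfl fun w _ => ?_
    simp [red, mt]
  · rw [EE, sum_mul, ← sum_neg_distrib]
    refine sum_congr rfl fun q _ => ?_
    rw [RR, mul_sum, ← sum_neg_distrib]
    refine sum_congr rfl fun w _ => ?_
    by_cases hr : red w <;> simp [red, mt, hr]
theorem AA_succ (q) (hq : q ∈ P) (j) : AA P B T q (j+1) = RR P B T (j+1) - B q * AA P B T q j := by
  classical
  rw [eq_sub_iff_add_eq, AA, RR, sum_wds_succ, sum_wds_succ, AA, mul_sum, ← sum_add_distrib]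
  refine sum_congr rfl fun w _ => ?_
  have hq' : (q, true) ∈ lets P := by simp [lets, hq]
  rw [← add_sum_erase _ _ hq', ← add_sum_erase _ _ hq']
  rw [add_comm]
  simp only [List.head?_cons, ne_eq, not_true_eq_false, and_false, if_false, zero_add]
  rw [show (if red ((q, true) :: w) then (((q,true) :: w).map (mt B T)).prod else 0) = B q * (if red w ∧ ¬ w.head? = some (q, true) then (w.map (mt B T)).prod else 0) by
    simp [red, mt]]
  congr 1
  refine sum_congr rfl fun a ha => ?_
  grind
variable (hB : ∀ p ∈ P, B p ^ 3 = B p)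
theorem R1 : RR P B T 1 = BB P B - EE P T := by
  rw [RR_succ]; simp [AA_zero, RR_zero, BB]
theorem R2 : RR P B T 2 + EE P T * RR P B T 1 = BB P B * RR P B T 1 - DD P B := by
  rw [RR_succ, sub_add_cancel, BB, DD, sum_mul, ← sum_sub_distrib]
  refine sum_congr rfl fun q hq => ?_
  rw [AA_succ P B T q hq, AA_zero, mul_one, mul_sub, sq]
include hB in
theorem R3 (j : ℕ) : RR P B T (j+3) + EE P T * RR P B T (j+2) = BB P B * RR P B T (j+2) - DD P B * RR P B T (j+1) + RR P B T (j+1) + EE P T * RR P B T j := by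
  have h0 : ∑ q ∈ P, B q * AA P B T q j = RR P B T (j+1) + EE P T * RR P B T j := by rw [RR_succ P B T j, sub_add_cancel]
  rw [RR_succ P B T (j+2), sub_add_cancel, add_assoc (_ - _), ← h0, BB, DD, sum_mul, sum_mul, ← sum_sub_distrib, ← sum_add_distrib]
  refine sum_congr rfl fun q hq => ?_
  rw [AA_succ P B T q hq (j+1), AA_succ P B T q hq j]
  have h3 : B q * AA P B T q j = B q * (B q * (B q * AA P B T q j)) := by
    conv_lhs => rw [← hB q hq]
    noncomm_ring
  generalize AA P B T q j = a at h3 ⊢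
  rw [show j + 1 + 1 = j + 2 from rfl]
  generalize RR P B T (j+2) = r
  rw [sq, mul_sub, mul_sub, mul_sub, ← h3, mul_assoc, sub_add]
noncomputable def KK (t : ℝ) : 𝓡 := (1 - t^2) • (1:𝓡) + (t - t^3) • EE P T - t • BB P B + t^2 • DD P B
include hB in
theorem KS (t : ℝ) (J : ℕ) : KK P B T t * ∑ j ∈ range (J+3), t^j • RR P B T j =
    (1 - t^2) • (1:𝓡) - t^(J+3) • RR P B T (J+3) + t^(J+4) • ((DD P B - 1) * RR P B T (J+2) - EE P T * RR P B T (J+1)) - t^(J+5) • (EE P T * RR P B T (J+2)) := by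
  induction J with
  | zero =>
    have h1 := R1 P B T
    have h2 := R2 P B T
    have h3 := R3 P B T hB 0
    rw [eq_sub_of_add_eq h3, eq_sub_of_add_eq h2, h1]
    simp only [sum_range_succ, range_zero, sum_empty, RR_zero, h1, eq_sub_of_add_eq h2, KK]
    simp only [add_mul, sub_mul, mul_add, mul_sub, smul_mul_assoc, mul_smul_comm, one_mul, mul_one, smul_add, smul_sub, smul_smul, zero_add, ← mul_assoc]
    module
  | succ J ih =>
    rw [sum_range_succ, mul_add, ih]
    rw [show J + 1 + 3 = J + 1 + 3 from rfl, eq_sub_of_add_eq (R3 P B T hB (J+1)), KK]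
    simp only [add_mul, sub_mul, mul_add, mul_sub, smul_mul_assoc, mul_smul_comm, one_mul, mul_one, smul_add, smul_sub, smul_smul, zero_add, ← mul_assoc]
    simp only [show J + 1 + 2 = J + 3 by ring, show J + 1 + 1 = J + 2 by ring]
    module
end alg
section mat
variable {V : Type*} [Fintype V] [DecidableEq V]
open Matrix
theorem pos_of_inv (K : ℝ → Matrix V V ℝ) (hc : Continuous K) (hs : ∀ t, (K t).IsHermitian) (h0 : K 0 = 1) (t0 : ℝ)
    (hinv : ∀ t, 0 ≤ t → t ≤ t0 → ∀ φ, K t *ᵥ φ = 0 → φ = 0) (t : ℝ) (ht : 0 ≤ t) (ht0 : t ≤ t0) (φ : V → ℝ) : 0 ≤ φ ⬝ᵥ K t *ᵥ φ := by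
  by_contra hneg
  push Not at hneg
  have hF : Continuous (fun x : ℝ × (V → ℝ) => x.2 ⬝ᵥ K x.1 *ᵥ x.2) := by
    have : Continuous (fun x : ℝ × (V → ℝ) => K x.1) := hc.comp continuous_fst
    exact Continuous.dotProduct continuous_snd (Continuous.matrix_mulVec this continuous_snd)
  have hcl : IsClosed {x : ℝ × (V → ℝ) | x.2 ⬝ᵥ K x.1 *ᵥ x.2 ≤ 0} := isClosed_le hF continuous_const
  have hcomp : IsCompact ((Set.Icc 0 t0 ×ˢ Metric.sphere (0 : V → ℝ) 1) ∩ {x : ℝ × (V → ℝ) | x.2 ⬝ᵥ K x.1 *ᵥ x.2 ≤ 0}) :=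
    (isCompact_Icc.prod (isCompact_sphere _ _)).inter_right hcl
  have hscale : ∀ (t : ℝ) (φ : V → ℝ) (c : ℝ), (c • φ) ⬝ᵥ K t *ᵥ (c • φ) = c^2 * (φ ⬝ᵥ K t *ᵥ φ) := by
    intro t φ c; simp [mulVec_smul]; ring
  have hφ0 : φ ≠ 0 := by rintro rfl; simp at hneg
  have hnφ : 0 < ‖φ‖ := norm_pos_iff.2 hφ0
  have hne : ((Set.Icc 0 t0 ×ˢ Metric.sphere (0 : V → ℝ) 1) ∩ {x : ℝ × (V → ℝ) | x.2 ⬝ᵥ K x.1 *ᵥ x.2 ≤ 0}).Nonempty := by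
    refine ⟨(t, ‖φ‖⁻¹ • φ), ⟨⟨⟨ht, ht0⟩, ?_⟩, ?_⟩⟩
    · simp [norm_smul, hnφ.ne']
    · show (‖φ‖⁻¹ • φ) ⬝ᵥ K t *ᵥ (‖φ‖⁻¹ • φ) ≤ 0
      rw [hscale]
      nlinarith
  obtain ⟨⟨t1, ψ⟩, ⟨⟨⟨ht1, ht2⟩, hψ⟩, hle⟩, hmin⟩ := hcomp.exists_isMinOn hne (f := Prod.fst) continuous_fst.continuousOn
  simp only at ht1 ht2 hψ
  replace hle : ψ ⬝ᵥ K t1 *ᵥ ψ ≤ 0 := hle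
  have hψ0 : ψ ≠ 0 := by rintro rfl; simp at hψ
  have hpos : ∀ t, 0 ≤ t → t < t1 → ∀ χ : V → ℝ, 0 ≤ χ ⬝ᵥ K t *ᵥ χ := by
    intro t h1 h2 χ
    by_contra hn
    push Not at hn
    have hχ0 : χ ≠ 0 := by rintro rfl; simp at hn
    have hnχ : 0 < ‖χ‖ := norm_pos_iff.2 hχ0
    have := hmin (a := (t, ‖χ‖⁻¹ • χ)) ⟨⟨⟨h1, by simp only; linarith⟩, by simp [norm_smul, hnχ.ne']⟩, by
      show (‖χ‖⁻¹ • χ) ⬝ᵥ K t *ᵥ (‖χ‖⁻¹ • χ) ≤ 0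
      rw [hscale]
      exact mul_nonpos_of_nonneg_of_nonpos (by positivity) hn.le⟩
    simp at this; linarith
  have ht1' : 0 < t1 := by
    rcases ht1.lt_or_eq with h | h
    · exact h
    · exfalso; rw [← h, h0] at hle
      simp at hle
      have : 0 < ψ ⬝ᵥ ψ := by
        have := dotProduct_star_self_pos_iff.2 hψ0
        simpa using this
      linarith
  have hpsd : (K t1).PosSemidef := by
    refine PosSemidef.of_dotProduct_mulVec_nonneg (hs t1) fun χ => ?_
    have hcont : Continuous (fun t => χ ⬝ᵥ K t *ᵥ χ) := hF.comp (by fun_prop : Continuous (fun t => (t, χ)))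
    have hcl2 : IsClosed {t | 0 ≤ χ ⬝ᵥ K t *ᵥ χ} := isClosed_le continuous_const hcont
    have hsub : Set.Ico 0 t1 ⊆ {t | 0 ≤ χ ⬝ᵥ K t *ᵥ χ} := fun t ht => hpos t ht.1 ht.2 χ
    have := hcl2.closure_subset_iff.2 hsub
    rw [closure_Ico ht1'.ne] at this
    simpa using this ⟨ht1, le_rfl⟩
  have hz : star ψ ⬝ᵥ K t1 *ᵥ ψ = 0 := le_antisymm (by simpa using hle) (by simpa using hpsd.dotProduct_mulVec_nonneg ψ)
  exact hψ0 (hinv t1 ht1 ht2 ψ ((hpsd.dotProduct_mulVec_zero_iff ψ).1 hz))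
end mat
end TB
namespace TB
open Finset
section nrm
variable {V : Type*} [Fintype V] [DecidableEq V]
open Matrix
open scoped Matrix.Norms.L2Operator
noncomputable def n2 (φ : V → ℝ) : ℝ := Real.sqrt (∑ u, φ u ^ 2)
theorem n2_eq (φ : V → ℝ) : n2 φ = ‖(WithLp.toLp 2 φ : EuclideanSpace ℝ V)‖ := by
  rw [EuclideanSpace.norm_eq, n2]; simp
theorem n2_nonneg (φ : V → ℝ) : 0 ≤ n2 φ := Real.sqrt_nonneg _
theorem n2_sq (φ : V → ℝ) : n2 φ ^ 2 = ∑ u, φ u ^ 2 := Real.sq_sqrt (sum_nonneg fun _ _ => sq_nonneg _)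
theorem n2_dot (φ : V → ℝ) : n2 φ ^ 2 = φ ⬝ᵥ φ := by rw [n2_sq]; simp [dotProduct, sq]
theorem cs (φ ψ : V → ℝ) : |φ ⬝ᵥ ψ| ≤ n2 φ * n2 ψ := by
  have := abs_real_inner_le_norm (WithLp.toLp 2 φ : EuclideanSpace ℝ V) (WithLp.toLp 2 ψ)
  rw [n2_eq, n2_eq]
  refine le_trans (le_of_eq ?_) this
  simp [PiLp.inner_apply, dotProduct, mul_comm]
theorem n2_mulVec (M : Matrix V V ℝ) (φ : V → ℝ) : n2 (M *ᵥ φ) ≤ ‖M‖ * n2 φ := by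
  have := l2_opNorm_mulVec M (WithLp.toLp 2 φ : EuclideanSpace ℝ V)
  rw [n2_eq, n2_eq]; simpa using this
theorem bil (M : Matrix V V ℝ) (φ ψ : V → ℝ) : |φ ⬝ᵥ M *ᵥ ψ| ≤ ‖M‖ * (n2 φ * n2 ψ) := by
  refine (cs _ _).trans ?_
  have := mul_le_mul_of_nonneg_left (n2_mulVec M ψ) (n2_nonneg φ)
  linarith
theorem norm_le_of_bil (M : Matrix V V ℝ) (c : ℝ) (hc : 0 ≤ c) (h : ∀ φ ψ, φ ⬝ᵥ M *ᵥ ψ ≤ c * (n2 φ * n2 ψ)) : ‖M‖ ≤ c := by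
  rw [cstar_norm_def]
  refine ContinuousLinearMap.opNorm_le_bound _ hc fun x => ?_
  have h1 := h (M *ᵥ x.ofLp) x.ofLp
  rw [← n2_dot] at h1
  have e1 : ‖toEuclideanCLM (n := V) (𝕜 := ℝ) M x‖ = n2 (M *ᵥ x.ofLp) := by rw [n2_eq, ← ofLp_toEuclideanCLM]
  have e2 : ‖x‖ = n2 x.ofLp := by rw [n2_eq]
  rw [e1, e2]
  by_contra hlt
  push Not at hlt
  have h0 := n2_nonneg x.ofLp
  have : 0 < n2 (M *ᵥ x.ofLp) := lt_of_le_of_lt (by positivity) hlt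
  nlinarith
theorem norm_dom (M S : Matrix V V ℝ) (h : ∀ u v, |M u v| ≤ S u v) : ‖M‖ ≤ ‖S‖ := by
  refine norm_le_of_bil _ _ (norm_nonneg _) fun φ ψ => ?_
  have h1 := bil S (fun u => |φ u|) (fun u => |ψ u|)
  have e : ∀ φ : V → ℝ, n2 (fun u => |φ u|) = n2 φ := fun φ => by simp [n2]
  rw [e, e] at h1
  refine le_trans ?_ ((le_abs_self _).trans h1)
  simp only [dotProduct, mulVec]
  refine sum_le_sum fun u _ => ?_
  rw [mul_sum, mul_sum]
  refine sum_le_sum fun v _ => ?_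
  calc φ u * (M u v * ψ v) ≤ |φ u * (M u v * ψ v)| := le_abs_self _
    _ = |φ u| * (|M u v| * |ψ v|) := by rw [abs_mul, abs_mul]
    _ ≤ _ := by gcongr; exact h u v
theorem schur (M : Matrix V V ℝ) (r c : ℝ) (hr0 : 0 ≤ r) (hc0 : 0 ≤ c) (hr : ∀ u, ∑ v, |M u v| ≤ r) (hc : ∀ v, ∑ u, |M u v| ≤ c) : ‖M‖ ≤ Real.sqrt (r * c) := by
  refine norm_le_of_bil _ _ (Real.sqrt_nonneg _) fun φ ψ => ?_
  have h1 : φ ⬝ᵥ M *ᵥ ψ ≤ ∑ x : V × V, (Real.sqrt |M x.1 x.2| * |φ x.1|) * (Real.sqrt |M x.1 x.2| * |ψ x.2|) := by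
    rw [Fintype.sum_prod_type]
    simp only [dotProduct, mulVec, mul_sum]
    refine sum_le_sum fun u _ => sum_le_sum fun v _ => ?_
    refine (le_abs_self _).trans (le_of_eq ?_)
    rw [abs_mul, abs_mul]
    grind
  refine h1.trans ((Real.sum_mul_le_sqrt_mul_sqrt _ _ _).trans ?_)
  have a1 : ∑ x : V × V, (Real.sqrt |M x.1 x.2| * |φ x.1|) ^ 2 ≤ r * n2 φ ^ 2 := by
    rw [Fintype.sum_prod_type, n2_sq, mul_sum]
    refine sum_le_sum fun u _ => ?_
    simp only [mul_pow, Real.sq_sqrt (abs_nonneg _), sq_abs]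
    rw [← sum_mul]
    exact mul_le_mul_of_nonneg_right (hr u) (sq_nonneg _)
  have a2 : ∑ x : V × V, (Real.sqrt |M x.1 x.2| * |ψ x.2|) ^ 2 ≤ c * n2 ψ ^ 2 := by
    rw [Fintype.sum_prod_type_right, n2_sq, mul_sum]
    refine sum_le_sum fun u _ => ?_
    simp only [mul_pow, Real.sq_sqrt (abs_nonneg _), sq_abs]
    rw [← sum_mul]
    exact mul_le_mul_of_nonneg_right (hc u) (sq_nonneg _)
  refine (mul_le_mul (Real.sqrt_le_sqrt a1) (Real.sqrt_le_sqrt a2) (Real.sqrt_nonneg _) (Real.sqrt_nonneg _)).trans (le_of_eq ?_)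
  rw [Real.sqrt_mul hr0, Real.sqrt_mul hc0, Real.sqrt_mul hr0, Real.sqrt_sq (n2_nonneg _), Real.sqrt_sq (n2_nonneg _)]
  ring
theorem frob (M : Matrix V V ℝ) : ‖M‖ ^ 2 ≤ ∑ u, ∑ v, M u v ^ 2 := by
  have h0 : 0 ≤ ∑ u, ∑ v, M u v ^ 2 := sum_nonneg fun _ _ => sum_nonneg fun _ _ => sq_nonneg _
  have : ‖M‖ ≤ Real.sqrt (∑ u, ∑ v, M u v ^ 2) := by
    refine norm_le_of_bil _ _ (Real.sqrt_nonneg _) fun φ ψ => ?_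
    have h1 : φ ⬝ᵥ M *ᵥ ψ = ∑ x : V × V, M x.1 x.2 * (φ x.1 * ψ x.2) := by
      rw [Fintype.sum_prod_type]
      simp only [dotProduct, mulVec, mul_sum]
      refine sum_congr rfl fun u _ => sum_congr rfl fun v _ => by ring
    rw [h1]
    refine (Real.sum_mul_le_sqrt_mul_sqrt _ _ _).trans (le_of_eq ?_)
    rw [Fintype.sum_prod_type]
    congr 1
    rw [n2, n2, ← Real.sqrt_mul (sum_nonneg fun _ _ => sq_nonneg _), Fintype.sum_prod_type, sum_mul_sum]
    simp only [mul_pow]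
  calc _ ≤ Real.sqrt (∑ u, ∑ v, M u v ^ 2) ^ 2 := by gcongr
    _ = _ := Real.sq_sqrt h0
theorem norm_le_trace (M : Matrix V V ℝ) (hM : M.IsHermitian) (a : ℕ) : ‖M‖ ^ (2 ^ (a+1)) ≤ (M ^ (2 ^ (a+1))).trace := by
  have h1 : ‖M ^ (2 ^ a)‖ = ‖M‖ ^ (2 ^ a) := by
    have := IsSelfAdjoint.nnnorm_pow_two_pow (x := M) hM a
    exact congrArg NNReal.toReal this
  have h2 : (M ^ (2 ^ a)).IsHermitian := hM.pow _
  rw [pow_succ, pow_mul, ← h1]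
  refine (frob _).trans (le_of_eq ?_)
  rw [pow_mul, sq, Matrix.trace]
  simp only [Matrix.diag_apply, Matrix.mul_apply]
  refine sum_congr rfl fun u _ => sum_congr rfl fun v _ => ?_
  rw [sq]; congr 1
  have := h2.apply u v
  simpa using this.symm
theorem opm (P : Finset ℕ) (B T : ℕ → Matrix V V ℝ) (hB3 : ∀ p ∈ P, B p ^ 3 = B p) (hBs : ∀ p, (B p).IsHermitian) (hTs : ∀ p, (T p).IsHermitian)
    (J : ℕ) (ρ Λ Le : ℝ) (hρ : 1 ≤ ρ) (hE' : ‖EE P T‖ ≤ Le) (hLe : Le ≤ Λ) (hD : ‖DD P B‖ ≤ Λ) (h1 : ‖(1 : Matrix V V ℝ)‖ ≤ 1)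
    (hR : ∀ i, i = J+1 ∨ i = J+2 ∨ i = J+3 → ‖RR P B T i‖ ≤ 3 * ρ ^ i) (hJ : 24 * (Λ + 1) ≤ 2 ^ (J+1))
    (t : ℝ) (ht : 0 ≤ t) (htρ : t * (2 * ρ) ≤ 1) (φ : V → ℝ) :
    t * (φ ⬝ᵥ (BB P B - EE P T) *ᵥ φ) ≤ n2 φ ^ 2 + t ^ 2 * (φ ⬝ᵥ DD P B *ᵥ φ) + t ^ 3 * (Le * n2 φ ^ 2) := by
  have hE := hE'.trans hLe
  have hΛ : 0 ≤ Λ := (norm_nonneg _).trans hE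
  have hEs : (EE P T).IsHermitian := by
    rw [IsHermitian, EE, conjTranspose_sum]
    exact sum_congr rfl fun p _ => by rw [conjTranspose_smul, (hTs p).eq]; simp
  have hBBs : (BB P B).IsHermitian := by
    rw [IsHermitian, BB, conjTranspose_sum]
    exact sum_congr rfl fun p _ => (hBs p).eq
  have hDs : (DD P B).IsHermitian := by
    rw [IsHermitian, DD, conjTranspose_sum]
    exact sum_congr rfl fun p _ => ((hBs p).pow 2).eq
  have hsm : ∀ (c : ℝ) {M : Matrix V V ℝ}, M.IsHermitian → (c • M).IsHermitian := fun c M hM => by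
    simp_all
  have hKs : ∀ t, (KK P B T t).IsHermitian := fun t =>
    (((hsm _ isHermitian_one).add (hsm _ hEs)).sub (hsm _ hBBs)).add (hsm _ hDs)
  have hpos := pos_of_inv (KK P B T) (by unfold KK; fun_prop) hKs (by simp [KK]) (1 / (2 * ρ)) ?_ t ht (by rw [le_div_iff₀ (by linarith)]; exact htρ) φ
  · have e : φ ⬝ᵥ KK P B T t *ᵥ φ = (1 - t^2) * n2 φ ^ 2 + (t - t^3) * (φ ⬝ᵥ EE P T *ᵥ φ) - t * (φ ⬝ᵥ BB P B *ᵥ φ) + t ^ 2 * (φ ⬝ᵥ DD P B *ᵥ φ) := by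
      rw [KK, n2_dot]
      simp [add_mulVec, sub_mulVec, smul_mulVec, dotProduct_add, dotProduct_sub]
    rw [e] at hpos
    rw [sub_mulVec, dotProduct_sub]
    have h2 := (abs_le.1 ((bil (EE P T) φ φ).trans (mul_le_mul_of_nonneg_right hE' (mul_nonneg (n2_nonneg φ) (n2_nonneg φ))))).1
    have h3 : 0 ≤ t ^ 3 := by positivity
    nlinarith [sq_nonneg (t * n2 φ)]
  · intro s hs hs2 ψ hψ
    by_contra hψ0
    have hn : 0 < n2 ψ ^ 2 := by
      rw [n2_dot]
      have := dotProduct_star_self_pos_iff.2 hψ0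
      simpa using this
    have hsρ : s * ρ ≤ 1/2 := by
      rw [le_div_iff₀ (by linarith)] at hs2; linarith
    have hs1 : s ≤ 1/2 := by nlinarith
    have hz : ψ ⬝ᵥ (KK P B T s * ∑ j ∈ range (J+3), s^j • RR P B T j) *ᵥ ψ = 0 := by
      rw [← mulVec_mulVec, dotProduct_mulVec, ← mulVec_transpose]
      have : (KK P B T s)ᵀ = KK P B T s := by simpa using (hKs s).eq
      rw [this, hψ]; simp
    rw [KS P B T hB3 s J] at hz
    set tail := s^(J+3) • RR P B T (J+3) - s^(J+4) • ((DD P B - 1) * RR P B T (J+2) - EE P T * RR P B T (J+1)) + s^(J+5) • (EE P T * RR P B T (J+2)) with htail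
    have hpw : ∀ i, s ^ i * ρ ^ i ≤ (1/2)^i := fun i => by
      rw [← mul_pow]; exact pow_le_pow_left₀ (by positivity) hsρ i
    have hp0 : (0:ℝ) ≤ (1/2)^(J+1) := by positivity
    have hpw1 := hpw (J+1)
    have hpw2 : s ^ (J+2) * ρ ^ (J+2) ≤ (1/2)^(J+1) := (hpw (J+2)).trans (pow_le_pow_of_le_one (by norm_num) (by norm_num) (by omega))
    have hpw3 : s ^ (J+3) * ρ ^ (J+3) ≤ (1/2)^(J+1) := (hpw (J+3)).trans (pow_le_pow_of_le_one (by norm_num) (by norm_num) (by omega))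
    have hA : ‖tail‖ ≤ 1 / 2 := by
      have n3 : ‖s^(J+3) • RR P B T (J+3)‖ ≤ 3 * (1/2)^(J+1) := by
        rw [norm_smul, Real.norm_of_nonneg (by positivity)]
        calc _ ≤ s^(J+3) * (3 * ρ^(J+3)) := by gcongr; exact hR _ (by simp)
          _ ≤ _ := by linarith
      have nE : ∀ i k, (i = J+1 ∨ i = J+2) → i ≤ k → ∀ M : Matrix V V ℝ, ‖M‖ ≤ Λ + 1 → ‖s^k • (M * RR P B T i)‖ ≤ (Λ+1) * (3 * (1/2)^(J+1)) := by
        intro i k hi hk M hM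
        rw [norm_smul, Real.norm_of_nonneg (by positivity)]
        have hsk : s ^ k ≤ s ^ i := pow_le_pow_of_le_one hs (by linarith) hk
        have hri := hR i (by tauto)
        have hpi : s ^ i * ρ ^ i ≤ (1/2)^(J+1) := by rcases hi with rfl | rfl <;> assumption
        calc _ ≤ s ^ i * ((Λ + 1) * (3 * ρ ^ i)) := by
              gcongr
              exact (norm_mul_le _ _).trans (mul_le_mul hM hri (norm_nonneg _) (by linarith))
          _ = (Λ+1) * (3 * (s ^ i * ρ ^ i)) := by ring
          _ ≤ _ := by gcongr
      have hd1 : ‖DD P B - 1‖ ≤ Λ + 1 := (norm_sub_le _ _).trans (by linarith)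
      have x1 := nE (J+2) (J+4) (by simp) (by omega) _ hd1
      have x2 := nE (J+1) (J+4) (by simp) (by omega) (EE P T) (by linarith)
      have x3 := nE (J+2) (J+5) (by simp) (by omega) (EE P T) (by linarith)
      have key : 24 * (Λ + 1) * (1/2)^(J+1) ≤ 1 := by
        rw [one_div, inv_pow, ← div_eq_mul_inv, div_le_one (by positivity)]; exact hJ
      have y := norm_add_le (s^(J+3) • RR P B T (J+3) - s^(J+4) • ((DD P B - 1) * RR P B T (J+2) - EE P T * RR P B T (J+1))) (s^(J+5) • (EE P T * RR P B T (J+2)))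
      have y2 := norm_sub_le (s^(J+3) • RR P B T (J+3)) (s^(J+4) • ((DD P B - 1) * RR P B T (J+2) - EE P T * RR P B T (J+1)))
      have y3 := norm_sub_le (s^(J+4) • ((DD P B - 1) * RR P B T (J+2))) (s^(J+4) • (EE P T * RR P B T (J+1)))
      rw [← smul_sub] at y3
      nlinarith
    have e : (1 - s^2) • (1:Matrix V V ℝ) - s^(J+3) • RR P B T (J+3) + s^(J+4) • ((DD P B - 1) * RR P B T (J+2) - EE P T * RR P B T (J+1)) - s^(J+5) • (EE P T * RR P B T (J+2)) = (1 - s^2) • (1:Matrix V V ℝ) - tail := by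
      rw [htail]; abel
    rw [e, sub_mulVec, dotProduct_sub] at hz
    have e2 : ψ ⬝ᵥ ((1 - s^2) • (1:Matrix V V ℝ)) *ᵥ ψ = (1 - s^2) * n2 ψ ^ 2 := by
      rw [n2_dot]; simp [smul_mulVec]
    rw [e2] at hz
    have h3 := (abs_le.1 ((bil tail ψ ψ).trans (mul_le_mul_of_nonneg_right hA (mul_nonneg (n2_nonneg ψ) (n2_nonneg ψ))))).2
    have hs4 : s ^ 2 ≤ 1/4 := by nlinarith
    rw [← sq] at h3
    nlinarith [mul_le_mul_of_nonneg_right hs4 hn.le]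
end nrm
end TB
namespace TB
open Finset
section ops
open Matrix
open scoped Matrix.Norms.L2Operator
open Classical
abbrev VV := ℤ × Bool
abbrev LT := ℕ × Bool
def wkp (w : List LT) (v : VV) : VV := wk (w.map Prod.fst) v
@[simp] theorem wkp_nil (v) : wkp [] v = v := rfl
@[simp] theorem wkp_cons (a w v) : wkp (a :: w) v = stp a.1 (wkp w v) := rfl
theorem wkp_append (a b v) : wkp (a ++ b) v = wkp a (wkp b v) := by simp [wkp, wk_append]
theorem wkp_reverse (w v) : wkp w.reverse (wkp w v) = v := by simp [wkp, ← List.map_reverse]; rw [List.map_reverse]; exact wk_reverse _ _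
def ok (S : VV → Prop) : List LT → VV → Prop
  | [], v => S v
  | a :: w, v => ok S w v ∧ S (stp a.1 (wkp w v)) ∧ (a.2 = true → (a.1:ℤ) ∣ (wkp w v).1)
noncomputable def wt (a : LT) : ℝ := if a.2 then 1 else -(1 / (a.1:ℝ))
noncomputable def wg (w : List LT) : ℝ := (w.map wt).prod
theorem ok_last {S w v} (h : ok S w v) : S (wkp w v) := by
  cases w with
  | nil => exact h
  | cons a w => exact h.2.1
theorem ok_mono {S S' : VV → Prop} (hS : ∀ v, S v → S' v) {w v} (h : ok S w v) : ok S' w v := by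
  induction w with
  | nil => exact hS _ h
  | cons a w ih => exact ⟨ih h.1, hS _ h.2.1, h.2.2⟩
theorem ok_append {S a b v} : ok S (a ++ b) v ↔ ok S b v ∧ ok S a (wkp b v) := by
  induction a with
  | nil => simp [ok]; exact fun h => ok_last h
  | cons x a ih => simp only [List.cons_append, ok, ih, wkp_append]; tauto
theorem ok_reverse {S w v} (h : ok S w v) : ok S w.reverse (wkp w v) := by
  induction w with
  | nil => exact h
  | cons a w ih =>
    rw [List.reverse_cons, ok_append]
    refine ⟨⟨h.2.1, ?_, fun ha => ?_⟩, ?_⟩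
    · simp [stp_stp]; exact ok_last h.1
    · simp [stp_dvd]; exact h.2.2 ha
    · simp [stp_stp]; exact ih h.1
theorem ok_dw {S w v} (h : ok S w v) (hw : ∀ a ∈ w, a.2 = true) : dw (w.map Prod.fst) v := by
  induction w with
  | nil => trivial
  | cons a w ih => exact ⟨ih h.1 (fun b hb => hw b (by simp [hb])), h.2.2 (hw a (by simp))⟩
def fb (P : Finset ℕ) (Lm : ℕ) : List LT → VV → Prop
  | [], _ => False
  | a :: w, v => fb P Lm w v ∨ (a.2 = false ∧ (a.1 ∈ w.map Prod.fst ∨ ∃ q ∈ 0 :: w.map Prod.fst, BadL P Lm q (stp a.1 (wkp w v))))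
variable {P : Finset ℕ} {Lm j : ℕ}
theorem fb_left {w v} (c) (h : fb P Lm w v) : fb P Lm (c ++ w) v := by
  induction c with
  | nil => exact h
  | cons a c ih => exact Or.inl ih
theorem fb_right {w e v} (h : fb P Lm w (wkp e v)) : fb P Lm (w ++ e) v := by
  induction w with
  | nil => exact h.elim
  | cons a w ih =>
    rcases h with h | ⟨h1, h2⟩
    · exact Or.inl (ih h)
    · refine Or.inr ⟨h1, ?_⟩
      rcases h2 with h2 | ⟨q, hq, hb⟩
      · left; simp at h2 ⊢; tauto
      · right; refine ⟨q, by simp at hq ⊢; tauto, ?_⟩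
        change BadL P Lm q (stp a.1 (wkp (w ++ e) v)); rw [wkp_append]; exact hb
theorem lastF (w : List LT) : (∀ a ∈ w, a.2 = true) ∨ ∃ d x c, w = d ++ (x, false) :: c ∧ ∀ a ∈ d, a.2 = true := by
  induction w with
  | nil => left; simp
  | cons a w ih =>
    obtain ⟨p, f⟩ := a
    cases f with
    | false => right; exact ⟨[], p, w, rfl, by simp⟩
    | true =>
      grind
def Y0 (P : Finset ℕ) (j : ℕ) (v : VV) : Prop :=
  ∃ q y, y ≠ [] ∧ y.Nodup ∧ q ∉ y ∧ y.length ≤ j ∧ (∀ x ∈ q :: y, x ∈ P) ∧ dw (q :: (y ++ [q])) v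
def Yp (P : Finset ℕ) (j : ℕ) (v : VV) : Prop :=
  ∃ l, l.length ≤ j ∧ (∀ x ∈ l, x ∈ P) ∧ dw l v ∧ Y0 P j (wk l v)
theorem BadL_Y0 {l q v} (hl : l.length ≤ 2 * j) (hP : ∀ x ∈ l, x ∈ P) (hd : dw l v) (hY : Y0 P j (wk l v)) (hLm : 3 * j + 2 ≤ Lm) : BadL P Lm q v := by
  obtain ⟨q', y, h1, h2, h3, h4, h5, h6⟩ := hY
  refine ⟨(q' :: (y ++ [q'])) ++ l, by simp; omega, ?_, (dw_append _ _ _).2 ⟨hd, h6⟩, Or.inl ⟨q', y, l, by simp, h1, h2, h3⟩⟩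
  grind
theorem fb_Yp {S w v} (hLm : 3 * j + 2 ≤ Lm) (hok : ok S w v) (hP : ∀ a ∈ w, a.1 ∈ P) (hlen : w.length ≤ j)
    (hY : Yp P j (wkp w v)) (hm : ¬ ∀ a ∈ w, a.2 = true) : fb P Lm w v := by
  rcases lastF w with h | ⟨d, x, c, rfl, hd⟩
  · exact absurd h hm
  refine fb_left d (Or.inr ⟨rfl, Or.inr ⟨0, by simp, ?_⟩⟩)
  obtain ⟨l, h1, h2, h3, h4⟩ := hY
  have hok' := (ok_append.1 hok).2
  rw [wkp_append, wkp_cons] at h3 h4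
  refine BadL_Y0 (l := l ++ d.map Prod.fst) ?_ ?_ ((dw_append _ _ _).2 ⟨ok_dw hok' hd, h3⟩) (by rw [wk_append]; exact h4) hLm
  · simp at hlen ⊢; omega
  · intro y hy
    rw [List.mem_append, List.mem_map] at hy
    rcases hy with hy | ⟨a, ha, rfl⟩
    · exact h2 y hy
    · exact hP a (by simp [ha])
theorem Yp_of_Y0 {v} (h : Y0 P j v) : Yp P j v := ⟨[], by simp, by simp, trivial, h⟩
theorem ok_not {S : VV → Prop} {w v} (h : ok S w v) (hn : ¬ ok (fun u => S u ∧ ¬ Y0 P j u) w v) : ∃ c e, w = c ++ e ∧ Y0 P j (wkp e v) := by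
  induction w with
  | nil => exact ⟨[], [], rfl, by by_contra h'; exact hn ⟨h, h'⟩⟩
  | cons a w ih =>
    by_cases h1 : ok (fun u => S u ∧ ¬ Y0 P j u) w v
    · refine ⟨[], a :: w, rfl, ?_⟩
      by_contra h'
      exact hn ⟨h1, ⟨h.2.1, h'⟩, h.2.2⟩
    · obtain ⟨c, e, rfl, hc⟩ := ih h.1 h1
      grind
theorem a_not_r {S : VV → Prop} {w v} (hLm : 3 * j + 2 ≤ Lm) (hP : ∀ a ∈ w, a.1 ∈ P) (hlen : w.length ≤ j)
    (h : ok S w v) (hn : ¬ ok (fun u => S u ∧ ¬ Y0 P j u) w v) :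
    fb P Lm w v ∨ fb P Lm w.reverse (wkp w v) ∨ ((∀ a ∈ w, a.2 = true) ∧ Yp P j v ∧ Yp P j (wkp w v)) := by
  obtain ⟨c, e, rfl, hY⟩ := ok_not h hn
  have h1 := ok_append.1 h
  simp only [List.length_append] at hlen
  have hPc : ∀ a ∈ c, a.1 ∈ P := fun a ha => hP a (by simp [ha])
  have hPe : ∀ a ∈ e, a.1 ∈ P := fun a ha => hP a (by simp [ha])
  have h2 := ok_reverse h1.2
  by_cases he : ∀ a ∈ e, a.2 = true
  · by_cases hc : ∀ a ∈ c, a.2 = true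
    · right; right
      refine ⟨fun a ha => (List.mem_append.1 ha).elim (hc a) (he a), ⟨e.map Prod.fst, by simp; omega, ?_, ok_dw h1.1 he, hY⟩, ?_⟩
      · grind
      · refine ⟨c.reverse.map Prod.fst, by simp; omega, ?_, ?_, ?_⟩
        · grind
        · rw [wkp_append]; exact ok_dw h2 (fun a ha => hc a (List.mem_reverse.1 ha))
        · rw [wkp_append]; change Y0 P j (wkp c.reverse _); rw [wkp_reverse]; exact hY
    · right; left
      rw [List.reverse_append, wkp_append]
      refine fb_left _ (fb_Yp hLm h2 (fun a ha => hPc a (List.mem_reverse.1 ha)) (by simp; omega) ?_ ?_)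
      · rw [wkp_reverse]; exact Yp_of_Y0 hY
      · simpa using hc
  · left
    exact fb_left _ (fb_Yp hLm h1.1 hPe (by omega) (Yp_of_Y0 hY) he)
theorem r_not_a {S : VV → Prop} {w v} (hLm : 3 * j + 2 ≤ Lm) (hP : ∀ a ∈ w, a.1 ∈ P) (hlen : w.length ≤ j)
    (h : ok (fun u => S u ∧ ¬ Y0 P j u) w v) (hr : red w) :
    (w.map Prod.fst).Nodup ∨ fb P Lm w v ∨ fb P Lm w.reverse (wkp w v) := by
  induction w with
  | nil => left; simp
  | cons a w ih =>
    simp only [List.length_cons] at hlen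
    rcases ih (fun b hb => hP b (by simp [hb])) (by omega) h.1 hr.1 with h1 | h1 | h1
    · by_cases ha : a.1 ∈ w.map Prod.fst
      · right
        obtain ⟨y', c', hyc, hny⟩ := List.eq_append_cons_of_mem ha
        obtain ⟨y, w2, rfl, rfl, hw2⟩ := List.map_eq_append_iff.1 hyc
        obtain ⟨b, c, rfl, hb, rfl⟩ := List.map_eq_cons_iff.1 hw2
        obtain ⟨q, f⟩ := a
        obtain ⟨q2, f2⟩ := b
        simp only at hb
        subst hb
        cases f with
        | false => left; exact Or.inr ⟨rfl, Or.inl ha⟩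
        | true =>
        cases f2 with
        | false =>
          right
          rw [show ((q2, true) :: (y ++ (q2, false) :: c)) = ((q2,true) :: y) ++ ([(q2, false)] ++ c) by simp, List.reverse_append, List.reverse_append, wkp_append, wkp_append, List.append_assoc]
          refine fb_left _ (Or.inr ⟨rfl, Or.inl (by simp)⟩)
        | true =>
          have hA := (ok_append (a := (q2, true) :: y) (b := (q2, true) :: c)).1 h
          have hC := (ok_append (a := (q2, true) :: (y ++ [(q2, true)])) (b := c)).1 (by simpa using h)
          rcases lastF y with hy | ⟨d, x, y2, rfl, hd⟩
          · exfalso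
            refine (ok_last hC.1).2 ⟨q2, y.map Prod.fst, ?_, ?_, hny, ?_, ?_, ?_⟩
            · intro h0
              simp only [List.map_eq_nil_iff] at h0
              subst h0
              exact hr.2 ⟨rfl, rfl⟩
            · grind
            · simp at hlen ⊢; omega
            · simp_all
            · have := ok_dw hC.2 (by intro a ha; simp at ha; rcases ha with rfl | ha | rfl; rfl; exact hy a ha; rfl)
              simpa using this
          · left
            have e : ((q2, true) :: (d ++ (x, false) :: y2 ++ (q2, true) :: c)) = ((q2, true) :: d) ++ (x, false) :: (y2 ++ (q2, true) :: c) := by simp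
            rw [e] at h ⊢
            refine fb_left _ (Or.inr ⟨rfl, Or.inr ⟨q2, by simp, ?_⟩⟩)
            have h3 := ok_dw (ok_append.1 h).2 (by intro a ha; rcases List.mem_cons.1 ha with rfl | ha; rfl; exact hd a ha)
            refine ⟨_, ?_, ?_, h3, Or.inr rfl⟩
            · simp at hlen ⊢; omega
            · intro z hz
              obtain ⟨b, hb, rfl⟩ := List.mem_map.1 hz
              grind
      · grind
    · right; left; exact Or.inl h1
    · right; right
      rw [List.reverse_cons]
      refine fb_right ?_
      simpa [stp_stp] using h1
theorem nd_red {w : List LT} (h : (w.map Prod.fst).Nodup) : red w := by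
  induction w with
  | nil => trivial
  | cons a w ih =>
    rw [List.map_cons, List.nodup_cons] at h
    refine ⟨ih h.2, fun h2 => h.1 ?_⟩
    cases w with
    | nil => simp at h2
    | cons b w => simp at h2; simp [h2.2]
end ops
end TB
namespace TB
open Finset
section ops2
open Matrix
open scoped Matrix.Norms.L2Operator
open Classical
variable {P : Finset ℕ} {Lm j : ℕ}
theorem abs_wg_cons (a w) : |wg (a :: w)| = |wt a| * |wg w| := by simp [wg, abs_mul]
theorem abs_wt_f (p : ℕ) : |wt (p, false)| = 1 / (p:ℝ) := by simp [wt]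
theorem abs_wt_t (p : ℕ) : |wt (p, true)| = 1 := by simp [wt]
def rowb (P : Finset ℕ) (S : VV → Prop) (Δ : ℝ) : Prop :=
  ∀ v, S v → ∑ p ∈ P, (if (p:ℤ) ∣ v.1 then (1:ℝ) else 0) + ∑ p ∈ P, 1 / (p:ℝ) ≤ Δ
theorem row_step {S Δ} (h : rowb P S Δ) {v} (hv : S v) : ∑ a ∈ lets P, (if S (stp a.1 v) ∧ (a.2 = true → (a.1:ℤ) ∣ v.1) then |wt a| else 0) ≤ Δ := by
  refine le_trans ?_ (h v hv)
  rw [sum_lets]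
  refine add_le_add (sum_le_sum fun p _ => ?_) (sum_le_sum fun p _ => ?_)
  · simp only [abs_wt_t, forall_const]
    split_ifs <;> simp_all
  · simp only [abs_wt_f]
    split_ifs <;> simp_all
theorem rs_ok {S Δ} (h : rowb P S Δ) (h0 : 0 ≤ Δ) (v : VV) (n : ℕ) : ∑ w ∈ wds (lets P) n, (if ok S w v then |wg w| else 0) ≤ Δ ^ n := by
  induction n with
  | zero => rw [sum_wds_zero]; simp [wg]; split_ifs <;> norm_num
  | succ n ih =>
    rw [sum_wds_succ, pow_succ]
    refine le_trans ?_ (mul_le_mul_of_nonneg_right ih h0)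
    rw [sum_mul]
    refine sum_le_sum fun w _ => ?_
    by_cases hw : ok S w v
    · rw [if_pos hw]
      refine le_trans (le_of_eq ?_) (mul_le_mul_of_nonneg_left (row_step h (ok_last hw)) (abs_nonneg (wg w)))
      rw [mul_sum]
      refine sum_congr rfl fun a _ => ?_
      simp only [ok, hw, true_and, abs_wg_cons, mul_ite, mul_zero]
      split_ifs <;> ring
    · simp [ok, hw]
theorem rs_fb {S Δ H0 τ} (h : rowb P S Δ) (h1 : 1 ≤ Δ) (hH0 : 0 < H0) (hP : ∀ p ∈ P, H0 ≤ (p:ℝ)) (hτ0 : 0 ≤ τ)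
    (hτ : ∀ u, S u → ∀ q ∈ insert 0 P, ∑ x ∈ P, (if BadL P Lm q (stp x u) then (1:ℝ) / x else 0) ≤ τ)
    (v : VV) (n : ℕ) (hn : n ≤ j) : ∑ w ∈ wds (lets P) n, (if ok S w v ∧ fb P Lm w v then |wg w| else 0) ≤ n * Δ ^ n * (j / H0 + (j + 1) * τ) := by
  induction n with
  | zero => rw [sum_wds_zero]; simp [fb]
  | succ n ih =>
    have ih := ih (by omega)
    set η : ℝ := j / H0 + (j + 1) * τ with hη
    have hη0 : 0 ≤ η := by positivity
    have h0 : 0 ≤ Δ := by linarith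
    have key : ∀ w ∈ wds (lets P) n, ∑ a ∈ lets P, (if ok S (a :: w) v ∧ fb P Lm (a :: w) v then |wg (a :: w)| else 0) ≤
        (if ok S w v ∧ fb P Lm w v then |wg w| else 0) * Δ + (if ok S w v then |wg w| else 0) * η := by
      intro w hw
      obtain ⟨hwl, hwP⟩ := mem_wds.1 hw
      by_cases ho : ok S w v
      swap
      · simp [ok, ho]
      have hS := ok_last ho
      by_cases hf : fb P Lm w v
      · simp only [ho, hf, true_and, if_true, and_self]
        have : 0 ≤ |wg w| * η := by positivity
        refine le_trans ?_ (le_add_of_nonneg_right this)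
        refine le_trans (le_of_eq ?_) (mul_le_mul_of_nonneg_left (row_step h hS) (abs_nonneg (wg w)))
        rw [mul_sum]
        refine sum_congr rfl fun a _ => ?_
        simp only [ok, ho, true_and, abs_wg_cons, mul_ite, mul_zero, fb, hf, true_or, and_true]
        split_ifs <;> ring
      · simp only [ho, hf, and_false, if_false, zero_mul, zero_add, if_true]
        rw [sum_lets]
        have z : ∑ p ∈ P, (if ok S ((p, true) :: w) v ∧ fb P Lm ((p, true) :: w) v then |wg ((p, true) :: w)| else 0) = 0 :=
          sum_eq_zero fun p _ => by simp [fb, hf]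
        rw [z, zero_add]
        have b1 : ∀ p ∈ P, (if ok S ((p, false) :: w) v ∧ fb P Lm ((p, false) :: w) v then |wg ((p, false) :: w)| else 0) ≤
            |wg w| * ((if p ∈ w.map Prod.fst then 1 / (p:ℝ) else 0) + ∑ q ∈ (0 :: w.map Prod.fst).toFinset, (if BadL P Lm q (stp p (wkp w v)) then (1:ℝ) / p else 0)) := by
          intro p _
          have nn : ∀ q, (0:ℝ) ≤ (if BadL P Lm q (stp p (wkp w v)) then (1:ℝ) / p else 0) := fun q => by split_ifs <;> positivity
          have nn2 : (0:ℝ) ≤ if p ∈ w.map Prod.fst then 1 / (p:ℝ) else 0 := by split_ifs <;> positivity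
          by_cases hc : ok S ((p, false) :: w) v ∧ fb P Lm ((p, false) :: w) v
          · rw [if_pos hc, abs_wg_cons, abs_wt_f, mul_comm]
            refine mul_le_mul_of_nonneg_left ?_ (abs_nonneg _)
            rcases hc.2 with hc | ⟨-, hc | ⟨q, hq, hb⟩⟩
            · exact absurd hc hf
            · replace hc : p ∈ w.map Prod.fst := hc
              rw [if_pos hc]; exact le_add_of_nonneg_right (sum_nonneg fun q _ => nn q)
            · refine le_trans ?_ (le_add_of_nonneg_left nn2)
              refine le_trans ?_ (single_le_sum (fun q _ => nn q) (List.mem_toFinset.2 hq))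
              grind
          · rw [if_neg hc]; exact mul_nonneg (abs_nonneg _) (add_nonneg nn2 (sum_nonneg fun q _ => nn q))
        refine (sum_le_sum b1).trans ?_
        rw [← mul_sum]
        refine mul_le_mul_of_nonneg_left ?_ (abs_nonneg _)
        rw [sum_add_distrib]
        refine add_le_add ?_ ?_
        · rw [← sum_filter]
          have : (filter (fun p => p ∈ w.map Prod.fst) P) ⊆ (w.map Prod.fst).toFinset := fun p hp => List.mem_toFinset.2 (mem_filter.1 hp).2
          have hc : ((filter (fun p => p ∈ w.map Prod.fst) P).card : ℝ) ≤ j := by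
            have := (card_le_card this).trans (List.toFinset_card_le _)
            rw [List.length_map, hwl] at this
            exact_mod_cast this.trans (by omega)
          calc _ ≤ ∑ p ∈ filter (fun p => p ∈ w.map Prod.fst) P, 1 / H0 := sum_le_sum fun p hp => one_div_le_one_div_of_le hH0 (hP p (mem_filter.1 hp).1)
            _ = (filter (fun p => p ∈ w.map Prod.fst) P).card * (1 / H0) := by rw [sum_const, nsmul_eq_mul]
            _ ≤ j * (1 / H0) := by gcongr
            _ = _ := by ring
        · rw [sum_comm]
          have hc : (((0 :: w.map Prod.fst).toFinset).card : ℝ) ≤ j + 1 := by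
            have := List.toFinset_card_le (0 :: w.map Prod.fst)
            rw [List.length_cons, List.length_map, hwl] at this
            exact_mod_cast this.trans (by omega)
          calc _ ≤ ∑ q ∈ (0 :: w.map Prod.fst).toFinset, τ := by
                refine sum_le_sum fun q hq => hτ _ hS q ?_
                rw [List.mem_toFinset] at hq
                rcases List.mem_cons.1 hq with rfl | hq
                · simp
                · obtain ⟨a, ha, rfl⟩ := List.mem_map.1 hq
                  have := hwP a ha
                  simp [lets] at this; simp [this]
            _ = ((0 :: w.map Prod.fst).toFinset).card * τ := by rw [sum_const, nsmul_eq_mul]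
            _ ≤ _ := by gcongr
    rw [sum_wds_succ]
    refine (sum_le_sum key).trans ?_
    rw [sum_add_distrib, ← sum_mul, ← sum_mul]
    have x1 := mul_le_mul_of_nonneg_right ih h0
    have x2 := mul_le_mul_of_nonneg_right (rs_ok h h0 v n) hη0
    refine (add_le_add x1 x2).trans ?_
    have x3 : Δ ^ n * η ≤ Δ ^ (n+1) * η := mul_le_mul_of_nonneg_right (pow_le_pow_right₀ h1 (by omega)) hη0
    push_cast
    rw [pow_succ] at x3 ⊢
    nlinarith
variable {I : Finset VV}
noncomputable def ind (I : Finset VV) (S : VV → Prop) (a : LT) : Matrix I I ℝ := fun u v =>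
  if S u ∧ S v ∧ u.1 = stp a.1 v.1 ∧ (a.2 = true → (a.1:ℤ) ∣ v.1.1) then 1 else 0
noncomputable def Bm (I : Finset VV) (S : VV → Prop) (p : ℕ) : Matrix I I ℝ := ind I S (p, true)
noncomputable def Tm (I : Finset VV) (S : VV → Prop) (p : ℕ) : Matrix I I ℝ := ind I S (p, false)
theorem mt_ind (S : VV → Prop) (a : LT) : mt (Bm I S) (Tm I S) a = wt a • ind I S a := by
  obtain ⟨p, f⟩ := a
  cases f <;> simp [mt, wt, Bm, Tm]
theorem ind_symm (S : VV → Prop) (a : LT) : (ind I S a).IsHermitian := by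
  ext u v
  simp only [conjTranspose_apply, star_trivial, ind]
  refine if_congr ?_ rfl rfl
  have : ∀ u v : VV, u = stp a.1 v → v = stp a.1 u := fun u v h => by rw [h, stp_stp]
  constructor
  · rintro ⟨h1, h2, h3, h4⟩
    refine ⟨h2, h1, this _ _ h3, fun h => ?_⟩
    rw [h3, stp_dvd _ _ _ rfl]; exact h4 h
  · rintro ⟨h1, h2, h3, h4⟩
    refine ⟨h2, h1, this _ _ h3, fun h => ?_⟩
    rw [h3, stp_dvd _ _ _ rfl]; exact h4 h
theorem prod_entry (S : VV → Prop) (hS : ∀ v, S v → v ∈ I) (w : List LT) (hw : w ≠ []) (u v : I) :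
    ((w.map (mt (Bm I S) (Tm I S))).prod : Matrix I I ℝ) u v = if ok S w v ∧ wkp w v = u.1 then wg w else 0 := by
  induction w generalizing u with
  | nil => exact absurd rfl hw
  | cons a w ih =>
    rw [List.map_cons, List.prod_cons, mt_ind]
    cases w with
    | nil =>
      simp only [List.map_nil, List.prod_nil, mul_one, Matrix.smul_apply, ind, ok, wg, List.map_cons, List.prod_cons, wkp_cons, wkp_nil, smul_eq_mul, mul_ite, mul_one, mul_zero]
      refine if_congr ?_ rfl rfl
      constructor
      · rintro ⟨h1, h2, h3, h4⟩; exact ⟨⟨h2, h3 ▸ h1, h4⟩, h3.symm⟩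
      · rintro ⟨⟨h2, h1, h4⟩, h3⟩; exact ⟨h3 ▸ h1, h2, h3.symm, h4⟩
    | cons b w =>
      have ih' := ih (by simp)
      generalize hw' : b :: w = w' at *
      rw [smul_mul, Matrix.smul_apply, Matrix.mul_apply, smul_eq_mul]
      simp only [ih']
      by_cases ho : ok S w' v
      · have hm := hS _ (ok_last ho)
        rw [sum_eq_single ⟨wkp w' v, hm⟩]
        · simp only [ho, true_and, if_true, ind, ok, wkp_cons, wg, List.map_cons, List.prod_cons]
          by_cases hc : S (stp a.1 (wkp w' v)) ∧ (a.2 = true → (a.1:ℤ) ∣ (wkp w' v).1) ∧ stp a.1 (wkp w' v) = u.1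
          · rw [if_pos, if_pos]
            · ring
            · exact ⟨⟨hc.1, hc.2.1⟩, hc.2.2⟩
            · exact ⟨hc.2.2 ▸ hc.1, ok_last ho, hc.2.2.symm, hc.2.1⟩
          · rw [if_neg, if_neg]
            · ring
            · rintro ⟨⟨h1, h2⟩, h3⟩; exact hc ⟨h1, h2, h3⟩
            · rintro ⟨h1, h2, h3, h4⟩; exact hc ⟨h3 ▸ h1, h4, h3.symm⟩
        · intro x _ hx
          have : ¬ (wkp w' v = x.1) := fun h => hx (Subtype.ext h.symm)
          simp [this]
        · simp
      · simp [ok, ho]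
end ops2
end TB
namespace TB
open Finset
section ops3
open Matrix
open scoped Matrix.Norms.L2Operator
open Classical
variable {P : Finset ℕ} {Lm j : ℕ} {I : Finset VV}
def nd (w : List LT) : Prop := (w.map Prod.fst).Nodup
def pureD (w : List LT) : Prop := ∀ a ∈ w, a.2 = true
noncomputable def Ah (P : Finset ℕ) (I : Finset VV) (n : ℕ) : Matrix I I ℝ := fun u v =>
  ∑ w ∈ wds (lets P) n, if nd w ∧ ok (· ∈ I) w v ∧ wkp w v = u.1 then wg w else 0
noncomputable def T1 (P : Finset ℕ) (I : Finset VV) (Lm n : ℕ) : Matrix I I ℝ := fun u v =>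
  ∑ w ∈ wds (lets P) n, if (ok (· ∈ I) w v ∧ fb P Lm w v) ∧ wkp w v = u.1 then |wg w| else 0
theorem sum_pt {I : Finset VV} (x : VV) (c : ℝ) (hc : 0 ≤ c) (p : Prop) [Decidable p] : ∑ u : I, (if p ∧ x = u.1 then c else 0) ≤ if p then c else 0 := by
  by_cases hp : p
  · simp only [hp, true_and, if_true]
    by_cases hx : x ∈ I
    · rw [sum_eq_single ⟨x, hx⟩]
      · simp
      · grind
      · simp
    · rw [sum_eq_zero]
      · exact hc
      · grind
  · simp [hp]
theorem T1_nonneg (n u v) : 0 ≤ T1 P I Lm n u v := sum_nonneg fun w _ => by split_ifs <;> positivity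
theorem wg_reverse (w) : wg w.reverse = wg w := by simp [wg, List.prod_reverse]
theorem T1_norm {Δ H0 τ} (h : rowb P (· ∈ I) Δ) (h1 : 1 ≤ Δ) (hH0 : 0 < H0) (hP : ∀ p ∈ P, H0 ≤ (p:ℝ)) (hτ0 : 0 ≤ τ)
    (hτ : ∀ u, u ∈ I → ∀ q ∈ insert 0 P, ∑ x ∈ P, (if BadL P Lm q (stp x u) then (1:ℝ) / x else 0) ≤ τ)
    (n : ℕ) (hn : n ≤ j) : ‖T1 P I Lm n‖ ≤ Real.sqrt (Δ ^ n * (n * Δ ^ n * (j / H0 + (j + 1) * τ))) := by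
  refine schur _ _ _ (by positivity) (by positivity) (fun u => ?_) (fun v => ?_)
  · simp only [abs_of_nonneg (T1_nonneg n _ _)]
    simp only [T1]
    rw [sum_comm]
    refine le_trans ?_ (rs_ok h (by linarith) u n)
    rw [← sum_wds_reverse _ _ (fun w => if ok (· ∈ I) w u.1 then |wg w| else 0)]
    refine sum_le_sum fun w _ => ?_
    refine le_trans ?_ (sum_pt (I := I) (wkp w.reverse u) _ (abs_nonneg _) _)
    refine sum_le_sum fun v _ => ?_
    by_cases hc : (ok (· ∈ I) w v ∧ fb P Lm w v) ∧ wkp w v = u.1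
    · rw [if_pos hc, if_pos]
      · rw [wg_reverse]
      · rw [← hc.2]; exact ⟨ok_reverse hc.1.1, wkp_reverse _ _⟩
    · grind
  · simp only [abs_of_nonneg (T1_nonneg n _ _)]
    simp only [T1]
    rw [sum_comm]
    exact (sum_le_sum fun w _ => sum_pt _ _ (abs_nonneg _) _).trans (rs_fb h h1 hH0 hP hτ0 hτ v n hn)
theorem n2_restrict {V : Type*} [Fintype V] (s : V → Prop) (φ : V → ℝ) : n2 (fun u => if s u then φ u else 0) ≤ n2 φ := by
  refine Real.sqrt_le_sqrt (sum_le_sum fun u _ => ?_)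
  dsimp only
  split_ifs
  · exact le_rfl
  · nlinarith [sq_nonneg (φ u)]
theorem restrict_norm {V : Type*} [Fintype V] [DecidableEq V] (s : V → Prop) (M : Matrix V V ℝ) : ‖Matrix.of (fun u v => if s u ∧ s v then M u v else 0)‖ ≤ ‖M‖ := by
  refine norm_le_of_bil _ _ (norm_nonneg _) fun φ ψ => ?_
  have h1 := (le_abs_self _).trans (bil M (fun u => if s u then φ u else 0) (fun u => if s u then ψ u else 0))
  have h2 := mul_le_mul (n2_restrict s φ) (n2_restrict s ψ) (n2_nonneg _) (n2_nonneg _)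
  refine le_trans (le_of_eq ?_) (h1.trans (mul_le_mul_of_nonneg_left h2 (norm_nonneg _)))
  simp only [dotProduct, mulVec, mul_sum, Matrix.of_apply]
  grind
theorem wg_pure {w} (h : pureD w) : wg w = 1 := by
  refine List.prod_eq_one fun x hx => ?_
  obtain ⟨a, ha, rfl⟩ := List.mem_map.1 hx
  simp [wt, h a ha]
theorem R_norm {ρ : ℝ} {n : ℕ} (hLm : 3 * j + 2 ≤ Lm) (hn : n ≤ j) (hn1 : n ≠ 0) (hA : ‖Ah P I n‖ ≤ ρ) (hρ : 1 ≤ ρ) (hT : ‖T1 P I Lm n‖ ≤ 1/3) :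
    ‖RR P (Bm I (fun u => u ∈ I ∧ ¬ Y0 P j u)) (Tm I (fun u => u ∈ I ∧ ¬ Y0 P j u)) n‖ ≤ 3 * ρ := by
  set Z : VV → Prop := fun u => u ∈ I ∧ ¬ Y0 P j u with hZ
  have hRe : ∀ u v, RR P (Bm I Z) (Tm I Z) n u v = ∑ w ∈ wds (lets P) n, if red w ∧ ok Z w v ∧ wkp w v = u.1 then wg w else 0 := by
    intro u v
    rw [RR, Matrix.sum_apply]
    refine sum_congr rfl fun w hw => ?_
    have hne : w ≠ [] := by rintro rfl; exact hn1 (mem_wds.1 hw).1.symm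
    by_cases hr : red w
    · simp only [hr, if_true, true_and]
      exact prod_entry Z (fun v h => h.1) w hne u v
    · simp [hr]
  set X : Matrix I I ℝ := fun u v => ∑ w ∈ wds (lets P) n, if pureD w ∧ nd w ∧ (ok (· ∈ I) w v ∧ ¬ ok Z w v ∧ ¬ fb P Lm w v ∧ ¬ fb P Lm w.reverse u.1) ∧ wkp w v = u.1 then (1:ℝ) else 0 with hX
  set XD : Matrix I I ℝ := fun u v => if Yp P j u.1 ∧ Yp P j v.1 then ∑ w ∈ wds (lets P) n, (if pureD w ∧ nd w ∧ ok (· ∈ I) w v ∧ wkp w v = u.1 then (1:ℝ) else 0) else 0 with hXD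
  set YA : Matrix I I ℝ := fun u v => if Yp P j u.1 ∧ Yp P j v.1 then Ah P I n u v else 0 with hYA
  have wP : ∀ w ∈ wds (lets P) n, (∀ a ∈ w, a.1 ∈ P) ∧ w.length ≤ j := by
    intro w hw
    obtain ⟨h1, h2⟩ := mem_wds.1 hw
    exact ⟨fun a ha => by have := h2 a ha; simp [lets] at this; exact this, by omega⟩
  have hmono : ∀ w v, ok Z w v → ok (· ∈ I) w v := fun w v h => ok_mono (fun _ h => h.1) h
  have c1 : ‖X‖ ≤ ‖XD‖ := by
    refine norm_dom _ _ fun u v => ?_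
    have h0 : 0 ≤ X u v := sum_nonneg fun w _ => by split_ifs <;> norm_num
    rw [abs_of_nonneg h0]
    by_cases hY : Yp P j u.1 ∧ Yp P j v.1
    · simp only [hXD, hY, if_true, and_self]
      refine sum_le_sum fun w _ => ?_
      grind
    · simp only [hXD, hY, if_false]
      refine le_of_eq (sum_eq_zero fun w hw => ?_)
      rw [if_neg]
      rintro ⟨h1, h2, ⟨h3, h4, h5, h6⟩, h7⟩
      obtain ⟨g1, g2⟩ := wP w hw
      rcases a_not_r hLm g1 g2 h3 h4 with h | h | h
      · exact h5 h
      · grind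
      · grind
  have c2 : ‖YA - XD‖ ≤ ‖T1 P I Lm n‖ := by
    refine norm_dom _ _ fun u v => ?_
    rw [Matrix.sub_apply]
    by_cases hY : Yp P j u.1 ∧ Yp P j v.1
    · simp only [hXD, hYA, hY, if_true, and_self, Ah, T1]
      rw [← sum_sub_distrib]
      refine (abs_sum_le_sum_abs _ _).trans (sum_le_sum fun w hw => ?_)
      by_cases hc : nd w ∧ ok (· ∈ I) w v ∧ wkp w v = u.1
      · by_cases hp : pureD w
        · simp only [hp, hc, wg_pure hp, true_and, and_true, if_true, sub_self, abs_zero]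
          split_ifs <;> positivity
        · obtain ⟨g1, g2⟩ := wP w hw
          have : fb P Lm w v := fb_Yp hLm hc.2.1 g1 g2 (by rw [hc.2.2]; exact hY.1) hp
          simp [hp, hc, this]
      · grind
    · simp only [hXD, hYA, hY, if_false, sub_self, abs_zero]
      exact T1_nonneg _ _ _
  have c3 : ‖YA‖ ≤ ρ := (restrict_norm (fun u : I => Yp P j u.1) _).trans hA
  have c4 : ‖RR P (Bm I Z) (Tm I Z) n - Ah P I n + X‖ ≤ ‖T1 P I Lm n + (T1 P I Lm n)ᴴ‖ := by
    refine norm_dom _ _ fun u v => ?_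
    rw [Matrix.add_apply, Matrix.sub_apply, hRe, Matrix.add_apply, conjTranspose_apply, star_trivial]
    have e : T1 P I Lm n v u = ∑ w ∈ wds (lets P) n, if (ok (· ∈ I) w.reverse u ∧ fb P Lm w.reverse u) ∧ wkp w.reverse u = v.1 then |wg w| else 0 := by
      rw [T1, ← sum_wds_reverse]; simp only [wg_reverse]
    rw [e]
    simp only [Ah, T1, hX]
    rw [← sum_sub_distrib, ← sum_add_distrib, ← sum_add_distrib]
    refine (abs_sum_le_sum_abs _ _).trans (sum_le_sum fun w hw => ?_)
    obtain ⟨g1, g2⟩ := wP w hw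
    by_cases hu : wkp w v = u.1
    swap
    · simp only [hu, and_false, if_false, sub_self, add_zero, abs_zero, zero_add]
      split_ifs <;> positivity
    by_cases hI : ok (· ∈ I) w v
    swap
    · have hz : ¬ ok Z w v := fun h => hI (hmono _ _ h)
      simp only [hI, hz, and_false, false_and, if_false, sub_self, add_zero, abs_zero, zero_add]
      split_ifs <;> positivity
    have hI' := ok_reverse hI
    have hr' := wkp_reverse w v
    rw [hu] at hI' hr'
    simp only [hu, hI, hI', hr', and_true, true_and]
    by_cases hf : fb P Lm w v ∨ fb P Lm w.reverse u
    · have b0 : |wg w| ≤ (if fb P Lm w v then |wg w| else 0) + (if fb P Lm w.reverse u then |wg w| else 0) := by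
        rcases hf with hf | hf
        · rw [if_pos hf]; exact le_add_of_nonneg_right (by split_ifs <;> positivity)
        · rw [if_pos hf]; exact le_add_of_nonneg_left (by split_ifs <;> positivity)
      refine le_trans ?_ b0
      have : ¬ (pureD w ∧ nd w ∧ ¬ ok Z w v ∧ ¬ fb P Lm w v ∧ ¬ fb P Lm w.reverse u) := fun h => hf.elim h.2.2.2.1 h.2.2.2.2
      rw [if_neg this, add_zero]
      split_ifs <;> simp
    · push Not at hf
      simp only [hf.1, hf.2, not_false_eq_true, and_true, if_false, add_zero]
      refine le_of_eq (abs_eq_zero.2 ?_)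
      by_cases hz : ok Z w v
      · have : red w ↔ nd w := by
          refine ⟨fun h => ?_, nd_red⟩
          rcases r_not_a hLm g1 g2 hz h with h | h | h
          · exact h
          · exact absurd h hf.1
          · rw [hu] at h; exact absurd h hf.2
        simp [hz, this]
      · by_cases hnd : nd w
        · have hp : pureD w := by
            rcases a_not_r hLm g1 g2 hI hz with h | h | h
            · exact absurd h hf.1
            · rw [hu] at h; exact absurd h hf.2
            · exact h.1
          simp [hz, hnd, hp, wg_pure hp]
        · simp [hz, hnd]
  have c5 : ‖XD‖ ≤ ρ + 1/3 := by
    have : XD = YA - (YA - XD) := by abel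
    rw [this]; exact (norm_sub_le _ _).trans (by linarith)
  have c6 : ‖T1 P I Lm n + (T1 P I Lm n)ᴴ‖ ≤ 2/3 := by
    refine (norm_add_le _ _).trans ?_
    rw [l2_opNorm_conjTranspose]; linarith
  have : RR P (Bm I Z) (Tm I Z) n = (RR P (Bm I Z) (Tm I Z) n - Ah P I n + X) + Ah P I n - X := by abel
  rw [this]
  refine (norm_sub_le _ _).trans ?_
  have := norm_add_le (RR P (Bm I Z) (Tm I Z) n - Ah P I n + X) (Ah P I n)
  linarith
end ops3
end TB
namespace TB
open Finset
section ops4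
open Matrix
open scoped Matrix.Norms.L2Operator
open Classical
variable {P : Finset ℕ} {Lm j : ℕ} {I : Finset VV} {S : VV → Prop}
theorem B2_entry (hS : ∀ v, S v → v ∈ I) (p : ℕ) (u v : I) : (Bm I S p ^ 2) u v = if S v.1 ∧ S (stp p v.1) ∧ (p:ℤ) ∣ v.1.1 ∧ u = v then 1 else 0 := by
  have := prod_entry S hS [(p, true), (p, true)] (by simp) u v
  simp only [List.map_cons, List.map_nil, List.prod_cons, List.prod_nil, mul_one, mt_ind, wt, if_true, one_smul, wg, ok, wkp_cons, wkp_nil, stp_stp, stp_dvd p p _ rfl] at this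
  rw [sq]; refine this.trans (if_congr ?_ rfl rfl)
  grind
theorem B3 (hS : ∀ v, S v → v ∈ I) (p : ℕ) : Bm I S p ^ 3 = Bm I S p := by
  rw [pow_succ]
  ext u v
  rw [Matrix.mul_apply, sum_eq_single u]
  · rw [B2_entry hS]
    change _ * (if S u.1 ∧ S v.1 ∧ u.1 = stp p v.1 ∧ (true = true → (p:ℤ) ∣ v.1.1) then (1:ℝ) else 0) = (if S u.1 ∧ S v.1 ∧ u.1 = stp p v.1 ∧ (true = true → (p:ℤ) ∣ v.1.1) then (1:ℝ) else 0)
    by_cases h : S u.1 ∧ S v.1 ∧ u.1 = stp p v.1 ∧ (true = true → (p:ℤ) ∣ v.1.1)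
    · rw [if_pos h, if_pos, mul_one]
      obtain ⟨h1, h2, h3, h4⟩ := h
      refine ⟨h1, ?_, ?_, rfl⟩
      · rw [h3, stp_stp]; exact h2
      · rw [h3, stp_dvd p p _ rfl]; exact h4 rfl
    · rw [if_neg h, mul_zero]
  · intro x _ hx
    rw [B2_entry hS, if_neg, zero_mul]
    grind
  · simp
theorem DD_entry (hS : ∀ v, S v → v ∈ I) (u v : I) : ∃ c : ℝ, 0 ≤ c ∧ c ≤ ∑ p ∈ P, (if (p:ℤ) ∣ v.1.1 then (1:ℝ) else 0) ∧ DD P (Bm I S) u v = if u = v then c else 0 := by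
  refine ⟨∑ p ∈ P, if S v.1 ∧ S (stp p v.1) ∧ (p:ℤ) ∣ v.1.1 then (1:ℝ) else 0, sum_nonneg fun _ _ => by split_ifs <;> norm_num, sum_le_sum fun p _ => ?_, ?_⟩
  · split_ifs <;> simp_all
  · rw [DD, Matrix.sum_apply]
    simp only [B2_entry hS]
    by_cases h : u = v <;> simp [h]
theorem DD_quad (hS : ∀ v, S v → v ∈ I) (φ : I → ℝ) (d : ℝ) (hd : ∀ v : I, φ v ≠ 0 → ∑ p ∈ P, (if (p:ℤ) ∣ v.1.1 then (1:ℝ) else 0) ≤ d) :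
    φ ⬝ᵥ DD P (Bm I S) *ᵥ φ ≤ d * n2 φ ^ 2 := by
  rw [n2_sq, mul_sum]
  refine sum_le_sum fun u _ => ?_
  rw [mulVec, dotProduct, sum_eq_single u]
  · obtain ⟨c, h1, h2, h3⟩ := DD_entry (P := P) hS u u
    rw [h3, if_pos rfl]
    by_cases h : φ u = 0
    · simp [h]
    · have := h2.trans (hd u h)
      nlinarith [sq_nonneg (φ u)]
  · intro v _ hv
    obtain ⟨c, h1, h2, h3⟩ := DD_entry (P := P) hS u v
    grind
  · simp
theorem DD_norm (hS : ∀ v, S v → v ∈ I) (d : ℝ) (hd0 : 0 ≤ d) (hd : ∀ v ∈ I, ∑ p ∈ P, (if (p:ℤ) ∣ v.1 then (1:ℝ) else 0) ≤ d) : ‖DD P (Bm I S)‖ ≤ d := by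
  have key : ∀ u v : I, |DD P (Bm I S) u v| ≤ if u = v then d else 0 := fun u v => by
    obtain ⟨c, h1, h2, h3⟩ := DD_entry (P := P) hS u v
    grind
  refine (schur _ d d hd0 hd0 (fun u => (sum_le_sum fun v _ => key u v).trans ?_) (fun v => (sum_le_sum fun u _ => key u v).trans ?_)).trans (le_of_eq (Real.sqrt_mul_self hd0))
  · simp
  · simp
theorem EE_norm : ‖EE P (Tm I S)‖ ≤ ∑ p ∈ P, 1 / (p:ℝ) := by
  refine (norm_sum_le _ _).trans (sum_le_sum fun p _ => ?_)
  rw [norm_smul, Real.norm_of_nonneg (by positivity)]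
  have : ‖Tm I S p‖ ≤ 1 := by
    refine (schur _ 1 1 zero_le_one zero_le_one ?_ ?_).trans (by simp)
    · intro u
      refine le_trans (sum_le_sum fun v _ => ?_) ((sum_pt (I := I) (stp p u) 1 zero_le_one True).trans (by simp))
      simp only [Tm, ind]
      split_ifs with h1 h2 h3 <;> first | norm_num | skip
      · exfalso; apply h3; rw [h1.2.2.1, stp_stp]; exact ⟨trivial, rfl⟩
      · grind
    · intro u
      refine le_trans (sum_le_sum fun v _ => ?_) ((sum_pt (I := I) (stp p u) 1 zero_le_one True).trans (by simp))
      simp only [Tm, ind]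
      grind
  have h0 : 0 ≤ 1 / (p:ℝ) := by positivity
  nlinarith
theorem quad_eq (φ : VV → ℝ) (hI : ∀ v, S v → v ∈ I) (hφ : ∀ v, φ v ≠ 0 → S v) :
    (fun u : I => φ u) ⬝ᵥ (BB P (Bm I S) - EE P (Tm I S)) *ᵥ (fun u : I => φ u) =
      ∑ v ∈ I, ∑ p ∈ P, ((if (p:ℤ) ∣ v.1 then (1:ℝ) else 0) - 1 / p) * (φ (stp p v) * φ v) := by
  have e1 : ∀ u v : I, (BB P (Bm I S) - EE P (Tm I S)) u v = ∑ p ∈ P, if S u.1 ∧ S v.1 ∧ u.1 = stp p v.1 then ((if (p:ℤ) ∣ v.1.1 then (1:ℝ) else 0) - 1 / p) else 0 := by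
    intro u v
    rw [Matrix.sub_apply, BB, EE, Matrix.sum_apply, Matrix.sum_apply, ← sum_sub_distrib]
    refine sum_congr rfl fun p _ => ?_
    simp only [Bm, Tm, ind, Matrix.smul_apply, smul_eq_mul]
    grind
  rw [← sum_coe_sort I]
  simp only [dotProduct, mulVec, mul_sum, e1]
  rw [sum_comm]
  refine sum_congr rfl fun v _ => ?_
  simp only [sum_mul, mul_sum]
  rw [sum_comm]
  refine sum_congr rfl fun p _ => ?_
  by_cases hz : φ (stp p v.1) = 0 ∨ φ v = 0
  · rw [sum_eq_zero]
    · grind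
    · grind
  · push Not at hz
    have hm := hI _ (hφ _ hz.1)
    rw [sum_eq_single ⟨stp p v.1, hm⟩]
    · grind
    · grind
    · simp
theorem tile_bound (I0 : Finset ℤ) (H0 Δ τ ρ d L t : ℝ) (J : ℕ)
    (hL : L = ∑ p ∈ P, 1 / (p:ℝ)) (hω : ∀ n ∈ I0, ∑ p ∈ P, (if (p:ℤ) ∣ n then (1:ℝ) else 0) ≤ Δ - L) (h1 : 1 ≤ Δ) (hLΔ : L ≤ Δ)
    (hH0 : 0 < H0) (hP : ∀ p ∈ P, H0 ≤ (p:ℝ)) (hτ0 : 0 ≤ τ)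
    (hτ : ∀ u : VV, u.1 ∈ I0 → ∀ q ∈ insert 0 P, ∑ x ∈ P, (if BadL P (3 * (J+3) + 2) q (stp x u) then (1:ℝ) / x else 0) ≤ τ)
    (hρ : 1 ≤ ρ)
    (hA : ∀ i, i = J+1 ∨ i = J+2 ∨ i = J+3 → ‖Ah P (I0 ×ˢ univ) i‖ ≤ ρ ^ i)
    (hsm : 9 * (Δ ^ (2 * (J+3)) * ((J+3) * ((J+3) / H0 + (J+4) * τ))) ≤ 1)
    (hJ : 24 * (Δ + 1) ≤ 2 ^ (J+1)) (ht : 0 ≤ t) (htρ : t * (2 * ρ) ≤ 1)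
    (f : ℤ → ℝ) (hf : ∀ n, f n ≠ 0 → n ∈ I0 ∧ (∑ p ∈ P, (if (p:ℤ) ∣ n then (1:ℝ) else 0) ≤ d) ∧ ∀ s, ¬ Y0 P (J+3) (n, s)) :
    t * |∑ n ∈ I0, ∑ p ∈ P, ((if (p:ℤ) ∣ n then (1:ℝ) else 0) - 1 / p) * (f n * (f (n + p) + f (n - p)))| ≤
      2 * (1 + t ^ 2 * d + t ^ 3 * L) * ∑ n ∈ I0, f n ^ 2 := by
  set I : Finset VV := I0 ×ˢ univ with hI
  set Z : VV → Prop := fun u => u ∈ I ∧ ¬ Y0 P (J+3) u with hZ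
  have hS : ∀ v, Z v → v ∈ I := fun v h => h.1
  have hmI : ∀ v, v ∈ I → v.1 ∈ I0 := fun v h => by simpa [hI] using h
  have hrow : rowb P (· ∈ I) Δ := fun v hv => by rw [← hL]; linarith [hω v.1 (hmI v hv)]
  have hT : ∀ i, i ≤ J + 3 → ‖T1 P I (3 * (J+3) + 2) i‖ ≤ 1/3 := by
    intro i hi
    refine (T1_norm hrow h1 hH0 hP hτ0 (fun u hu => hτ u (hmI u hu)) i hi).trans ?_
    rw [Real.sqrt_le_left (by norm_num)]
    have a1 : Δ ^ i * Δ ^ i ≤ Δ ^ (2 * (J+3)) := by rw [← pow_add]; exact pow_le_pow_right₀ h1 (by omega)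
    have a2 : (i:ℝ) ≤ J + 3 := by exact_mod_cast hi
    have a3 : 0 ≤ ((J:ℝ)+3) / H0 + (J+4) * τ := by positivity
    have : Δ ^ i * (i * Δ ^ i * (((J+3:ℕ):ℝ) / H0 + (((J+3:ℕ):ℝ) + 1) * τ)) ≤ Δ ^ (2 * (J+3)) * ((J+3) * ((J+3) / H0 + (J+4) * τ)) := by
      calc _ = (Δ ^ i * Δ ^ i) * (i * ((J+3) / H0 + (J+4) * τ)) := by push_cast; ring
        _ ≤ _ := by gcongr
    linarith
  have main : ∀ σ : ℝ, σ ^ 2 = 1 → t * (σ * ∑ n ∈ I0, ∑ p ∈ P, ((if (p:ℤ) ∣ n then (1:ℝ) else 0) - 1 / p) * (f n * (f (n + p) + f (n - p)))) ≤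
      2 * (1 + t ^ 2 * d + t ^ 3 * L) * ∑ n ∈ I0, f n ^ 2 := by
    intro σ hσ
    set φ : VV → ℝ := fun u => if u.2 then f u.1 else σ * f u.1 with hφ
    have hσ0 : σ ≠ 0 := by rintro rfl; norm_num at hσ
    have hφf : ∀ v, φ v ≠ 0 → f v.1 ≠ 0 := by
      grind
    have hφZ : ∀ v, φ v ≠ 0 → Z v := fun v hv => by
      grind
    have o := opm P (Bm I Z) (Tm I Z) (fun p _ => B3 hS p) (fun p => ind_symm Z _) (fun p => ind_symm Z _) J ρ Δ L hρ
      (by rw [hL]; exact EE_norm) hLΔ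
      (DD_norm hS Δ (by linarith) fun v hv => by
        have := hω v.1 (hmI v hv)
        have : 0 ≤ L := by rw [hL]; positivity
        linarith)
      (by
        refine norm_le_of_bil _ _ zero_le_one fun φ ψ => ?_
        rw [one_mulVec, one_mul]; exact (le_abs_self _).trans (cs _ _))
      (fun i hi => R_norm (j := J+3) le_rfl (by omega) (by omega) (hA i hi) (one_le_pow₀ hρ) (hT i (by omega))) hJ t ht htρ (fun u : I => φ u)
    rw [quad_eq φ hS hφZ] at o
    have hd := DD_quad (P := P) hS (fun u : I => φ u) d (fun v hv => (hf v.1.1 (hφf _ hv)).2.1)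
    have hn : n2 (fun u : I => φ u) ^ 2 = 2 * ∑ n ∈ I0, f n ^ 2 := by
      rw [n2_sq, sum_coe_sort I (fun u => φ u ^ 2), hI, sum_product, mul_sum]
      refine sum_congr rfl fun n _ => ?_
      simp [hφ, mul_pow, hσ, two_mul]
    have hq : ∑ v ∈ I, ∑ p ∈ P, ((if (p:ℤ) ∣ v.1 then (1:ℝ) else 0) - 1 / p) * (φ (stp p v) * φ v) = σ * ∑ n ∈ I0, ∑ p ∈ P, ((if (p:ℤ) ∣ n then (1:ℝ) else 0) - 1 / p) * (f n * (f (n + p) + f (n - p))) := by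
      rw [hI, sum_product, mul_sum]
      refine sum_congr rfl fun n _ => ?_
      rw [Fintype.sum_bool, ← sum_add_distrib, mul_sum]
      refine sum_congr rfl fun p _ => ?_
      simp [hφ, stp]; ring
    rw [hq, hn] at o
    rw [hn] at hd
    have := mul_le_mul_of_nonneg_left hd (sq_nonneg t)
    linarith
  rcases abs_choice (∑ n ∈ I0, ∑ p ∈ P, ((if (p:ℤ) ∣ n then (1:ℝ) else 0) - 1 / p) * (f n * (f (n + p) + f (n - p)))) with h | h
  · rw [h]; have := main 1 (by norm_num); rwa [one_mul] at this
  · rw [h]; have := main (-1) (by norm_num); rwa [neg_one_mul] at this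
end ops4
end TB
namespace TB
open Finset
section tr
open Matrix
open scoped Matrix.Norms.L2Operator
open Classical
variable {P : Finset ℕ} {S : VV → Prop} {I : Finset VV}
noncomputable def pf (p : ℕ) (n : ℤ) : ℝ := (if (p:ℤ) ∣ n then 1 else 0) - 1 / (p:ℝ)
noncomputable def pa : List ℕ → VV → ℝ
  | [], _ => 1
  | p :: l, v => pf p (wk l v).1 * pa l v
def inI (S : VV → Prop) : List ℕ → VV → Prop
  | [], v => S v
  | p :: l, v => inI S l v ∧ S (stp p (wk l v))
theorem pa_append (a b v) : pa (a ++ b) v = pa a (wk b v) * pa b v := by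
  induction a with
  | nil => simp [pa]
  | cons p a ih => simp [pa, ih, wk_append, mul_assoc]
theorem inI_last {l v} (h : inI S l v) : S (wk l v) := by
  cases l with
  | nil => exact h
  | cons a w => exact h.2
theorem inI_append {a b v} : inI S (a ++ b) v ↔ inI S b v ∧ inI S a (wk b v) := by
  induction a with
  | nil => simp [inI]; exact fun h => inI_last h
  | cons x a ih => simp only [List.cons_append, inI, ih, wk_append]; tauto
theorem sum_flags (n : ℕ) (v : VV) (g : List ℕ → ℝ) :
    ∑ w ∈ wds (lets P) n, g (w.map Prod.fst) * (if ok S w v then wg w else 0)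
      = ∑ l ∈ wds P n, g l * (if inI S l v then pa l v else 0) := by
  induction n generalizing g with
  | zero => simp [sum_wds_zero, ok, inI, pa, wg]
  | succ n ih =>
    rw [sum_wds_succ, sum_wds_succ]
    simp_rw [sum_lets]
    have h := ih (fun l => ∑ p ∈ P, g (p :: l) * if S (stp p (wk l v)) then pf p (wk l v).1 else 0)
    trans ∑ l ∈ wds P n, (∑ p ∈ P, g (p :: l) * if S (stp p (wk l v)) then pf p (wk l v).1 else 0) * (if inI S l v then pa l v else 0)
    · rw [← h]
      refine sum_congr rfl fun w _ => ?_
      rw [← sum_add_distrib, sum_mul]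
      refine sum_congr rfl fun p _ => ?_
      simp only [List.map_cons, ok, wg, List.prod_cons, wt, pf, wkp]
      grind
    · refine sum_congr rfl fun l _ => ?_
      rw [sum_mul]
      refine sum_congr rfl fun p _ => ?_
      simp only [inI, pa]
      grind
theorem Ah_eq (n : ℕ) (u v : I) : Ah P I n u v = ∑ l ∈ wds P n, if l.Nodup ∧ inI (· ∈ I) l v ∧ wk l v = u.1 then pa l v else 0 := by
  have h := sum_flags (P := P) (S := (· ∈ I)) n v.1 (fun l => if l.Nodup ∧ wk l v = u.1 then 1 else 0)
  rw [Ah]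
  convert h using 1
  · refine sum_congr rfl fun w _ => ?_
    simp only [nd, wkp]
    grind
  · grind
theorem Ah_herm (n : ℕ) : (Ah P I n).IsHermitian := by
  ext u v
  simp only [conjTranspose_apply, star_trivial, Ah]
  rw [← sum_wds_reverse]
  refine sum_congr rfl fun w _ => ?_
  rw [wg_reverse]
  refine if_congr ?_ rfl rfl
  have key : ∀ (w : List LT) (u v : I), nd w ∧ ok (· ∈ I) w u ∧ wkp w u = v.1 → nd w.reverse ∧ ok (· ∈ I) w.reverse v ∧ wkp w.reverse v = u.1 := by
    rintro w u v ⟨h1, h2, h3⟩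
    refine ⟨by simpa [nd, List.map_reverse] using h1, ?_, ?_⟩
    · rw [← h3]; exact ok_reverse h2
    · rw [← h3]; exact wkp_reverse _ _
  constructor
  · intro h; simpa using key _ _ _ h
  · intro h; exact key _ _ _ h
theorem SD_block {n : ℕ} (c l : List ℕ) (hl : n ∣ l.length) (hc : c.length ≤ n) : SD n (c ++ l) ↔ SD n l ∧ c.Nodup := by
  induction c with
  | nil => simp
  | cons p c ih =>
    simp only [List.length_cons] at hc
    simp only [List.cons_append, SD, ih (by omega), List.nodup_cons, List.length_append]
    have : (c.length + l.length) % n = c.length := by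
      obtain ⟨k, hk⟩ := hl
      rw [hk, Nat.add_mul_mod_self_left, Nat.mod_eq_of_lt (by omega)]
    rw [this]; simp; tauto
theorem Ah_pow (n g : ℕ) (u v : I) : (Ah P I n ^ g) u v = ∑ l ∈ wds P (g * n), if SD n l ∧ inI (· ∈ I) l v ∧ wk l v = u.1 then pa l v else 0 := by
  induction g generalizing u with
  | zero =>
    rw [zero_mul, sum_wds_zero, pow_zero, Matrix.one_apply]
    simp only [pa]
    refine if_congr ?_ rfl rfl
    simp only [SD, inI, wk_nil, Subtype.ext_iff, eq_comm, Subtype.coe_prop, true_and]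
    grind
  | succ g ih =>
    rw [pow_succ', Matrix.mul_apply, show (g+1)*n = n + g * n by ring, sum_wds_add]
    simp_rw [ih, Ah_eq, sum_mul_sum]
    trans ∑ x : I, ∑ l ∈ wds P (g * n), ∑ c ∈ wds P n, if wk l v = x.1 then (if SD n (c ++ l) ∧ inI (· ∈ I) (c ++ l) v ∧ wk (c ++ l) v = u.1 then pa (c ++ l) v else 0) else 0
    · refine sum_congr rfl fun x _ => ?_
      rw [sum_comm]
      refine sum_congr rfl fun l hl => sum_congr rfl fun c hc => ?_
      rw [SD_block c l (by rw [(mem_wds.1 hl).1]; exact Dvd.intro_left g rfl) (by rw [(mem_wds.1 hc).1]), inI_append, wk_append, pa_append]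
      grind
    · rw [sum_comm]
      refine sum_congr rfl fun l hl => ?_
      rw [sum_comm]
      refine sum_congr rfl fun c hc => ?_
      by_cases h : SD n (c ++ l) ∧ inI (· ∈ I) (c ++ l) v ∧ wk (c ++ l) v = u.1
      · simp only [h, if_true, and_self]
        rw [sum_eq_single ⟨wk l v, inI_last (inI_append.1 h.2.1).1⟩]
        · simp
        · grind
        · simp
      · simp [h]
theorem Ah_tr (n g : ℕ) : trace (Ah P I n ^ g) = ∑ l ∈ wds P (g * n), ∑ v ∈ I, if SD n l ∧ inI (· ∈ I) l v ∧ wk l v = v then pa l v else 0 := by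
  simp only [trace, Matrix.diag, Ah_pow]
  rw [sum_comm]
  refine sum_congr rfl fun l _ => ?_
  exact sum_coe_sort I (fun v => if SD n l ∧ inI (· ∈ I) l v ∧ wk l v = v then pa l v else 0)
end tr
end TB
namespace TB
open Finset
section tr2
open Matrix
open scoped Matrix.Norms.L2Operator
open Classical
variable {P : Finset ℕ} {S : VV → Prop} {I : Finset VV}
def sh (m : ℤ) (v : VV) : VV := (v.1 + m, v.2)
theorem stp_sh (p m v) : stp p (sh m v) = sh m (stp p v) := by
  obtain ⟨n, s⟩ := v; cases s <;> simp [stp, sh] <;> ring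
theorem wk_sh (l m v) : wk l (sh m v) = sh m (wk l v) := by
  induction l with
  | nil => rfl
  | cons p l ih => simp [ih, stp_sh]
theorem inI_sh {m l v} : inI S l (sh m v) ↔ inI (fun u => S (sh m u)) l v := by
  induction l with
  | nil => rfl
  | cons p l ih => simp [inI, ih, wk_sh, stp_sh]
theorem pa_sh {m : ℤ} {l : List ℕ} (hl : ∀ p ∈ l, (p:ℤ) ∣ m) (v) : pa l (sh m v) = pa l v := by
  induction l with
  | nil => rfl
  | cons p l ih =>
    rw [pa, pa, ih (fun x hx => hl x (by simp [hx])), wk_sh]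
    congr 1
    exact congrArg (· - 1 / (p:ℝ)) (if_congr (dvd_add_left (hl p (by simp))) rfl rfl)
theorem pf_abs (p : ℕ) (hp : 1 ≤ p) (n) : |pf p n| ≤ 1 := by
  have : (1:ℝ) ≤ p := by exact_mod_cast hp
  have h1 : 1 / (p:ℝ) ≤ 1 := by rw [div_le_one (by linarith)]; exact this
  have h2 : 0 < 1 / (p:ℝ) := by positivity
  rw [pf, abs_le]; split_ifs <;> constructor <;> linarith
theorem pa_abs {l : List ℕ} (hl : ∀ p ∈ l, 1 ≤ p) (v) : |pa l v| ≤ 1 := by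
  induction l with
  | nil => simp [pa]
  | cons p l ih =>
    rw [pa, abs_mul]
    exact mul_le_one₀ (pf_abs p (hl p (by simp)) _) (abs_nonneg _) (ih fun x hx => hl x (by simp [hx]))
theorem per_sum (F : ℕ → ℝ) (Q : ℕ) (hQ : 0 < Q) (hF : ∀ t, F (Q + t) = F t) (h0 : ∑ t ∈ range Q, F t = 0) (h1 : ∀ t, |F t| ≤ 1) (T : ℕ) :
    |∑ t ∈ range T, F t| ≤ Q := by
  induction T using Nat.strong_induction_on with
  | _ T ih =>
    by_cases h : T < Q
    · refine (abs_sum_le_sum_abs _ _).trans ?_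
      refine (sum_le_sum fun t _ => h1 t).trans ?_
      simp; exact h.le
    · obtain ⟨T', rfl⟩ := Nat.exists_eq_add_of_le (not_lt.1 h)
      rw [sum_range_add, h0, zero_add]
      grind
theorem pf_sum (z : ℕ) (hz : z.Prime) (α β : ℤ) (hβ : ¬ (z:ℤ) ∣ β) : ∑ r ∈ range z, pf z (α + β * r) = 0 := by
  have hz0 : (z:ℝ) ≠ 0 := by exact_mod_cast hz.ne_zero
  simp only [pf]
  rw [sum_sub_distrib, sum_const, card_range, nsmul_eq_mul, mul_one_div_cancel hz0, sum_boole]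
  have : (filter (fun r : ℕ => (z:ℤ) ∣ α + β * r) (range z)).card = 1 := by
    have : Fact z.Prime := ⟨hz⟩
    have hb : (β : ZMod z) ≠ 0 := fun h => hβ ((ZMod.intCast_zmod_eq_zero_iff_dvd _ _).1 h)
    rw [card_eq_one]
    refine ⟨((-α : ZMod z) / β).val, ?_⟩
    ext r
    simp only [mem_filter, mem_range, mem_singleton]
    rw [← ZMod.intCast_zmod_eq_zero_iff_dvd]
    push_cast
    constructor
    · rintro ⟨h1, h2⟩
      have : (r : ZMod z) = -α / β := by rw [eq_div_iff hb]; linear_combination h2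
      rw [← this, ZMod.val_natCast, Nat.mod_eq_of_lt h1]
    · rintro rfl
      refine ⟨ZMod.val_lt _, ?_⟩
      rw [ZMod.natCast_zmod_val]; field_simp; ring
  rw [this]; simp
theorem sum_rg (f : ℕ → ℝ) (m n : ℕ) : ∑ t ∈ range (m * n), f t = ∑ j ∈ range m, ∑ i ∈ range n, f (j + m * i) := by
  induction n with
  | zero => simp
  | succ n ih =>
    rw [Nat.mul_succ, sum_range_add, ih, ← sum_add_distrib]
    refine sum_congr rfl fun j _ => ?_
    rw [sum_range_succ, add_comm j]
theorem lone {l : List ℕ} (hl : ∀ p ∈ l, p.Prime) {W : ℕ} (hW : ∀ p ∈ l, p.Coprime W) (hn : ¬ nonlone l) (v : VV) (T : ℕ) :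
    |∑ t ∈ range T, pa l (sh (W * t) v)| ≤ (l.prod : ℕ) := by
  have hpos : ∀ l' : List ℕ, (∀ x ∈ l', x ∈ l) → 0 < l'.prod := by
    intro l' h
    refine List.prod_pos fun x hx => (hl x (h x hx)).pos
  have hdv : ∀ x ∈ l, x ∣ l.prod := fun x hx => List.dvd_prod hx
  refine per_sum _ _ (hpos l fun x hx => hx) ?_ ?_ (fun t => pa_abs (fun p hp => (hl p hp).one_le) _) T
  · intro t
    have : sh (W * ((l.prod + t : ℕ):ℤ)) v = sh (W * l.prod) (sh (W * t) v) := by simp [sh]; ring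
    rw [this, pa_sh]
    intro p hp
    exact Dvd.dvd.mul_left (by exact_mod_cast hdv p hp) _
  · obtain ⟨z, hz, hc⟩ : ∃ z ∈ l, l.count z < 2 := by simpa [nonlone] using hn
    obtain ⟨l1, l2, rfl⟩ := List.append_of_mem hz
    have hc' : l1.count z = 0 ∧ l2.count z = 0 := by simp at hc; omega
    rw [List.count_eq_zero, List.count_eq_zero] at hc'
    have hzp := hl z hz
    set Q' := (l1 ++ l2).prod with hQ'
    have hQ : (l1 ++ z :: l2).prod = Q' * z := by simp [hQ']; ring
    rw [hQ, sum_rg]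
    refine sum_eq_zero fun j _ => ?_
    have hnd : ¬ (z:ℤ) ∣ W * Q' := by
      rw [Int.natCast_dvd_natCast.symm.trans (by push_cast; rfl) |>.symm.not]
      rw [hzp.dvd_mul, not_or]
      constructor
      · exact (Nat.Prime.coprime_iff_not_dvd hzp).1 (hW z hz)
      · intro h
        obtain ⟨x, hx, hzx⟩ := (Prime.dvd_prod_iff hzp.prime).1 h
        have hxl : x ∈ l1 ++ z :: l2 := by simp at hx ⊢; tauto
        have : z = x := (Nat.prime_dvd_prime_iff_eq hzp (hl x hxl)).1 hzx
        subst this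
        simp at hx; tauto
    have key : ∀ i : ℕ, pa (l1 ++ z :: l2) (sh (W * ((j + Q' * i : ℕ):ℤ)) v) = pa l1 (wk (z :: l2) (sh (W * j) v)) * pa l2 (sh (W * j) v) * pf z (((wk l2 v).1 + W * j) + (W * Q') * i) := by
      intro i
      have e : sh (W * ((j + Q' * i : ℕ):ℤ)) v = sh (W * Q' * i) (sh (W * j) v) := by simp [sh]; ring
      have hd : ∀ x ∈ l1 ++ l2, (x:ℤ) ∣ W * Q' * i := fun x hx =>
        Dvd.dvd.mul_right (Dvd.dvd.mul_left (by exact_mod_cast List.dvd_prod hx) _) _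
      rw [e, pa_append, pa, wk_sh (z :: l2), pa_sh (fun x hx => hd x (by simp [hx])), pa_sh (l := l2) (fun x hx => hd x (by simp [hx])), wk_sh l2 _ (sh _ v), wk_sh l2]
      simp only [sh]; ring
    simp_rw [key]
    rw [← mul_sum, pf_sum z hzp _ _ hnd, mul_zero]
theorem facts_congr {ε : ℕ → ℤ} {rs D D' : ℕ → Bool} {l : List ℕ} {n : ℤ} (h : ∀ i < l.length, D i = D' i) : (facts ε rs D n l ↔ facts ε rs D' n l) ∧ Fp D l = Fp D' l := by
  induction l with
  | nil => simp [facts, Fp]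
  | cons p l ih =>
    simp only [List.length_cons] at h
    obtain ⟨h1, h2⟩ := ih (fun i hi => h i (by omega))
    simp [facts, Fp, h1, h2, h l.length (by omega)]
theorem bp_congr {ε : ℕ → ℤ} {rs rs' : ℕ → Bool} {l : List ℕ} (h : ∀ i, 0 < i → i ≤ l.length → rs i = rs' i) : bp ε rs l = bp ε rs' l := by
  induction l with
  | nil => rfl
  | cons p l ih => simp only [List.length_cons] at h; simp [bp, ih (fun i h0 hi => h i h0 (by omega)), h (l.length+1) (by omega)]
noncomputable def DU (U : Finset ℕ) (i : ℕ) : Bool := decide (i ∈ U)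
theorem pa_facts (M : ℕ) (s : Bool) (n : ℤ) (l : List ℕ) (hl : l.length ≤ M) :
    |pa l (n, s)| ≤ ∑ U ∈ (range l.length).powerset, if facts (es s M) (fun _ => false) (DU U) n l then Fp (DU U) l else 0 := by
  induction l with
  | nil => simp [pa, facts, Fp]
  | cons p l ih =>
    simp only [List.length_cons] at hl ⊢
    have ih := ih (by omega)
    have hw : (wk l (n, s)).1 = n + bp (es s M) (fun _ => false) l := by
      rw [wk_bp s M n l (by omega), bp_congr]
      intro i h0 hi; simp [rsS, Nat.mod_eq_of_lt (show i < M + 1 by omega)]; omega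
    rw [range_add_one, sum_powerset_insert (by simp), pa, abs_mul, hw]
    have h1 : ∀ U ∈ (range l.length).powerset, (if facts (es s M) (fun _ => false) (DU U) n (p :: l) then Fp (DU U) (p :: l) else 0) = 1 / p * (if facts (es s M) (fun _ => false) (DU U) n l then Fp (DU U) l else 0) := by
      intro U hU
      have : DU U l.length = false := by
        simp only [DU, decide_eq_false_iff_not]; intro h; have := mem_powerset.1 hU h; simp at this
      simp [facts, Fp, this]
    have h2 : ∀ U ∈ (range l.length).powerset, (if facts (es s M) (fun _ => false) (DU (insert l.length U)) n (p :: l) then Fp (DU (insert l.length U)) (p :: l) else 0) = (if (p:ℤ) ∣ n + bp (es s M) (fun _ => false) l then 1 else 0) * (if facts (es s M) (fun _ => false) (DU U) n l then Fp (DU U) l else 0) := by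
      intro U hU
      have : DU (insert l.length U) l.length = true := by simp [DU]
      have hc := facts_congr (ε := es s M) (rs := fun _ => false) (D := DU (insert l.length U)) (D' := DU U) (l := l) (n := n) (by
        intro i hi; simp [DU]; omega)
      simp only [facts, Fp, this, hc.1, hc.2, if_true, forall_const]
      grind
    rw [sum_congr rfl h1, sum_congr rfl h2, ← mul_sum, ← mul_sum, ← add_mul]
    refine mul_le_mul ?_ ih (abs_nonneg _) (by positivity)
    rw [pf]
    have : (0:ℝ) ≤ 1 / p := by positivity
    grind
end tr2
end TB
namespace TB
open Finset
section tr3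
open Matrix
open scoped Matrix.Norms.L2Operator
open Classical
variable {P : Finset ℕ}
noncomputable def tile (a : ℤ) (W t : ℕ) : Finset ℤ := Ioc (a + W * t) (a + W * t + W)
theorem sum_tile {β : Type*} [AddCommMonoid β] (a : ℤ) (W t : ℕ) (f : ℤ → β) : ∑ n ∈ tile a W t, f n = ∑ n ∈ tile a W 0, f (n + W * t) := by
  refine sum_bij' (fun n _ => n - W * t) (fun n _ => n + W * t) ?_ ?_ ?_ ?_ ?_ <;> simp [tile] <;> intros <;> first | omega | constructor <;> linarith
theorem sum_tiles {β : Type*} [AddCommMonoid β] (a : ℤ) (W T : ℕ) (f : ℤ → β) : ∑ t ∈ range T, ∑ n ∈ tile a W t, f n = ∑ n ∈ Ioc a (a + (W * T : ℕ)), f n := by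
  induction T with
  | zero => simp
  | succ T ih =>
    rw [sum_range_succ, ih]
    have h : Ioc a (a + (W * (T+1) : ℕ)) = Ioc a (a + (W * T : ℕ)) ∪ tile a W T := by
      ext x; simp only [tile, mem_union, mem_Ioc]; push_cast; have : (0:ℤ) ≤ W * T := by positivity
      grind
    rw [h, sum_union]
    rw [disjoint_left]; intro x hx hy; simp [tile] at hx hy; omega
theorem tr_tile (a : ℤ) (W n g t : ℕ) : trace (Ah P (tile a W t ×ˢ univ) n ^ g) = ∑ l ∈ wds P (g * n), ∑ v ∈ tile a W 0 ×ˢ univ, if SD n l ∧ inI (· ∈ tile a W 0 ×ˢ (univ : Finset Bool)) l v ∧ wk l v = v then pa l (sh (W * t) v) else 0 := by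
  rw [Ah_tr]
  refine sum_congr rfl fun l _ => ?_
  rw [sum_product, sum_product, sum_tile]
  refine sum_congr rfl fun n _ => sum_congr rfl fun s _ => ?_
  have e : ((n + W * t, s) : VV) = sh (W * t) (n, s) := rfl
  rw [e, inI_sh, wk_sh]
  have e2 : (fun u => sh (W * t) u ∈ tile a W t ×ˢ (univ : Finset Bool)) = (· ∈ tile a W 0 ×ˢ (univ : Finset Bool)) := by
    ext u; simp [sh, tile]; intros; constructor <;> intro <;> linarith
  rw [e2]
  refine if_congr ?_ rfl rfl
  have : sh (W * t) (wk l (n, s)) = sh (W * t) (n, s) ↔ wk l (n, s) = (n, s) := by simp [sh, Prod.ext_iff]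
  rw [this]
theorem tr_sum {H0 δ H : ℝ} (hH : 1 ≤ H) (hH0 : 0 < H0) (hPp : ∀ p ∈ P, p.Prime) (hP : ∀ p ∈ P, H0 ≤ (p:ℝ) ∧ (p:ℝ) ≤ H)
    {h n g m : ℕ} (hn : 0 < n) (hh : 2 * n ≤ h) (hδ0 : 0 ≤ δ) (hm : m = g * n) (hm1 : 1 ≤ m)
    (hδ : ∀ s, ∀ l : List ℕ, (∀ x ∈ l, x ∈ P) → l.length ≤ m → ∑ x ∈ P with Bad (es s m) (fun _ => false) h l x, (1:ℝ) / x ≤ δ)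
    (hL : 1 ≤ ∑ p ∈ P, (1:ℝ) / p) (hsm : δ * (m:ℝ) ^ (2 * g + 1) ≤ 1) (hmm : (m:ℝ) ^ 2 / H0 ≤ 1)
    (a : ℤ) (W T : ℕ) (hW : ∀ p ∈ P, p.Coprime W) (hM : H ^ m ≤ (W * T : ℕ)) :
    ∑ t ∈ range T, trace (Ah P (tile a W t ×ˢ univ) n ^ g) ≤ 4 * (W * T : ℕ) * (10 ^ m * ((∑ p ∈ P, (1:ℝ) / p) ^ (m / 2) * (m:ℝ) ^ g)) + 2 * W * ((P.card:ℝ) ^ m * H ^ m) := by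
  simp_rw [tr_tile]
  rw [sum_comm, ← hm]
  set B := tile a W 0 ×ˢ (univ : Finset Bool) with hB
  have hBc : (B.card : ℝ) = 2 * W := by simp [hB, tile, mul_comm]
  have hpr : ∀ l ∈ wds P m, (l.prod : ℝ) ≤ H ^ m := by
    intro l hl
    obtain ⟨h1, h2⟩ := mem_wds.1 hl
    rw [← h1]
    clear hl h1
    induction l with
    | nil => simp
    | cons p l ih =>
      rw [List.prod_cons, List.length_cons, pow_succ', Nat.cast_mul]
      exact mul_le_mul (hP p (h2 p (by simp))).2 (ih fun x hx => h2 x (by simp [hx])) (by positivity) (by positivity)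
  have key : ∀ l ∈ wds P m, ∑ t ∈ range T, ∑ v ∈ B, (if SD n l ∧ inI (· ∈ B) l v ∧ wk l v = v then pa l (sh (W * t) v) else 0)
      ≤ (∑ s : Bool, ∑ U ∈ (range m).powerset, 2 * (W * T : ℕ) * (if SD n l ∧ nonlone l then Wt (es s m) (fun _ => false) (DU U) l else 0)) + 2 * W * H ^ m := by
    intro l hl
    obtain ⟨hl1, hl2⟩ := mem_wds.1 hl
    have hlp : ∀ p ∈ l, p.Prime := fun p hp => hPp p (hl2 p hp)
    by_cases hc : SD n l ∧ nonlone l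
    · have h1 : ∑ t ∈ range T, ∑ v ∈ B, (if SD n l ∧ inI (· ∈ B) l v ∧ wk l v = v then pa l (sh (W * t) v) else 0) ≤ ∑ s : Bool, ∑ x ∈ Ioc a (a + (W * T : ℕ)), |pa l (x, s)| := by
        rw [sum_comm (s := (univ : Finset Bool)), ← sum_tiles]
        refine sum_le_sum fun t _ => ?_
        rw [hB, sum_product, sum_tile a W t]
        refine sum_le_sum fun x _ => sum_le_sum fun s _ => ?_
        split_ifs
        · exact le_abs_self _
        · exact abs_nonneg _
      refine h1.trans ?_
      have : 0 ≤ 2 * W * H ^ m := by positivity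
      refine le_trans ?_ (le_add_of_nonneg_right this)
      refine sum_le_sum fun s _ => ?_
      simp only [hc, and_self, if_true]
      refine (sum_le_sum fun x _ => pa_facts m s x l hl1.le).trans ?_
      rw [sum_comm, hl1]
      refine sum_le_sum fun U _ => ?_
      rw [← sum_filter, sum_const, nsmul_eq_mul]
      have := count_facts (ε := es s m) (rs := fun _ => false) (D := DU U) hH a (W * T) l (fun x hx => ⟨hlp x hx, (hP x (hl2 x hx)).2⟩) (by rw [hl1]; exact hM)
      convert this using 3
    · have h0 : 0 ≤ (∑ s : Bool, ∑ U ∈ (range m).powerset, 2 * ((W * T : ℕ):ℝ) * (if SD n l ∧ nonlone l then Wt (es s m) (fun _ => false) (DU U) l else 0)) := by simp [hc]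
      refine le_trans ?_ (le_add_of_nonneg_left h0)
      rw [sum_comm]
      rw [← hBc, ← nsmul_eq_mul, ← sum_const]
      refine sum_le_sum fun v _ => ?_
      by_cases hs : SD n l ∧ inI (· ∈ B) l v ∧ wk l v = v
      · simp only [hs, if_true, and_self]
        have hnl : ¬ nonlone l := fun h => hc ⟨hs.1, h⟩
        exact (le_abs_self _).trans ((lone hlp (fun p hp => hW p (hl2 p hp)) hnl v T).trans (hpr l hl))
      · simp only [hs, if_false, sum_const_zero]; positivity
  refine (sum_le_sum key).trans ?_
  rw [sum_add_distrib, sum_const, card_wds, nsmul_eq_mul]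
  refine add_le_add ?_ (le_of_eq (by push_cast; ring))
  rw [sum_comm]
  have h3 : ∀ s : Bool, ∑ l ∈ wds P m, ∑ U ∈ (range m).powerset, 2 * ((W * T : ℕ):ℝ) * (if SD n l ∧ nonlone l then Wt (es s m) (fun _ => false) (DU U) l else 0) ≤ 2 ^ m * (2 * (W * T : ℕ) * (5 ^ m * ((∑ p ∈ P, (1:ℝ) / p) ^ (m / 2) * (m:ℝ) ^ g))) := by
    intro s
    rw [sum_comm]
    have : (2:ℝ)^m = ((range m).powerset.card : ℝ) := by simp
    rw [this, ← nsmul_eq_mul, ← sum_const]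
    refine sum_le_sum fun U _ => ?_
    rw [← mul_sum]
    refine mul_le_mul_of_nonneg_left ?_ (by positivity)
    exact T_sum (h := h) (δ := δ) (H0 := H0) hH0 (fun p hp => (hP p hp).1) (fun i => es_abs _ _ _) (fun _ => rfl) n g hn hh hδ0 hm hm1 (hδ s) hL hsm hmm
  refine (sum_le_sum fun s _ => h3 s).trans (le_of_eq ?_)
  rw [sum_const, card_univ, Fintype.card_bool, nsmul_eq_mul, show (10:ℝ) = 2 * 5 by norm_num, mul_pow]; push_cast; ring
end tr3
end TB
namespace TB
open Finset
section tails
open Matrix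
open scoped Matrix.Norms.L2Operator
open Classical
variable {P : Finset ℕ} {H0 H : ℝ}
noncomputable def om (P : Finset ℕ) (n : ℤ) : ℝ := ∑ p ∈ P, (if (p:ℤ) ∣ n then (1:ℝ) else 0)
theorem om_low (n : ℤ) (d : ℝ) (hd : d ≤ om P n) (S s : ℕ) (hs : s ≤ S) (hS : (S:ℝ) ≤ d) : (d - S) ^ s ≤ ∑ l ∈ wds P s, if l.Nodup ∧ ∀ p ∈ l, (p:ℤ) ∣ n then (1:ℝ) else 0 := by
  induction s with
  | zero => rw [sum_wds_zero]; simp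
  | succ s ih =>
    rw [sum_wds_succ, pow_succ]
    refine (mul_le_mul_of_nonneg_right (ih (by omega)) (by linarith)).trans ?_
    rw [sum_mul]
    refine sum_le_sum fun l hl => ?_
    by_cases hc : l.Nodup ∧ ∀ p ∈ l, (p:ℤ) ∣ n
    · rw [if_pos hc, one_mul]
      have h1 : ∀ p ∈ P, (if (p:ℤ) ∣ n then (1:ℝ) else 0) - (if p ∈ l.toFinset then 1 else 0) ≤ if (p :: l).Nodup ∧ ∀ x ∈ p :: l, (x:ℤ) ∣ n then (1:ℝ) else 0 := by
        intro p _
        by_cases a : (p:ℤ) ∣ n <;> by_cases b : p ∈ l <;> simp [a, b, hc.1] <;> first | exact hc.2 | skip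
        grind
      refine le_trans ?_ (sum_le_sum h1)
      rw [sum_sub_distrib]
      have h2 : ∑ p ∈ P, (if p ∈ l.toFinset then (1:ℝ) else 0) ≤ S := by
        rw [sum_boole]
        have h3 : (P.filter (· ∈ l.toFinset)).card ≤ l.length := (card_le_card (fun x hx => (mem_filter.1 hx).2)).trans (List.toFinset_card_le l)
        rw [(mem_wds.1 hl).1] at h3
        exact_mod_cast h3.trans (by omega)
      have : om P n = ∑ p ∈ P, (if (p:ℤ) ∣ n then (1:ℝ) else 0) := rfl
      linarith
    · rw [if_neg hc, zero_mul]; exact sum_nonneg fun _ _ => by split_ifs <;> norm_num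
theorem sum_inv_prod (s : ℕ) : ∑ l ∈ wds P s, 1 / (l.prod : ℝ) = (∑ p ∈ P, 1 / (p:ℝ)) ^ s := by
  induction s with
  | zero => simp [sum_wds_zero]
  | succ s ih =>
    rw [sum_wds_succ, pow_succ, ← ih, sum_mul_sum]
    simp_all
theorem om_tail (hH : 1 ≤ H) (hP : ∀ p ∈ P, Nat.Prime p ∧ (p:ℝ) ≤ H) (a : ℤ) (M s : ℕ) (hM : H ^ s ≤ M) (d : ℝ) (hd : (s:ℝ) ≤ d) :
    (((Ioc a (a + M)).filter (fun n => d ≤ om P n)).card : ℝ) * (d - s) ^ s ≤ 2 * M * (∑ p ∈ P, 1 / (p:ℝ)) ^ s := by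
  rw [← nsmul_eq_mul, ← sum_const, ← sum_inv_prod, mul_sum]
  refine (sum_le_sum fun n hn => om_low n d (mem_filter.1 hn).2 s s le_rfl hd).trans ?_
  rw [sum_comm]
  refine sum_le_sum fun l hl => ?_
  obtain ⟨h1, h2⟩ := mem_wds.1 hl
  rw [sum_boole]
  have hpos : 0 < l.prod := List.prod_pos fun x hx => (hP x (h2 x hx)).1.pos
  by_cases hnd : l.Nodup
  · have hle : (l.prod:ℝ) ≤ M := by
      refine le_trans ?_ hM
      rw [← h1]
      clear hl h1 hpos hnd
      induction l with
      | nil => simp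
      | cons p l ih =>
        rw [List.prod_cons, List.length_cons, pow_succ', Nat.cast_mul]
        exact mul_le_mul (hP p (h2 p (by simp))).2 (ih fun x hx => h2 x (by simp [hx])) (by positivity) (by positivity)
    have hdv : ∀ n : ℤ, (∀ p ∈ l, (p:ℤ) ∣ n) → (l.prod:ℤ) ∣ n := by
      intro n hn
      have hp : ∀ x ∈ l, x.Prime := fun x hx => (hP x (h2 x hx)).1
      clear hl h1 h2 hpos hle
      induction l with
      | nil => simp
      | cons p l ih =>
        rw [List.prod_cons, Nat.cast_mul]
        refine IsCoprime.mul_dvd ?_ (hn p (by simp)) (ih (List.nodup_cons.1 hnd).2 (fun x hx => hn x (by simp [hx])) (fun x hx => hp x (by simp [hx])))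
        rw [Nat.isCoprime_iff_coprime, Nat.Prime.coprime_iff_not_dvd (hp p (by simp))]
        intro h
        obtain ⟨x, hx, hzx⟩ := (Prime.dvd_prod_iff (hp p (by simp)).prime).1 h
        have := (Nat.prime_dvd_prime_iff_eq (hp p (by simp)) (hp x (by simp [hx]))).1 hzx
        grind
    have h3 := card_mod_le a M l.prod hpos (filter (fun n => l.Nodup ∧ ∀ p ∈ l, (p:ℤ) ∣ n) (filter (fun n => d ≤ om P n) (Ioc a (a + M))))
      ((filter_subset _ _).trans (filter_subset _ _)) (fun n hn n' hn' => dvd_sub (hdv _ (mem_filter.1 hn).2.2) (hdv _ (mem_filter.1 hn').2.2))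
    refine h3.trans ?_
    have h4 : (0:ℝ) < l.prod := by exact_mod_cast hpos
    have : 1 ≤ (M:ℝ) / l.prod := by rw [le_div_iff₀ h4]; linarith
    grind
  · simp only [hnd, false_and, filter_false, card_empty, Nat.cast_zero]; positivity
def BS (P : Finset ℕ) (h m : ℕ) (δ : ℝ) : Prop := ∀ (ε : ℕ → ℤ) (rs : ℕ → Bool), (∀ i, |ε i| = 1) → ∀ l : List ℕ, (∀ x ∈ l, x ∈ P) → l.length ≤ m → ∑ x ∈ P with Bad ε rs h l x, (1:ℝ) / x ≤ δ
def Tb (P : Finset ℕ) (Lm : ℕ) (τ : ℝ) (n : ℤ) : Prop := ∃ s : Bool, ∃ q ∈ insert 0 P, τ < ∑ x ∈ P, (if BadL P Lm q (stp x (n, s)) then (1:ℝ) / x else 0)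
theorem tau_count (hH : 1 ≤ H) (hH0 : 0 < H0) (hP : ∀ p ∈ P, Nat.Prime p ∧ H0 ≤ (p : ℝ) ∧ (p : ℝ) ≤ H) {δ τ : ℝ} {h m Lm v : ℕ} (hδ0 : 0 < δ) (hδ1 : δ ≤ 1) (hmδ : m / H0 ≤ δ)
    (hBS : BS P h m δ) (hh : Lm + 1 ≤ h) (hv : 1 ≤ v) (hn : v * (Lm + 1) ≤ m) (hτ : 0 < τ) (a : ℤ) (M : ℕ) (hM : H ^ m ≤ M) :
    (((Ioc a (a + M)).filter (fun n => Tb P Lm τ n)).card : ℝ) * (τ / (Lm + 1)) ^ v ≤ 2 * (P.card + 1) * (Lm + 1) * (2 * M * (δ ^ (v - 1) * (∑ p ∈ P, (1:ℝ) / p + 2 + 2 * m) ^ (v * (Lm + 1)))) := by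
  have hL0 : 0 ≤ ∑ p ∈ P, (1:ℝ) / p := sum_nonneg fun _ _ => by positivity
  rw [← nsmul_eq_mul, ← sum_const]
  have h1 : ∀ n ∈ (Ioc a (a + M)).filter (fun n => Tb P Lm τ n), (τ / (Lm + 1)) ^ v ≤ ∑ s : Bool, ∑ q ∈ insert 0 P, ∑ ℓ ∈ range (Lm + 1), eL P s q ℓ 1 n ^ v := by
    intro n hn
    obtain ⟨s, q, hq, hlt⟩ := (mem_filter.1 hn).2
    have h2 := hlt.trans_le (BadL_le (P := P) Lm q (n, s))
    have h3 : ∃ ℓ ∈ range (Lm + 1), τ / (Lm + 1) ≤ eL P s q ℓ 1 n := by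
      by_contra hcon
      push Not at hcon
      have := sum_le_sum fun ℓ hℓ => (hcon ℓ hℓ).le
      rw [sum_const, card_range, nsmul_eq_mul] at this
      push_cast at this
      rw [mul_div_cancel₀ _ (by positivity)] at this
      linarith
    obtain ⟨ℓ, hℓ, h4⟩ := h3
    have h5 := pow_le_pow_left₀ (by positivity) h4 v
    have nn : ∀ s q ℓ, 0 ≤ eL P s q ℓ 1 n ^ v := fun s q ℓ => pow_nonneg (eL_nonneg _ _ _ _ _) _
    refine h5.trans ?_
    refine (single_le_sum (f := fun ℓ => eL P s q ℓ 1 n ^ v) (fun ℓ _ => nn s q ℓ) hℓ).trans ?_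
    refine (single_le_sum (f := fun q => ∑ ℓ ∈ range (Lm + 1), eL P s q ℓ 1 n ^ v) (fun q _ => sum_nonneg fun ℓ _ => nn s q ℓ) hq).trans ?_
    exact single_le_sum (f := fun s => ∑ q ∈ insert 0 P, ∑ ℓ ∈ range (Lm + 1), eL P s q ℓ 1 n ^ v) (fun s _ => sum_nonneg fun q _ => sum_nonneg fun ℓ _ => nn s q ℓ) (mem_univ s)
  refine (sum_le_sum h1).trans ?_
  refine (sum_le_sum_of_subset_of_nonneg (filter_subset _ _) (fun n _ _ => sum_nonneg fun s _ => sum_nonneg fun q _ => sum_nonneg fun ℓ _ => pow_nonneg (eL_nonneg _ _ _ _ _) _)).trans ?_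
  rw [sum_comm]
  set X := 2 * (M:ℝ) * (δ ^ (v - 1) * (∑ p ∈ P, (1:ℝ) / p + 2 + 2 * m) ^ (v * (Lm + 1))) with hX
  have hX0 : 0 ≤ X := by positivity
  have h6 : ∀ s : Bool, ∀ q ∈ insert 0 P, ∀ ℓ ∈ range (Lm + 1), ∑ n ∈ Ioc a (a + M), eL P s q ℓ 1 n ^ v ≤ X := by
    intro s q _ ℓ hℓ
    have hℓ' : ℓ + 1 ≤ Lm + 1 := by simpa using hℓ
    refine (eL_moment (h := h) (v := v) (q := q) hH hH0 hP hδ0 hδ1 hmδ s (hℓ'.trans hh) (hBS _ _ (es_abs s ℓ)) ((Nat.mul_le_mul_left v hℓ').trans hn) (v - 1) (by split_ifs <;> omega) a M hM).trans ?_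
    rw [hX]
    have : (1:ℝ) ≤ ∑ p ∈ P, (1:ℝ) / p + 2 + 2 * m := by linarith [show (0:ℝ) ≤ m by positivity]
    gcongr
  have h7 : ∀ s : Bool, ∑ n ∈ Ioc a (a + M), ∑ q ∈ insert 0 P, ∑ ℓ ∈ range (Lm + 1), eL P s q ℓ 1 n ^ v ≤ (P.card + 1) * ((Lm + 1) * X) := by
    intro s
    rw [sum_comm]
    have : ∀ q ∈ insert 0 P, ∑ n ∈ Ioc a (a + M), ∑ ℓ ∈ range (Lm + 1), eL P s q ℓ 1 n ^ v ≤ (Lm + 1) * X := by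
      intro q hq
      rw [sum_comm]
      refine (sum_le_sum (h6 s q hq)).trans ?_
      simp
    refine (sum_le_sum this).trans ?_
    rw [sum_const, nsmul_eq_mul]
    have : ((insert 0 P).card : ℝ) ≤ P.card + 1 := by exact_mod_cast card_insert_le 0 P
    gcongr
  refine (sum_le_sum fun s _ => h7 s).trans (le_of_eq ?_)
  rw [sum_const, card_univ, Fintype.card_bool, nsmul_eq_mul]; push_cast; ring
theorem Y0_count (hH : 1 ≤ H) (hH0 : 0 < H0) (hP : ∀ p ∈ P, Nat.Prime p ∧ H0 ≤ (p : ℝ) ∧ (p : ℝ) ≤ H) {δ : ℝ} {h m j : ℕ} (hδ0 : 0 < δ) (hδ1 : δ ≤ 1) (hmδ : m / H0 ≤ δ)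
    (hBS : BS P h m δ) (hh : 3 * j + 3 ≤ h) (hn : 3 * j + 3 ≤ m) (a : ℤ) (M : ℕ) (hM : H ^ m ≤ M) (h0 : 0 ∉ P) (hL : 1 ≤ ∑ p ∈ P, (1:ℝ) / p) (s : Bool) :
    (((Ioc a (a + M)).filter (fun n => Y0 P j (n, s))).card : ℝ) ≤ (3 * j + 3) * (6 * M * (δ * (∑ p ∈ P, (1:ℝ) / p + 2 + 2 * m) ^ (3 * j + 3))) := by
  set L := ∑ p ∈ P, (1:ℝ) / p with hLd
  set Lm := 3 * j + 2 with hLm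
  obtain ⟨Hn, hHn⟩ : ∃ Hn : ℕ, Hn = ⌊H⌋₊ := ⟨_, rfl⟩
  have hHn1 : ∀ p ∈ P, p ≤ Hn := fun p hp => by rw [hHn]; exact Nat.le_floor (hP p hp).2.2
  have hHm : H ≤ M := le_trans (by simpa using pow_le_pow_right₀ hH (show 1 ≤ m by omega)) hM
  have hHM : (Hn:ℝ) ≤ M := (Nat.floor_le (by linarith) |>.trans' (by rw [hHn])).trans hHm
  set E := Ioc (a - Hn) (a - Hn + ((M + 2 * Hn : ℕ):ℤ)) with hE
  have h1 : ∑ u ∈ E, ∑ x ∈ P, (if BadL P Lm 0 (stp x (u, !s)) then (1:ℝ) / x else 0) ≤ (3 * j + 3) * (2 * (M + 2 * Hn : ℕ) * (δ * (L + 2 + 2 * m) ^ (3 * j + 3))) := by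
    refine (sum_le_sum fun u _ => BadL_le (P := P) Lm 0 (u, !s)).trans ?_
    rw [sum_comm]
    have : ∀ ℓ ∈ range (Lm + 1), ∑ u ∈ E, eL P (!s) 0 ℓ 1 u ≤ 2 * (M + 2 * Hn : ℕ) * (δ * (L + 2 + 2 * m) ^ (3 * j + 3)) := by
      intro ℓ hℓ
      have hℓ' : ℓ + 1 ≤ 3 * j + 3 := by have := mem_range.1 hℓ; omega
      have h2 := eL_moment (h := h) (v := 1) (q := 0) hH hH0 hP hδ0 hδ1 hmδ (!s) (hℓ'.trans hh) (hBS _ _ (es_abs (!s) ℓ)) (by omega) 1 (by simp [h0]) (a - Hn) (M + 2 * Hn) (hM.trans (by push_cast; linarith [show (0:ℝ) ≤ Hn by positivity]))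
      simp only [pow_one, one_mul] at h2
      refine h2.trans ?_
      have : (1:ℝ) ≤ L + 2 + 2 * m := by linarith [show (0:ℝ) ≤ m by positivity]
      gcongr
    refine (sum_le_sum this).trans (le_of_eq ?_)
    rw [sum_const, card_range, nsmul_eq_mul, hLm]; push_cast; ring
  have h2 : (((Ioc a (a + M)).filter (fun n => Y0 P j (n, s))).card : ℝ) * L ≤ ∑ u ∈ E, ∑ x ∈ P, (if BadL P Lm 0 (stp x (u, !s)) then (1:ℝ) / x else 0) := by
    rw [sum_comm, hLd, mul_sum]
    refine sum_le_sum fun x hx => ?_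
    rw [← sum_filter, sum_const, nsmul_eq_mul]
    refine mul_le_mul_of_nonneg_right ?_ (by positivity)
    have hx' := hHn1 x hx
    refine Nat.cast_le.2 (card_le_card_of_injOn (fun n => (stp x (n, s)).1) ?_ ?_)
    · intro n hn
      simp only [coe_filter, Set.mem_setOf_eq, mem_Ioc] at hn
      have e : ((stp x (n, s)).1, !s) = stp x (n, s) := by simp [stp]
      simp only [coe_filter, Set.mem_setOf_eq]
      refine ⟨?_, ?_⟩
      · simp only [hE, mem_Ioc, stp]
        grind
      · rw [e, stp_stp]
        exact BadL_Y0 (l := []) (by simp) (by simp) trivial hn.2 le_rfl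
    · intro n _ n' _ hnn
      simp only [stp] at hnn
      split_ifs at hnn <;> linarith
  have h3 : (((Ioc a (a + M)).filter (fun n => Y0 P j (n, s))).card : ℝ) ≤ (((Ioc a (a + M)).filter (fun n => Y0 P j (n, s))).card : ℝ) * L := le_mul_of_one_le_right (by positivity) hL
  refine h3.trans (h2.trans (h1.trans ?_))
  have h4 : ((M + 2 * Hn : ℕ):ℝ) ≤ 3 * M := by push_cast; linarith
  have h5 : (0:ℝ) ≤ L + 2 + 2 * m := by positivity
  have h6 : 0 ≤ δ * (L + 2 + 2 * m) ^ (3 * j + 3) := by positivity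
  refine mul_le_mul_of_nonneg_left ?_ (by positivity)
  refine mul_le_mul_of_nonneg_right ?_ h6
  linarith
end tails
end TB
namespace TB
open Finset
section red
open Matrix
open scoped ComplexOrder
theorem trace_pow_le {V : Type*} [Fintype V] [DecidableEq V] (M : Matrix V V ℝ) (hM : M.IsHermitian) (Γ : ℝ) (h : ∀ φ : V → ℝ, |φ ⬝ᵥ M *ᵥ φ| ≤ Γ * (φ ⬝ᵥ φ)) (k : ℕ) :
    trace (M ^ (2 * k)) ≤ Fintype.card V * Γ ^ (2 * k) := by
  have h1 : trace (M ^ (2 * k)) = ∑ i, hM.eigenvalues i ^ (2 * k) := by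
    conv_lhs => rw [hM.spectral_theorem, ← map_pow, Unitary.conjStarAlgAut_apply, trace_mul_cycle, diagonal_pow]
    simp [trace]
  have h2 : ∀ i, |hM.eigenvalues i| ≤ Γ := by
    intro i
    have e := hM.eigenvalues_eq i
    have := h (hM.eigenvectorBasis i)
    simp only [RCLike.re_to_real] at e
    rw [star_trivial] at e
    rw [← e] at this
    have n1 : (hM.eigenvectorBasis i).ofLp ⬝ᵥ (hM.eigenvectorBasis i).ofLp = 1 := by
      have := hM.eigenvectorBasis.orthonormal.1 i
      have h3 := EuclideanSpace.real_norm_sq_eq (hM.eigenvectorBasis i)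
      rw [this] at h3
      simp only [dotProduct, ← sq]; rw [← h3]; norm_num
    rwa [n1, mul_one] at this
  rw [h1]
  have : ∀ i ∈ univ, hM.eigenvalues i ^ (2 * k) ≤ Γ ^ (2 * k) := fun i _ => by
    rw [pow_mul, ← sq_abs, ← pow_mul]; exact pow_le_pow_left₀ (abs_nonneg _) (h2 i) _
  refine (sum_le_sum this).trans ?_
  simp_all
open Classical in
noncomputable def mX (NN : Finset ℤ) (P : Finset ℕ) (X : Finset ℤ) : Matrix NN NN ℝ := fun n m =>
  if n.1 ∈ X ∧ m.1 ∈ X then ∑ p ∈ P, pf p n.1 * ((if m.1 = n.1 + p then 1 else 0) + (if m.1 = n.1 - p then 1 else 0)) else 0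
theorem mX_herm (NN P X) : (mX NN P X).IsHermitian := by
  ext n m
  simp only [conjTranspose_apply, star_trivial, mX]
  by_cases h : n.1 ∈ X <;> by_cases h' : m.1 ∈ X <;> simp only [h, h', and_true, and_false, if_true, if_false]
  refine sum_congr rfl fun p _ => ?_
  by_cases h1 : m.1 = n.1 + p
  · have e : (p:ℤ) ∣ m.1 ↔ (p:ℤ) ∣ n.1 := by rw [h1]; simp
    have h2 : n.1 = m.1 - p := by omega
    by_cases h3 : m.1 = n.1 - p
    · grind
    · have h4 : ¬ n.1 = m.1 + p := by omega
      rw [if_pos h1, if_neg h3, if_pos h2, if_neg h4, pf, pf, if_congr e rfl rfl]; ring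
  · have h2 : ¬ n.1 = m.1 - p := by omega
    by_cases h3 : m.1 = n.1 - p
    · have e : (p:ℤ) ∣ m.1 ↔ (p:ℤ) ∣ n.1 := by rw [h3]; simp
      have h4 : n.1 = m.1 + p := by omega
      rw [if_neg h1, if_pos h3, if_neg h2, if_pos h4, pf, pf, if_congr e rfl rfl]; ring
    · grind
theorem trace_red (NN : Finset ℤ) (P : Finset ℕ) (X : Finset ℤ) (hX : X ⊆ NN) (Γ : ℝ) (hΓ : 0 ≤ Γ) (k : ℕ)
    (hq : ∀ f : ℤ → ℝ, (∀ n, f n ≠ 0 → n ∈ X) → |∑ n ∈ NN, ∑ p ∈ P, ((if (p:ℤ) ∣ n then (1:ℝ) else 0) - 1 / p) * (f n * (f (n + p) + f (n - p)))| ≤ Γ * ∑ n ∈ NN, f n ^ 2)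
    (A AX : ({n : ℤ // n ∈ NN} → ℂ) →ₗ[ℂ] ({n : ℤ // n ∈ NN} → ℂ))
    (hA : ∀ (f : {n : ℤ // n ∈ NN} → ℂ) (n : {n : ℤ // n ∈ NN}),
          A f n = ∑ p ∈ P,
            ((if (p : ℤ) ∣ (n : ℤ) then (1 : ℂ) else 0) - 1 / (p : ℂ)) *
              ((if h : (n : ℤ) + (p : ℤ) ∈ NN then f ⟨(n : ℤ) + (p : ℤ), h⟩ else 0) +
               (if h : (n : ℤ) - (p : ℤ) ∈ NN then f ⟨(n : ℤ) - (p : ℤ), h⟩ else 0)))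
    (hAX : ∀ (f : {n : ℤ // n ∈ NN} → ℂ) (n : {n : ℤ // n ∈ NN}),
                AX f n = if (n : ℤ) ∈ X then
                    A (fun m : {n : ℤ // n ∈ NN} => if (m : ℤ) ∈ X then f m else 0) n
                  else 0) :
    LinearMap.trace ℂ ({n : ℤ // n ∈ NN} → ℂ) (AX ^ (2 * k)) ≤ ((NN.card * Γ ^ (2 * k) : ℝ) : ℂ) := by
  have aux : ∀ (c : ℤ) (g : NN → ℂ), (if h : c ∈ NN then g ⟨c, h⟩ else 0) = ∑ m : NN, (if m.1 = c then (1:ℂ) else 0) * g m := by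
    intro c g
    split_ifs with h
    · rw [sum_eq_single ⟨c, h⟩]
      · simp
      · grind
      · simp
    · symm; refine sum_eq_zero fun m _ => ?_
      grind
  have auxR : ∀ (c : ℤ) (g : ℤ → ℝ), (∀ n, g n ≠ 0 → n ∈ NN) → g c = ∑ m : NN, (if m.1 = c then (1:ℝ) else 0) * g m.1 := by
    intro c g hg
    by_cases h : c ∈ NN
    · rw [sum_eq_single ⟨c, h⟩]
      · simp
      · grind
      · simp
    · rw [sum_eq_zero fun m _ => by rw [if_neg (fun e : m.1 = c => h (e ▸ m.2)), zero_mul]]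
      grind
  simp only [aux] at hA
  have e1 : AX = Matrix.toLin' ((mX NN P X).map (Complex.ofRealHom)) := by
    refine LinearMap.ext fun f => funext fun n => ?_
    rw [hAX, hA, Matrix.toLin'_apply]
    simp only [mulVec, dotProduct, Matrix.map_apply, mX]
    by_cases hn : n.1 ∈ X
    · simp only [hn, if_true, true_and, ← sum_add_distrib, mul_sum]
      rw [sum_comm]
      refine sum_congr rfl fun m _ => ?_
      by_cases hm : m.1 ∈ X
      · simp only [hm, if_true, map_sum, sum_mul]
        refine sum_congr rfl fun p _ => ?_
        have cI : ∀ (c : Prop) [Decidable c], ((if c then (1:ℝ) else 0 : ℝ) : ℂ) = if c then 1 else 0 := by intro c _; split_ifs <;> simp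
        simp only [pf, Complex.ofRealHom_eq_coe, Complex.ofReal_mul, Complex.ofReal_sub, Complex.ofReal_add, cI, Complex.ofReal_div, Complex.ofReal_one, Complex.ofReal_natCast]; ring
      · simp [hm]
    · simp [hn]
  have e2 : LinearMap.trace ℂ ({n : ℤ // n ∈ NN} → ℂ) (AX ^ (2 * k)) = ((trace (mX NN P X ^ (2 * k)) : ℝ) : ℂ) := by
    rw [e1, ← Matrix.toLin'_pow, Matrix.trace_toLin'_eq, ← Matrix.map_pow]
    simp [trace]
  rw [e2, Complex.real_le_real]
  have := trace_pow_le (mX NN P X) (mX_herm NN P X) Γ ?_ k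
  · simpa using this
  intro φ
  have hf := hq (fun n => if h : n ∈ X then φ ⟨n, hX h⟩ else 0) (fun n hn => by by_contra h; simp [h] at hn)
  set f : ℤ → ℝ := fun n => if h : n ∈ X then φ ⟨n, hX h⟩ else 0 with hfd
  have hfN : ∀ n, f n ≠ 0 → n ∈ NN := fun n hn => by by_contra h; exact hn (dif_neg fun hx => h (hX hx))
  have hfn : ∀ m : NN, f m.1 = if m.1 ∈ X then φ m else 0 := fun m => by simp [hfd]
  have e3 : ∑ n ∈ NN, ∑ p ∈ P, ((if (p:ℤ) ∣ n then (1:ℝ) else 0) - 1 / p) * (f n * (f (n + p) + f (n - p))) = φ ⬝ᵥ mX NN P X *ᵥ φ := by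
    rw [← sum_coe_sort NN]
    simp only [dotProduct, mulVec]
    refine sum_congr rfl fun n _ => ?_
    simp only [auxR (n.1 + _) f hfN, auxR (n.1 - _) f hfN, hfn, mX, ← sum_add_distrib]
    by_cases hn : n.1 ∈ X
    · simp only [hn, if_true, true_and, mul_sum]
      rw [sum_comm]
      refine sum_congr rfl fun m _ => ?_
      by_cases hm : m.1 ∈ X
      · simp only [hm, if_true, sum_mul, mul_sum]
        refine sum_congr rfl fun p _ => ?_
        rw [pf]; ring
      · simp [hm]
    · simp [hn]
  rw [e3] at hf
  refine hf.trans ?_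
  have e4 : ∑ n ∈ NN, f n ^ 2 ≤ φ ⬝ᵥ φ := by
    rw [← sum_coe_sort NN]
    simp only [dotProduct]
    refine sum_le_sum fun n _ => ?_
    rw [hfn]; split_ifs
    · exact (sq _).le
    · simp; exact mul_self_nonneg _
  nlinarith
end red
end TB
namespace TB
open Finset
section build
open Matrix
open scoped Matrix.Norms.L2Operator
open Classical
variable {P : Finset ℕ}
def goodT (P : Finset ℕ) (a : ℤ) (W J : ℕ) (D0 τ ρ : ℝ) (t : ℕ) : Prop :=
  (∀ n ∈ tile a W t, om P n ≤ D0) ∧ (∀ n ∈ tile a W t, ¬ Tb P (3 * (J+3) + 2) τ n) ∧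
    ∀ i, i = J+1 ∨ i = J+2 ∨ i = J+3 → ‖Ah P (tile a W t ×ˢ univ) i‖ ≤ ρ ^ i
def gpt (P : Finset ℕ) (a : ℤ) (W J Hn : ℕ) (d : ℝ) (t : ℕ) (n : ℤ) : Prop :=
  n ∈ Ioc (a + W * t + Hn) (a + W * t + W - Hn) ∧ om P n ≤ d ∧ ∀ s, ¬ Y0 P (J+3) (n, s)
noncomputable def XX (P : Finset ℕ) (a : ℤ) (W T J Hn : ℕ) (D0 τ ρ d : ℝ) : Finset ℤ :=
  (Ioc a (a + (W * T : ℕ))).filter fun n => ∃ t < T, goodT P a W J D0 τ ρ t ∧ gpt P a W J Hn d t n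
theorem tile_uniq {a n : ℤ} {W t t' : ℕ} (h : n ∈ tile a W t) (h' : n ∈ tile a W t') : t = t' := by
  simp only [tile, mem_Ioc] at h h'
  nlinarith
theorem gpt_tile {a n : ℤ} {W J Hn t : ℕ} {d : ℝ} (h : gpt P a W J Hn d t n) : n ∈ tile a W t := by
  have := h.1
  simp only [tile, mem_Ioc] at this ⊢
  grind
theorem XX_form (a : ℤ) (W T J Hn N : ℕ) (hWT : W * T ≤ N) (H0 D0 τ ρ d L t : ℝ)
    (hHn : ∀ p ∈ P, p ≤ Hn)
    (hL : L = ∑ p ∈ P, 1 / (p:ℝ)) (h1 : 1 ≤ D0) (hL0 : 0 ≤ L) (hd : 0 ≤ d)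
    (hH0 : 0 < H0) (hP : ∀ p ∈ P, H0 ≤ (p:ℝ)) (hτ0 : 0 ≤ τ) (hρ : 1 ≤ ρ)
    (hsm : 9 * ((D0 + L) ^ (2 * (J+3)) * ((J+3) * ((J+3) / H0 + (J+4) * τ))) ≤ 1)
    (hJ : 24 * ((D0 + L) + 1) ≤ 2 ^ (J+1)) (ht : 0 ≤ t) (htρ : t * (2 * ρ) ≤ 1)
    (f : ℤ → ℝ) (hf : ∀ n, f n ≠ 0 → n ∈ XX P a W T J Hn D0 τ ρ d) :
    t * |∑ n ∈ Ioc a (a + N), ∑ p ∈ P, ((if (p:ℤ) ∣ n then (1:ℝ) else 0) - 1 / p) * (f n * (f (n + p) + f (n - p)))| ≤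
      2 * (1 + t ^ 2 * d + t ^ 3 * L) * ∑ n ∈ Ioc a (a + N), f n ^ 2 := by
  have hsub : Ioc a (a + (W * T : ℕ)) ⊆ Ioc a (a + (N:ℤ)) := Ioc_subset_Ioc le_rfl (by linarith [(show ((W * T : ℕ):ℤ) ≤ N by exact_mod_cast hWT)])
  have hz : ∀ n, n ∉ Ioc a (a + (W * T : ℕ)) → f n = 0 := fun n hn => by
    by_contra h; exact hn (mem_filter.1 (hf n h)).1
  rw [← sum_subset hsub (fun n _ hn => by simp [hz n hn]), ← sum_subset hsub (f := fun n => f n ^ 2) (fun n _ hn => by simp [hz n hn]),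
    ← sum_tiles, ← sum_tiles, mul_sum]
  refine (mul_le_mul_of_nonneg_left (abs_sum_le_sum_abs _ _) ht).trans ?_
  rw [mul_sum]
  refine sum_le_sum fun i hi => ?_
  set g : ℤ → ℝ := fun n => if n ∈ tile a W i then f n else 0 with hg
  have hG : ∀ n ∈ tile a W i, f n ≠ 0 → goodT P a W J D0 τ ρ i ∧ gpt P a W J Hn d i n := by
    intro n hn h
    obtain ⟨j, hj, h2, h3⟩ := (mem_filter.1 (hf n h)).2
    rw [tile_uniq hn (gpt_tile h3)]; exact ⟨h2, h3⟩
  have e1 : ∑ n ∈ tile a W i, ∑ p ∈ P, ((if (p:ℤ) ∣ n then (1:ℝ) else 0) - 1 / p) * (f n * (f (n + p) + f (n - p)))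
      = ∑ n ∈ tile a W i, ∑ p ∈ P, ((if (p:ℤ) ∣ n then (1:ℝ) else 0) - 1 / p) * (g n * (g (n + p) + g (n - p))) := by
    refine sum_congr rfl fun n hn => sum_congr rfl fun p hp => ?_
    by_cases h0 : f n = 0
    · simp [hg, h0]
    have h2 := (hG n hn h0).2.1
    have h3 : (p:ℤ) ≤ Hn := by exact_mod_cast hHn p hp
    have h4 : (0:ℤ) ≤ p := by positivity
    simp only [mem_Ioc] at h2
    have h5 : n + p ∈ tile a W i := by simp only [tile, mem_Ioc]; constructor <;> linarith
    have h6 : n - p ∈ tile a W i := by simp only [tile, mem_Ioc]; constructor <;> linarith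
    grind
  have e2 : ∑ n ∈ tile a W i, f n ^ 2 = ∑ n ∈ tile a W i, g n ^ 2 := sum_congr rfl fun n hn => by simp only [hg, if_pos hn]
  rw [e1, e2]
  by_cases hgood : goodT P a W J D0 τ ρ i
  · refine tile_bound (P := P) (tile a W i) H0 (D0 + L) τ ρ d L t J hL (fun n hn => ?_) (by linarith) (by linarith) hH0 hP hτ0 ?_ hρ hgood.2.2 hsm hJ ht htρ g ?_
    · have := hgood.1 n hn; unfold om at this; linarith
    · intro u hu q hq
      by_contra hc
      exact hgood.2.1 u.1 hu ⟨u.2, q, hq, not_le.1 hc⟩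
    · intro n hn
      by_cases h2 : n ∈ tile a W i
      · simp only [hg, if_pos h2] at hn
        have := (hG n h2 hn).2
        exact ⟨h2, this.2.1, this.2.2⟩
      · simp [hg, h2] at hn
  · have : ∀ n ∈ tile a W i, g n = 0 := fun n hn => by
      grind
    rw [sum_eq_zero (fun n hn => sum_eq_zero fun p hp => by rw [this n hn]; ring)]
    simp only [abs_zero, mul_zero]
    positivity
theorem bad_tiles (a : ℤ) (W T : ℕ) (Q : ℤ → Prop) :
    (((range T).filter fun t => ∃ n ∈ tile a W t, Q n).card : ℝ) ≤ ((Ioc a (a + (W * T : ℕ))).filter Q).card := by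
  rw [← sum_boole, ← sum_boole, ← sum_tiles]
  refine sum_le_sum fun t ht => ?_
  split_ifs with h
  · obtain ⟨n, hn, hq⟩ := h
    calc (1:ℝ) = if Q n then 1 else 0 := by rw [if_pos hq]
      _ ≤ _ := single_le_sum (f := fun n => if Q n then (1:ℝ) else 0) (fun _ _ => by positivity) hn
  · positivity
theorem XX_card (a : ℤ) (W T J Hn N : ℕ) (hWT : W * T ≤ N) (hW : 2 * Hn ≤ W) (D0 τ ρ d : ℝ) :
    ((Ioc a (a + N) \ XX P a W T J Hn D0 τ ρ d).card : ℝ) ≤ (N - W * T : ℕ) + 2 * Hn * T + 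
      ((Ioc a (a + (W * T : ℕ))).filter fun n => d ≤ om P n).card + ((Ioc a (a + (W * T : ℕ))).filter fun n => Y0 P (J+3) (n, true)).card
       + ((Ioc a (a + (W * T : ℕ))).filter fun n => Y0 P (J+3) (n, false)).card
       + W * (((Ioc a (a + (W * T : ℕ))).filter fun n => D0 ≤ om P n).card + ((Ioc a (a + (W * T : ℕ))).filter fun n => Tb P (3 * (J+3) + 2) τ n).card
        + ∑ i ∈ Icc (J+1) (J+3), ((range T).filter fun t => ρ ^ i < ‖Ah P (tile a W t ×ˢ univ) i‖).card) := by
  have hb : (((range T).filter fun t => ¬ goodT P a W J D0 τ ρ t).card : ℝ) ≤ (((Ioc a (a + (W * T : ℕ))).filter fun n => D0 ≤ om P n).card + ((Ioc a (a + (W * T : ℕ))).filter fun n => Tb P (3 * (J+3) + 2) τ n).card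
        + ∑ i ∈ Icc (J+1) (J+3), ((range T).filter fun t => ρ ^ i < ‖Ah P (tile a W t ×ˢ univ) i‖).card) := by
    refine le_trans ?_ (add_le_add_left (add_le_add (bad_tiles a W T _) (bad_tiles a W T _)) _)
    norm_cast
    refine le_trans (card_le_card ?_) ((card_union_le _ _).trans (add_le_add (card_union_le _ _) card_biUnion_le))
    intro t ht
    obtain ⟨ht1, ht2⟩ := mem_filter.1 ht
    simp only [mem_union, mem_biUnion, mem_filter, ht1, true_and, mem_Icc]
    by_contra hc
    push Not at hc
    refine ht2 ⟨fun n hn => (hc.1.1 n hn).le, hc.1.2, fun i hi => hc.2 i (by omega)⟩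
  have hc : (Ioc a (a + N) \ XX P a W T J Hn D0 τ ρ d).card ≤ (Ioc (a + (W * T : ℕ)) (a + N)).card + ((range T).biUnion fun t => Ioc (a + W * t) (a + W * t + Hn) ∪ Ioc (a + W * t + W - Hn) (a + W * t + W)).card
       + ((Ioc a (a + (W * T : ℕ))).filter fun n => d ≤ om P n).card + ((Ioc a (a + (W * T : ℕ))).filter fun n => Y0 P (J+3) (n, true)).card
       + ((Ioc a (a + (W * T : ℕ))).filter fun n => Y0 P (J+3) (n, false)).card
       + (((range T).filter fun t => ¬ goodT P a W J D0 τ ρ t).biUnion (tile a W)).card := by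
    refine le_trans (card_le_card ?_) (le_trans (card_union_le _ _) (add_le_add_left (le_trans (card_union_le _ _) (add_le_add_left (le_trans (card_union_le _ _) (add_le_add_left (le_trans (card_union_le _ _) (add_le_add_left (card_union_le _ _) _)) _)) _)) _))
    intro n hn
    obtain ⟨hn1, hn2⟩ := mem_sdiff.1 hn
    by_contra hcc
    simp only [mem_union, not_or] at hcc
    obtain ⟨⟨⟨⟨⟨c1, c2⟩, c3⟩, c4⟩, c5⟩, c6⟩ := hcc
    have hn3 : n ∈ Ioc a (a + (W * T : ℕ)) := by
      grind
    obtain ⟨t, htT, ht⟩ : ∃ t < T, n ∈ tile a W t := by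
      by_contra hcon
      push Not at hcon
      have := sum_tiles a W T (fun k => if k = n then (1:ℝ) else 0)
      rw [sum_eq_zero fun t ht => sum_eq_zero fun k hk => if_neg (fun e : k = n => hcon t (mem_range.1 ht) (e ▸ hk))] at this
      rw [sum_ite_eq' , if_pos hn3] at this
      norm_num at this
    refine hn2 (mem_filter.2 ⟨hn3, t, htT, ?_, ?_, ?_, ?_⟩)
    · grind
    · have : n ∉ Ioc (a + W * t) (a + W * t + Hn) ∪ Ioc (a + W * t + W - Hn) (a + W * t + W) := fun h => c2 (mem_biUnion.2 ⟨t, mem_range.2 htT, h⟩)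
      simp only [tile, mem_union, mem_Ioc] at this ht ⊢
      omega
    · grind
    · intro s hs
      cases s
      · grind
      · grind
  have h1 : (Ioc (a + (W * T : ℕ)) (a + (N:ℤ))).card = N - W * T := by
    rw [Int.card_Ioc]; omega
  have h2 : ((range T).biUnion fun t => Ioc (a + W * t) (a + W * t + Hn) ∪ Ioc (a + W * t + W - Hn) (a + W * t + W)).card ≤ 2 * Hn * T := by
    refine (card_biUnion_le_card_mul _ _ (2 * Hn) fun t _ => (card_union_le _ _).trans ?_).trans (by rw [card_range, mul_comm])
    rw [Int.card_Ioc, Int.card_Ioc]; omega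
  have h3 : (((range T).filter fun t => ¬ goodT P a W J D0 τ ρ t).biUnion (tile a W)).card ≤ W * ((range T).filter fun t => ¬ goodT P a W J D0 τ ρ t).card := by
    refine (card_biUnion_le_card_mul _ _ W fun t _ => ?_).trans (by rw [mul_comm])
    rw [tile, Int.card_Ioc]; omega
  have h4 : (W:ℝ) * ((range T).filter fun t => ¬ goodT P a W J D0 τ ρ t).card ≤ _ := mul_le_mul_of_nonneg_left hb (Nat.cast_nonneg W)
  refine le_trans ?_ (add_le_add_right h4 _)
  rw [h1] at hc
  have := hc.trans (add_le_add (add_le_add_left (add_le_add_left (add_le_add_left (add_le_add_right h2 _) _) _) _) h3)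
  exact_mod_cast this
theorem normbad {H0 δ H : ℝ} (hH : 1 ≤ H) (hH0 : 0 < H0) (hPp : ∀ p ∈ P, p.Prime) (hP : ∀ p ∈ P, H0 ≤ (p:ℝ) ∧ (p:ℝ) ≤ H)
    {h n α m mm : ℕ} (hn : 0 < n) (hh : 2 * n ≤ h) (hδ0 : 0 ≤ δ) (hm : m = 2 ^ (α+1) * n) (hm1 : 1 ≤ m) (hmm' : m ≤ mm)
    (hBS : BS P h mm δ)
    (hL : 1 ≤ ∑ p ∈ P, (1:ℝ) / p) (hsm : δ * (m:ℝ) ^ (2 * 2 ^ (α+1) + 1) ≤ 1) (hmm : (m:ℝ) ^ 2 / H0 ≤ 1)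
    (a : ℤ) (W T : ℕ) (hW : ∀ p ∈ P, p.Coprime W) (hM : H ^ m ≤ (W * T : ℕ)) (ρ : ℝ) (hρ : 0 ≤ ρ) :
    (((range T).filter fun t => ρ ^ n < ‖Ah P (tile a W t ×ˢ univ) n‖).card : ℝ) * ρ ^ m ≤ 4 * (W * T : ℕ) * (10 ^ m * ((∑ p ∈ P, (1:ℝ) / p) ^ (m / 2) * (m:ℝ) ^ (2 ^ (α+1)))) + 2 * W * ((P.card:ℝ) ^ m * H ^ m) := by
  refine le_trans ?_ (tr_sum hH hH0 hPp hP hn hh hδ0 hm hm1 (fun s l hl hl2 => hBS _ _ (fun i => es_abs s m i) l hl (hl2.trans hmm')) hL hsm hmm a W T hW hM)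
  rw [← nsmul_eq_mul, ← sum_const, sum_filter]
  refine sum_le_sum fun t ht => ?_
  have h1 := norm_le_trace (Ah P (tile a W t ×ˢ univ) n) (Ah_herm n) α
  split_ifs with hc
  · refine le_trans ?_ h1
    rw [hm, mul_comm, pow_mul]
    exact pow_le_pow_left₀ (by positivity) hc.le _
  · exact le_trans (by positivity) h1
end build
end TB
namespace TB
open Finset
theorem pw {x y b : ℝ} {n : ℕ} (hx0 : 0 ≤ x) (hx : x ≤ Real.exp y) (hy : 0 ≤ y) (hn : (n:ℝ) ≤ b) : x ^ n ≤ Real.exp (y * b) := by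
  refine (pow_le_pow_left₀ hx0 hx n).trans ?_
  rw [← Real.exp_nat_mul]
  exact Real.exp_le_exp.2 (by rw [mul_comm]; exact mul_le_mul_of_nonneg_left hn hy)
theorem pk {k : ℝ} (hk : 5000 ≤ k) : 5 * k + 4 * k ^ 3 ≤ k ^ 5 := by
  have h1 : k ≤ k ^ 3 := le_self_pow₀ (by linarith) (by norm_num)
  have h2 : (9:ℝ) ≤ k ^ 2 := by nlinarith
  nlinarith
open Classical
structure Reg (P : Finset ℕ) (H0 H s l L : ℝ) (α J : ℕ) : Prop where
  hP : ∀ p ∈ P, Nat.Prime p ∧ H0 ≤ (p : ℝ) ∧ (p : ℝ) ≤ H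
  hs : 5000 ≤ s
  hl : 200 ≤ l
  hsl : 25 * l ≤ s
  hkl : s ^ 2 = Real.exp l
  hH0 : Real.exp (200 * (s * l)) ≤ H0
  hH0H : H0 ≤ H
  hH : H = Real.exp (s ^ 2)
  hL : L = ∑ p ∈ P, (1:ℝ) / p
  hL1 : Real.exp 1 ≤ L
  hL2 : L ≤ 2 * s ^ 2
  hPc : (P.card : ℝ) ≤ H
  hg1 : s ≤ 2 ^ (α + 1)
  hg2 : (2:ℝ) ^ (α + 1) ≤ 2 * s
  hα : 1 ≤ α
  hm1 : s ^ 2 ≤ 2 ^ (α + 1) * (J + 1)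
  hm2 : (2:ℝ) ^ (α + 1) * (J + 3) ≤ s ^ 2 + 6 * s
  hJ1 : (J:ℝ) ≤ s
  hJ2 : s / 2 ≤ J + 1
namespace Reg
variable {P : Finset ℕ} {H0 H s l L : ℝ} {α J : ℕ}
theorem H0p (R : Reg P H0 H s l L α J) : 0 < H0 := (Real.exp_pos _).trans_le R.hH0
theorem H1 (R : Reg P H0 H s l L α J) : 1 ≤ H := by rw [R.hH]; exact Real.one_le_exp (by positivity)
theorem L1 (R : Reg P H0 H s l L α J) : 1 ≤ L := (Real.one_le_exp (by norm_num)).trans R.hL1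
theorem kp (R : Reg P H0 H s l L α J) (n : ℕ) : (s ^ 2) ^ n = Real.exp (n * l) := by rw [R.hkl, ← Real.exp_nat_mul]
theorem mm (R : Reg P H0 H s l L α J) : ((2 ^ (α+1) * (J+3) : ℕ):ℝ) ≤ s ^ 2 + 6 * s := by exact_mod_cast R.hm2
theorem fx (R : Reg P H0 H s l L α J) : 5000 * s ≤ s ^ 2 ∧ 5000 * s ^ 2 ≤ (s ^ 2) ^ 2 ∧ 5000 * l ≤ s * l := by
  have hs := R.hs
  have hl := R.hl
  have h1 : 5000 * s ≤ s ^ 2 := by rw [sq]; exact mul_le_mul_of_nonneg_right hs (by linarith)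
  refine ⟨h1, ?_, mul_le_mul_of_nonneg_right hs (by linarith)⟩
  nlinarith
theorem bs (R : Reg P H0 H s l L α J) : BS P (3 * J + 12) (2 ^ (α + 1) * (J + 3)) (Real.exp (9 * (s * l)) / H0) := by
  intro ε rs hε w hw hwl
  have hs := R.hs
  have hl := R.hl
  have hJ1 := R.hJ1
  have hH0 := R.H0p
  obtain ⟨hk, hkk, hsk⟩ := R.fx
  have hmm := R.mm
  set m := 2 ^ (α + 1) * (J + 3) with hm
  have hh : ((3 * J + 12 : ℕ):ℝ) ≤ 4 * s := by push_cast; linarith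
  have hk2 := R.kp 2
  have hHe := R.hH
  have hexp : s ^ 2 + 1 ≤ Real.exp (s^2) := Real.add_one_le_exp _
  have hH0s : s ^ 2 ≤ H0 := by
    refine le_trans ?_ R.hH0
    rw [R.hkl]
    exact Real.exp_le_exp.2 (by linarith)
  have hlog : Real.log H = s ^ 2 := by rw [R.hH, Real.log_exp]
  obtain ⟨B, hB1, hB2⟩ : ∃ B : ℕ, 4 * s ^ 2 ≤ (B:ℝ) ∧ (B:ℝ) ≤ 5 * s ^ 2 :=
    ⟨⌈4 * s ^ 2⌉₊, Nat.le_ceil _, by have := Nat.ceil_lt_add_one (show 0 ≤ 4 * s ^ 2 by positivity); linarith⟩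
  have h1 := bad_sum (ε := ε) (rs := rs) hH0 R.hP (3 * J + 12) (by linarith) hε m w hw hwl R.H1 B ?_
  · refine h1.trans ?_
    rw [hlog]
    have a1 : (2 * (m:ℝ) + 1) ^ (3 * J + 12) ≤ Real.exp (2 * l * (4 * s)) :=
      pw (by positivity) (by rw [show 2 * l = ((2:ℕ):ℝ) * l by norm_num, ← R.kp 2]; linarith) (by linarith) hh
    have a2 : ((m:ℝ) + 1) * (m + 1) ≤ Real.exp (4 * l) := by
      rw [show 4 * l = ((4:ℕ):ℝ) * l by norm_num, ← R.kp 4]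
      calc _ ≤ (s ^ 2) ^ 2 * (s^2)^2 := mul_le_mul (by linarith) (by linarith) (by positivity) (by positivity)
        _ = _ := by ring
    have a3 : (B:ℝ) / H0 + (m * (2 * (3 * J + 12) + 1) : ℕ) * ((2 + s ^ 2) / H0) ≤ Real.exp (5 * l) / H0 := by
      rw [← mul_div_assoc, ← add_div]
      refine div_le_div_of_nonneg_right ?_ hH0.le
      rw [show 5 * l = ((5:ℕ):ℝ) * l by norm_num, ← R.kp 5]
      have b1 : ((m * (2 * (3 * J + 12) + 1) : ℕ) : ℝ) ≤ (2 * s ^ 2) * (s ^ 2) := by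
        push_cast
        exact mul_le_mul (by linarith) (by linarith) (by positivity) (by positivity)
      have b2 : ((m * (2 * (3 * J + 12) + 1) : ℕ) : ℝ) * (2 + s ^ 2) ≤ (2 * s ^ 2) * (s ^ 2) * (2 * s ^ 2) := by
        gcongr; linarith
      have b3 := pk (k := s ^ 2) (by linarith)
      grind
    calc _ ≤ (Real.exp (2 * l * (4 * s)) * Real.exp (4 * l)) * (Real.exp (5 * l) / H0) := by
          refine mul_le_mul ?_ a3 (by positivity) (by positivity)
          push_cast
          rw [mul_assoc]
          gcongr
      _ = Real.exp (2 * l * (4 * s) + 4 * l + 5 * l) / H0 := by rw [Real.exp_add, Real.exp_add]; ring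
      _ ≤ _ := div_le_div_of_nonneg_right (Real.exp_le_exp.2 (by linarith)) hH0.le
  · calc _ ≤ Real.exp (s^2) * Real.exp (s^2) := by
          rw [← hHe]; refine mul_le_mul_of_nonneg_right ?_ (by linarith [R.H1])
          rw [hHe]
          have := Real.quadratic_le_exp_of_nonneg (show 0 ≤ s ^ 2 by positivity)
          linarith
      _ = Real.exp (2 * s ^ 2) := by rw [← Real.exp_add]; ring_nf
      _ < Real.exp (Real.log 2 * B) := Real.exp_lt_exp.2 (by
        have h2 : 0.6 * (B:ℝ) ≤ Real.log 2 * B := mul_le_mul_of_nonneg_right (by linarith [Real.log_two_gt_d9]) (by positivity)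
        linarith)
      _ = 2 ^ B := by rw [mul_comm, Real.exp_nat_mul, Real.exp_log (by norm_num)]
theorem dl (R : Reg P H0 H s l L α J) : Real.exp (9 * (s * l)) / H0 ≤ Real.exp (-191 * (s * l)) := by
  rw [div_le_iff₀ R.H0p]
  refine le_trans (le_of_eq ?_) (mul_le_mul_of_nonneg_left R.hH0 (Real.exp_pos _).le)
  rw [← Real.exp_add]; ring_nf
theorem ml (R : Reg P H0 H s l L α J) : ((2 ^ (α+1) * (J+3) : ℕ):ℝ) / H0 ≤ Real.exp (9 * (s * l)) / H0 := by
  refine div_le_div_of_nonneg_right (R.mm.trans ?_) R.H0p.le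
  have hs := R.hs
  have hl := R.hl
  obtain ⟨hk, hkk, hsk⟩ := R.fx
  calc s ^ 2 + 6 * s ≤ (s^2)^2 := by linarith
    _ = _ := R.kp 2
    _ ≤ _ := Real.exp_le_exp.2 (by push_cast; linarith)
theorem c_D (R : Reg P H0 H s l L α J) (a : ℤ) (M : ℕ) (hM : H ^ (2 ^ (α+1) * (J+3)) ≤ M) (W : ℝ) (hW0 : 0 ≤ W) (hW : W ≤ 2 * H ^ 2) :
    W * ((Ioc a (a + M)).filter (fun n => s ^ 4 ≤ om P n)).card ≤ M / H := by
  have hs := R.hs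
  obtain ⟨hk, hkk, hsk⟩ := R.fx
  obtain ⟨S, hS1, hS2, hS3⟩ : ∃ S : ℕ, s ^ 2 ≤ (S:ℝ) ∧ (S:ℝ) ≤ 2 * s ^ 2 ∧ S ≤ 2 ^ (α+1) * (J+3) :=
    ⟨⌈s ^ 2⌉₊, Nat.le_ceil _, by have := Nat.ceil_lt_add_one (show 0 ≤ s ^ 2 by positivity); linarith, Nat.ceil_le.2 (by
      have := R.hm1; push_cast; have h2 : (0:ℝ) < 2 ^ (α+1) := by positivity
      linarith)⟩
  have h1 := om_tail (P := P) R.H1 (fun p hp => ⟨(R.hP p hp).1, (R.hP p hp).2.2⟩) a M S ((pow_le_pow_right₀ R.H1 hS3).trans hM) (s ^ 4) (by linarith [show s ^ 4 = (s ^ 2) ^ 2 by ring])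
  rw [← R.hL] at h1
  set c : ℝ := (((Ioc a (a + M)).filter (fun n => s ^ 4 ≤ om P n)).card : ℝ)
  have hL0 : 0 < L := by linarith [R.L1]
  have hD : L * Real.exp 5 ≤ s ^ 4 - S := by
    have e5 : Real.exp 5 ≤ 3 ^ 5 := by
      rw [show (5:ℝ) = (5:ℕ) * 1 by norm_num, Real.exp_nat_mul]
      exact pow_le_pow_left₀ (Real.exp_pos _).le (by linarith [Real.exp_one_lt_d9]) _
    have : L * Real.exp 5 ≤ 2 * s ^ 2 * 3 ^ 5 := mul_le_mul R.hL2 e5 (Real.exp_pos _).le (by positivity)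
    grind
  have h2 : c * Real.exp (5 * s ^ 2) ≤ 2 * M := by
    have h3 : c * (L * Real.exp 5) ^ S ≤ 2 * M * L ^ S := le_trans (by gcongr) h1
    rw [mul_pow, ← Real.exp_nat_mul] at h3
    have h4 : c * Real.exp (S * 5) ≤ 2 * M := by
      have : 0 < L ^ S := by positivity
      exact le_of_mul_le_mul_right (by linarith) this
    refine le_trans (mul_le_mul_of_nonneg_left (Real.exp_le_exp.2 (by linarith)) (by positivity)) h4
  rw [le_div_iff₀ (by linarith [R.H1])]
  have e : Real.exp (5 * s^2) = H ^ 5 := by rw [R.hH, ← Real.exp_nat_mul]; norm_num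
  rw [e] at h2
  have hH4 : 4 ≤ H := by rw [R.hH]; have := Real.add_one_le_exp (s^2); linarith
  have hc : 0 ≤ c := by positivity
  calc W * c * H ≤ 2 * H ^ 2 * c * H := by gcongr
    _ ≤ (c * H ^ 5) / 2 := by
      have : (4:ℝ) ≤ H ^ 2 := by nlinarith
      have h3 : 0 ≤ c * H ^ 3 := by positivity
      nlinarith
    _ ≤ M := by linarith
theorem c_T (R : Reg P H0 H s l L α J) (a : ℤ) (M : ℕ) (hM : H ^ (2 ^ (α+1) * (J+3)) ≤ M) (W : ℝ) (hW0 : 0 ≤ W) (hW : W ≤ 2 * H ^ 2) :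
    W * ((Ioc a (a + M)).filter (fun n => Tb P (3 * (J+3) + 2) (Real.exp (-15 * (s * l))) n)).card ≤ M / H := by
  have hs := R.hs
  have hl := R.hl
  obtain ⟨hk, hkk, hsk⟩ := R.fx
  have hsl := R.hsl
  have hJ1 := R.hJ1
  obtain ⟨v, hv⟩ : ∃ v, v = 2 ^ (α - 1) := ⟨_, rfl⟩
  have hv4 : 2 ^ (α+1) = 4 * v := by rw [hv, show α + 1 = (α - 1) + 2 by have := R.hα; omega, pow_add]; omega
  have hv4r : (2:ℝ) ^ (α+1) = 4 * v := by exact_mod_cast hv4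
  have hv0 : 1 ≤ v := by rw [hv]; exact Nat.one_le_two_pow
  have hg1 := R.hg1
  have hg2 := R.hg2
  have hmm := R.mm
  set Q := s * l with hQ
  have h1 := tau_count (P := P) (H0 := H0) (δ := Real.exp (9 * Q) / H0) (τ := Real.exp (-15 * Q)) (h := 3 * J + 12) (m := 2 ^ (α+1) * (J+3)) (Lm := 3 * (J+3) + 2) (v := v)
    R.H1 R.H0p R.hP (div_pos (Real.exp_pos _) R.H0p) (R.dl.trans (Real.exp_le_one_iff.2 (by linarith))) R.ml R.bs (by omega) hv0 (by rw [hv4]; nlinarith) (Real.exp_pos _) a M hM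
  set c : ℝ := (((Ioc a (a + M)).filter (fun n => Tb P (3 * (J+3) + 2) (Real.exp (-15 * Q)) n)).card : ℝ)
  rw [← R.hL] at h1
  have hvs : s / 4 ≤ v := by linarith
  have hLm : (((3 * (J + 3) + 2 : ℕ):ℝ) + 1) ≤ 4 * s := by push_cast; linarith
  have hQp : 0 ≤ Q := by positivity
  have x1 : Real.exp (-16 * Q * v) ≤ (Real.exp (-15 * Q) / (((3 * (J + 3) + 2 : ℕ):ℝ) + 1)) ^ v := by
    rw [show -16 * Q * v = v * (-16 * Q) by ring, Real.exp_nat_mul]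
    refine pow_le_pow_left₀ (Real.exp_pos _).le ?_ _
    rw [le_div_iff₀ (by positivity)]
    calc _ ≤ Real.exp (-16 * Q) * Real.exp Q := by
          refine mul_le_mul_of_nonneg_left (hLm.trans ?_) (Real.exp_pos _).le
          calc 4 * s ≤ s ^ 2 := by linarith
            _ = Real.exp l := R.hkl
            _ ≤ _ := Real.exp_le_exp.2 (by linarith)
      _ = _ := by rw [← Real.exp_add]; ring_nf
  have x2 : (Real.exp (9 * Q) / H0) ^ (v - 1) ≤ Real.exp (-191 * Q * (v - 1)) := by
    refine (pow_le_pow_left₀ (div_pos (Real.exp_pos _) R.H0p).le R.dl _).trans (le_of_eq ?_)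
    rw [← Real.exp_nat_mul, Nat.cast_sub hv0, ← hQ]; push_cast; ring_nf
  have x3 : (L + 2 + 2 * ((2 ^ (α+1) * (J+3) : ℕ):ℝ)) ^ (v * (3 * (J + 3) + 2 + 1)) ≤ Real.exp (2 * l * (v * (4 * s))) := by
    have hL0 := R.L1
    refine pw (by positivity) ?_ (by linarith) ?_
    · have hL2 := R.hL2
      rw [show 2 * l = ((2:ℕ):ℝ) * l by norm_num, ← R.kp 2]; linarith
    · push_cast at hLm ⊢; gcongr
  have hH1 := R.H1
  have hH4 : s ^ 2 ≤ H := by rw [R.hH]; have := Real.add_one_le_exp (s^2); linarith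
  have x4 : c * Real.exp (-16 * Q * v) ≤ 2 * (2 * H) * H * (2 * M * (Real.exp (-191 * Q * (v - 1)) * Real.exp (2 * l * (v * (4 * s))))) := by
    refine (mul_le_mul_of_nonneg_left x1 (by positivity)).trans (h1.trans ?_)
    refine mul_le_mul ?_ ?_ (by have := R.H0p; have := R.L1; positivity) (by positivity)
    · refine mul_le_mul ?_ (by linarith) (by positivity) (by positivity)
      linarith [R.hPc]
    · refine mul_le_mul_of_nonneg_left ?_ (by positivity)
      exact mul_le_mul x2 x3 (by have := R.L1; positivity) (Real.exp_pos _).le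
  have x5 : c * Real.exp (-16 * Q * v) ≤ M * (8 * H ^ 2 * Real.exp (-191 * Q * (v - 1) + 2 * l * (v * (4 * s)))) := by
    rw [Real.exp_add]; refine x4.trans (le_of_eq (by ring))
  rw [le_div_iff₀ (by linarith)]
  have hc : 0 ≤ c := by positivity
  have h16 : 16 ≤ H := by linarith
  have x6 : c ≤ M * (8 * H ^ 2) * Real.exp (-6 * s ^ 2) := by
    have : c = c * Real.exp (-16 * Q * v) * Real.exp (16 * Q * v) := by rw [mul_assoc, ← Real.exp_add]; ring_nf; simp
    rw [this]
    refine (mul_le_mul_of_nonneg_right x5 (Real.exp_pos _).le).trans ?_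
    rw [← mul_assoc, mul_assoc _ _ (Real.exp (16 * Q * v)), ← Real.exp_add]
    refine mul_le_mul_of_nonneg_left (Real.exp_le_exp.2 ?_) (by positivity)
    have k1 : 50 * s ^ 2 ≤ Q * v := by
      calc 50 * s ^ 2 = s * 200 * (s / 4) := by ring
        _ ≤ s * l * (s / 4) := by gcongr
        _ ≤ _ := by rw [hQ]; gcongr
    have k2 : 25 * Q ≤ s ^ 2 := by rw [hQ, show 25 * (s * l) = s * (25 * l) by ring, sq]; gcongr
    grind
  have e : Real.exp (-6 * s^2) * H ^ 6 = 1 := by rw [R.hH, ← Real.exp_nat_mul, ← Real.exp_add]; ring_nf; simp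
  calc W * c * H ≤ 2 * H ^ 2 * (M * (8 * H ^ 2) * Real.exp (-6 * s ^ 2)) * H := by gcongr
    _ = M * (16 * H ^ 5 * Real.exp (-6 * s ^ 2)) := by ring
    _ ≤ M * (H * H ^ 5 * Real.exp (-6 * s ^ 2)) := by gcongr
    _ = M * (Real.exp (-6 * s^2) * H ^ 6) := by ring
    _ = M := by rw [e, mul_one]
end Reg
end TB
namespace TB
open Finset
namespace Reg
open Matrix
open scoped Matrix.Norms.L2Operator
open Classical
variable {P : Finset ℕ} {H0 H s l L : ℝ} {α J : ℕ}
theorem sl (R : Reg P H0 H s l L α J) : 25 * (s * l) ≤ s ^ 2 := by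
  rw [show 25 * (s * l) = s * (25 * l) by ring, sq]; exact mul_le_mul_of_nonneg_left R.hsl (by linarith [R.hs])
theorem sq0 (R : Reg P H0 H s l L α J) : Real.exp (100 * (s * l)) ≤ Real.sqrt H0 := by
  refine Real.le_sqrt_of_sq_le (le_trans (le_of_eq ?_) R.hH0)
  rw [← Real.exp_nat_mul]; ring_nf
theorem c_Y (R : Reg P H0 H s l L α J) (a : ℤ) (M : ℕ) (hM : H ^ (2 ^ (α+1) * (J+3)) ≤ M) (b : Bool) :
    (((Ioc a (a + M)).filter (fun n => Y0 P (J+3) (n, b))).card : ℝ) ≤ M / Real.sqrt H0 := by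
  have hs := R.hs
  have hl := R.hl
  obtain ⟨hk, hkk, hsk⟩ := R.fx
  have hJ1 := R.hJ1
  have hL1 := R.L1
  have hL2 := R.hL2
  have hmm := R.mm
  have hg : 4 ≤ 2 ^ (α+1) := by
    calc 4 = 2 ^ (1+1) := by norm_num
      _ ≤ _ := Nat.pow_le_pow_right (by norm_num) (by have := R.hα; omega)
  have h1 := Y0_count (P := P) (H0 := H0) (δ := Real.exp (9 * (s * l)) / H0) (h := 3 * J + 12) (m := 2 ^ (α+1) * (J+3)) (j := J + 3)
    R.H1 R.H0p R.hP (div_pos (Real.exp_pos _) R.H0p) (R.dl.trans (Real.exp_le_one_iff.2 (by linarith))) R.ml R.bs (by omega) (le_trans (by omega) (Nat.mul_le_mul_right _ hg)) a M hM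
    (fun h => by have := (R.hP 0 h).1; norm_num at this) (by rw [← R.hL]; exact hL1) b
  refine h1.trans ?_
  rw [← R.hL]
  have hh : ((3 * (J + 3) + 3 : ℕ):ℝ) ≤ 4 * s := by push_cast; linarith
  have x3 : (L + 2 + 2 * ((2 ^ (α+1) * (J+3) : ℕ):ℝ)) ^ (3 * (J + 3) + 3) ≤ Real.exp (2 * l * (4 * s)) := by
    refine pw (by positivity) ?_ (by linarith) hh
    rw [show 2 * l = ((2:ℕ):ℝ) * l by norm_num, ← R.kp 2]; linarith
  have x4 : (3 * ((J + 3 : ℕ):ℝ) + 3) * 6 ≤ Real.exp (s * l) := by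
    calc _ ≤ s ^ 2 := by push_cast; linarith
      _ = Real.exp l := R.hkl
      _ ≤ _ := Real.exp_le_exp.2 (by linarith)
  have hq := R.sq0
  have hqp : 0 < Real.sqrt H0 := Real.sqrt_pos.2 R.H0p
  have hH0 := R.H0p
  calc _ = (3 * ((J + 3 : ℕ):ℝ) + 3) * 6 * (Real.exp (9 * (s * l)) * (L + 2 + 2 * ((2 ^ (α+1) * (J+3) : ℕ):ℝ)) ^ (3 * (J + 3) + 3)) * (M / H0) := by ring
    _ ≤ Real.exp (s * l) * (Real.exp (9 * (s * l)) * Real.exp (2 * l * (4 * s))) * (M / H0) := by gcongr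
    _ = Real.exp (18 * (s * l)) * (M / H0) := by rw [← Real.exp_add, ← Real.exp_add]; ring_nf
    _ ≤ Real.sqrt H0 * (M / H0) := by
      refine mul_le_mul_of_nonneg_right (le_trans (Real.exp_le_exp.2 (by linarith)) hq) (by positivity)
    _ = Real.sqrt H0 * (M / (Real.sqrt H0 * Real.sqrt H0)) := by rw [Real.mul_self_sqrt hH0.le]
    _ = _ := by field_simp
theorem hsm (R : Reg P H0 H s l L α J) : 9 * ((s ^ 4 + L) ^ (2 * (J+3)) * (((J:ℝ)+3) * ((J+3) / H0 + (J+4) * Real.exp (-15 * (s * l))))) ≤ 1 := by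
  have hs := R.hs
  have hl := R.hl
  obtain ⟨hk, hkk, hsk⟩ := R.fx
  have hJ1 := R.hJ1
  have hL1 := R.L1
  have hL2 := R.hL2
  have x1 : (s ^ 4 + L) ^ (2 * (J+3)) ≤ Real.exp (3 * l * (3 * s)) := by
    refine pw (by positivity) ?_ (by linarith) (by push_cast; linarith)
    rw [show 3 * l = ((3:ℕ):ℝ) * l by norm_num, ← R.kp 3]
    nlinarith
  have x2 : 1 / H0 ≤ Real.exp (-15 * (s * l)) := by
    rw [div_le_iff₀ R.H0p]
    refine le_trans ?_ (mul_le_mul_of_nonneg_left R.hH0 (Real.exp_pos _).le)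
    rw [← Real.exp_add]; exact Real.one_le_exp (by linarith)
  have hH0 := R.H0p
  calc _ ≤ 9 * (Real.exp (3 * l * (3 * s)) * (s ^ 2 * (s ^ 2 * Real.exp (-15 * (s * l))))) := by
        gcongr
        · linarith
        · calc ((J:ℝ)+3) / H0 + (J+4) * Real.exp (-15 * (s * l)) = (J+3) * (1 / H0) + (J+4) * Real.exp (-15 * (s * l)) := by ring
            _ ≤ (J+3) * Real.exp (-15 * (s * l)) + (J+4) * Real.exp (-15 * (s * l)) := by gcongr
            _ = (2 * J + 7) * Real.exp (-15 * (s * l)) := by ring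
            _ ≤ _ := by gcongr; linarith
    _ ≤ s ^ 2 * (Real.exp (3 * l * (3 * s)) * (s ^ 2 * (s ^ 2 * Real.exp (-15 * (s * l))))) := by gcongr; linarith
    _ = Real.exp (3 * l - 6 * (s * l)) := by
      rw [R.hkl]; simp only [← Real.exp_add]; ring_nf
    _ ≤ 1 := Real.exp_le_one_iff.2 (by linarith)
theorem hJJ (R : Reg P H0 H s l L α J) : 24 * ((s ^ 4 + L) + 1) ≤ 2 ^ (J+1) := by
  have hs := R.hs
  have hl := R.hl
  obtain ⟨hk, hkk, hsk⟩ := R.fx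
  have hL2 := R.hL2
  have hJ2 := R.hJ2
  have hsl := R.hsl
  calc _ ≤ s ^ 2 * (s ^ 2) ^ 2 := by
        nlinarith
    _ = (s ^ 2) ^ 3 := by ring
    _ = Real.exp ((3:ℕ) * l) := R.kp 3
    _ ≤ Real.exp (Real.log 2 * (J + 1 : ℕ)) := Real.exp_le_exp.2 (by
        have h2 : 0.6 * ((J + 1 : ℕ):ℝ) ≤ Real.log 2 * (J + 1 : ℕ) := mul_le_mul_of_nonneg_right (by linarith [Real.log_two_gt_d9]) (by positivity)
        push_cast at h2 ⊢
        linarith)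
    _ = 2 ^ (J+1) := by rw [mul_comm, Real.exp_nat_mul, Real.exp_log (by norm_num)]
theorem c_N (R : Reg P H0 H s l L α J) (a : ℤ) (W T : ℕ) (hWc : ∀ p ∈ P, p.Coprime W) (hM : 2 * H ^ (2 * (2 ^ (α+1) * (J+3))) ≤ T) (hW1 : 1 ≤ W) (hW : (W:ℝ) ≤ 2 * H ^ 2)
    (i : ℕ) (hi : i ∈ Icc (J+1) (J+3)) :
    (W:ℝ) * ((range T).filter fun t => (10 * Real.exp 8 * Real.sqrt L) ^ i < ‖Ah P (tile a W t ×ˢ univ) i‖).card ≤ (W * T : ℕ) / H := by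
  have hs := R.hs
  have hl := R.hl
  obtain ⟨hk, hkk, hsk⟩ := R.fx
  have hL1 := R.L1
  have hH1 := R.H1
  have hmm := R.mm
  have hsl := R.sl
  obtain ⟨hi1, hi2⟩ := mem_Icc.1 hi
  obtain ⟨m, hm⟩ : ∃ m, m = 2 ^ (α+1) * i := ⟨_, rfl⟩
  have hmle : m ≤ 2 ^ (α+1) * (J+3) := by rw [hm]; exact Nat.mul_le_mul_left _ hi2
  have hmle' : (m:ℝ) ≤ s ^ 2 + 6 * s := le_trans (by exact_mod_cast hmle) hmm
  have hmge : s ^ 2 ≤ m := by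
    refine R.hm1.trans ?_
    rw [hm]; push_cast
    have : ((J + 1 : ℕ) : ℝ) ≤ i := by exact_mod_cast hi1
    push_cast at this
    gcongr
  have hm1 : 1 ≤ m := by
    have : (1:ℝ) ≤ m := by linarith
    exact_mod_cast this
  have hme : (m:ℝ) ≤ Real.exp (2 * l) := by
    rw [show 2 * l = ((2:ℕ):ℝ) * l by norm_num, ← R.kp 2]; linarith
  have hg2 := R.hg2
  have hmg : (m:ℝ) ^ (2 ^ (α+1)) ≤ Real.exp m := by
    refine (pw (by positivity) hme (by linarith) (b := 2 * s) (by push_cast; exact hg2)).trans (Real.exp_le_exp.2 ?_)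
    linarith
  have hT : 2 * H ^ (2 * m) ≤ T := le_trans (mul_le_mul_of_nonneg_left (pow_le_pow_right₀ hH1 (by omega)) (by norm_num)) hM
  have hT0 : (0:ℝ) ≤ T := by positivity
  have hW0 : (1:ℝ) ≤ W := by exact_mod_cast hW1
  have h1 := normbad (P := P) (H0 := H0) (δ := Real.exp (9 * (s * l)) / H0) (h := 3 * J + 12) (n := i) (α := α) (m := m) (mm := 2 ^ (α+1) * (J+3)) hH1 R.H0p (fun p hp => (R.hP p hp).1) (fun p hp => (R.hP p hp).2)
    (by omega) (by omega) (div_pos (Real.exp_pos _) R.H0p).le hm hm1 hmle R.bs (by rw [← R.hL]; exact hL1) ?_ ?_ a W T hWc ?_ (10 * Real.exp 8 * Real.sqrt L) (by positivity)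
  · rw [← R.hL] at h1
    set c : ℝ := (((range T).filter fun t => (10 * Real.exp 8 * Real.sqrt L) ^ i < ‖Ah P (tile a W t ×ˢ univ) i‖).card : ℝ)
    have hsL : 1 ≤ Real.sqrt L := Real.one_le_sqrt.2 hL1
    set X : ℝ := (10 * Real.sqrt L * Real.exp 1) ^ m with hX
    have hX1 : 1 ≤ X := one_le_pow₀ (by have := Real.one_le_exp (show (0:ℝ) ≤ 1 by norm_num); nlinarith)
    have y1 : L ^ (m / 2) ≤ Real.sqrt L ^ m := by
      calc L ^ (m/2) = (Real.sqrt L ^ 2) ^ (m / 2) := by rw [Real.sq_sqrt (by linarith)]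
        _ = Real.sqrt L ^ (2 * (m / 2)) := by rw [pow_mul]
        _ ≤ _ := pow_le_pow_right₀ hsL (by omega)
    have y2 : 10 ^ m * (L ^ (m / 2) * (m:ℝ) ^ (2 ^ (α+1))) ≤ X := by
      calc _ ≤ 10 ^ m * (Real.sqrt L ^ m * Real.exp m) := by gcongr
        _ = X := by rw [hX, mul_pow, mul_pow, ← Real.exp_nat_mul]; ring_nf
    have y3 : (P.card:ℝ) ^ m * H ^ m ≤ H ^ (2 * m) := by
      rw [two_mul, pow_add]
      gcongr
      exact R.hPc
    have y4 : (10 * Real.exp 8 * Real.sqrt L) ^ m = X * Real.exp (7 * m) := by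
      rw [hX, show 7 * (m:ℝ) = m * 7 by ring, Real.exp_nat_mul, ← mul_pow]
      congr 1
      rw [mul_assoc (10 * Real.sqrt L), ← Real.exp_add, show (1:ℝ) + 7 = 8 by norm_num]; ring
    have hM0 : (0:ℝ) ≤ (W * T : ℕ) := by positivity
    have y5 : c * (X * Real.exp (7 * m)) ≤ 5 * (W * T : ℕ) * X := by
      rw [← y4]
      refine h1.trans ?_
      have z1 : 2 * (W:ℝ) * ((P.card:ℝ) ^ m * H ^ m) ≤ (W * T : ℕ) := by
        push_cast
        calc 2 * (W:ℝ) * ((P.card:ℝ) ^ m * H ^ m) ≤ 2 * W * H ^ (2 * m) := by gcongr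
          _ = W * (2 * H ^ (2 * m)) := by ring
          _ ≤ _ := by gcongr
      have z2 : 4 * ((W * T : ℕ):ℝ) * (10 ^ m * (L ^ (m / 2) * (m:ℝ) ^ (2 ^ (α+1)))) ≤ 4 * (W * T : ℕ) * X := by gcongr
      have z3 : ((W * T : ℕ):ℝ) * 1 ≤ (W * T : ℕ) * X := by gcongr
      linarith
    have y6 : c * Real.exp (7 * m) ≤ 5 * (W * T : ℕ) := le_of_mul_le_mul_right (by linarith) (by linarith : 0 < X)
    have hc : 0 ≤ c := by positivity
    have y7 : c * H ^ 7 ≤ 5 * (W * T : ℕ) := by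
      refine le_trans (mul_le_mul_of_nonneg_left ?_ hc) y6
      rw [R.hH, ← Real.exp_nat_mul]
      exact Real.exp_le_exp.2 (by push_cast; linarith)
    have h10 : 10 ≤ H := by rw [R.hH]; have := Real.add_one_le_exp (s^2); linarith
    rw [le_div_iff₀ (by linarith)]
    have hH3 : 1 ≤ H ^ 3 := one_le_pow₀ hH1
    calc (W:ℝ) * c * H ≤ 2 * H ^ 2 * c * H := by gcongr
      _ = c * (H ^ 3 * 2) := by ring
      _ ≤ c * (H ^ 3 * (H ^ 3 * (H / 5))) := by
        gcongr
        nlinarith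
      _ = (c * H ^ 7) / 5 := by ring
      _ ≤ _ := by linarith
  · calc _ ≤ Real.exp (-191 * (s * l)) * Real.exp (2 * l * (5 * s)) := by
          refine mul_le_mul R.dl (pw (by positivity) hme (by linarith) ?_) (by positivity) (Real.exp_pos _).le
          push_cast; linarith
      _ = Real.exp (-181 * (s * l)) := by rw [← Real.exp_add]; ring_nf
      _ ≤ 1 := Real.exp_le_one_iff.2 (by linarith)
  · rw [div_le_one R.H0p]
    refine le_trans (pow_le_pow_left₀ (by positivity) hme 2) (le_trans ?_ R.hH0)
    rw [← Real.exp_nat_mul]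
    exact Real.exp_le_exp.2 (by push_cast; linarith)
  · push_cast
    calc H ^ m ≤ 1 * (2 * H ^ (2 * m)) := by
          have := pow_le_pow_right₀ hH1 (show m ≤ 2 * m by omega)
          have : 0 ≤ H ^ (2 * m) := by positivity
          linarith
      _ ≤ W * T := by gcongr
theorem c_d (R : Reg P H0 H s l L α J) (a : ℤ) (M : ℕ) (K : ℝ) (hK : 1 ≤ K) (hM : Real.exp (s ^ 2 * (K * L + 1)) ≤ M) :
    (((Ioc a (a + M)).filter (fun n => 3 * (K * L) ≤ om P n)).card : ℝ) ≤ 2 * M * Real.exp (-(K * L) * Real.log K) := by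
  have hL1 := R.L1
  have hKL : 1 ≤ K * L := by nlinarith
  obtain ⟨S, hS1, hS2⟩ : ∃ S : ℕ, K * L ≤ (S:ℝ) ∧ (S:ℝ) ≤ K * L + 1 :=
    ⟨⌈K * L⌉₊, Nat.le_ceil _, (Nat.ceil_lt_add_one (by linarith)).le⟩
  have h1 := om_tail (P := P) R.H1 (fun p hp => ⟨(R.hP p hp).1, (R.hP p hp).2.2⟩) a M S ?_ (3 * (K * L)) (by linarith)
  · rw [← R.hL] at h1
    set c : ℝ := (((Ioc a (a + M)).filter (fun n => 3 * (K * L) ≤ om P n)).card : ℝ)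
    have h2 : c * (K * L) ^ S ≤ 2 * M * L ^ S := le_trans (by gcongr; linarith) h1
    rw [mul_pow] at h2
    have h3 : c * K ^ S ≤ 2 * M := le_of_mul_le_mul_right (by linarith) (show 0 < L ^ S by positivity)
    rw [neg_mul, Real.exp_neg, ← div_eq_mul_inv, le_div_iff₀ (Real.exp_pos _)]
    refine le_trans (mul_le_mul_of_nonneg_left ?_ (by positivity)) h3
    rw [← Real.exp_log (show 0 < K by linarith), ← Real.exp_nat_mul, Real.exp_log (show 0 < K by linarith)]
    exact Real.exp_le_exp.2 (mul_le_mul_of_nonneg_right hS1 (Real.log_nonneg hK))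
  · refine le_trans ?_ hM
    rw [R.hH, ← Real.exp_nat_mul, mul_comm]
    gcongr
end Reg
end TB
namespace TB
open Finset
section fin
open Classical
variable {P : Finset ℕ} {H0 H s l L : ℝ} {α J : ℕ}
set_option maxHeartbeats 1000000 in
theorem core (R : Reg P H0 H s l L α J) (N : ℕ) (K : ℝ) (hK : 1 ≤ K) (hN : Real.exp (K * L * s ^ 4) ≤ N) :
    ∃ X ⊆ Ioc (N:ℤ) (2 * N), (((Ioc (N:ℤ) (2 * N)) \ X).card : ℝ) ≤ 10 * ((N : ℝ) * Real.exp (-(K * L) * Real.log K) + (N : ℝ) / Real.sqrt H0) ∧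
      ∀ f : ℤ → ℝ, (∀ n, f n ≠ 0 → n ∈ X) → |∑ n ∈ Ioc (N:ℤ) (2 * N), ∑ p ∈ P, ((if (p:ℤ) ∣ n then (1:ℝ) else 0) - 1 / p) * (f n * (f (n + p) + f (n - p)))| ≤ 12 * (10 * Real.exp 8) * Real.sqrt (K * L) * ∑ n ∈ Ioc (N:ℤ) (2 * N), f n ^ 2 := by
  have hs := R.hs
  have hl := R.hl
  obtain ⟨hk, hkk, hsk⟩ := R.fx
  have hL1 := R.L1
  have hH1 := R.H1
  have hmm := R.mm
  have e27 : (2.7:ℝ) ≤ Real.exp 1 := by linarith [Real.exp_one_gt_d9]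
  have hLK : L ≤ K * L := le_mul_of_one_le_left (by linarith) hK
  have hKL : 2.7 ≤ K * L := by linarith [R.hL1]
  have hs4 : s ^ 4 = (s ^ 2) ^ 2 := by ring
  have h10 : 10 ≤ H := by rw [R.hH]; have := Real.add_one_le_exp (s^2); linarith
  obtain ⟨c, hc1, hc2⟩ := exists_nat_pow_near (one_le_pow₀ hH1 : 1 ≤ H ^ 2) (one_lt_two : (1:ℝ) < 2)
  obtain ⟨W, hWd⟩ : ∃ W : ℕ, W = 2 ^ (c+1) := ⟨_, rfl⟩
  have hW1 : H ^ 2 ≤ (W:ℝ) := by rw [hWd]; push_cast; exact hc2.le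
  have hW2 : (W:ℝ) ≤ 2 * H ^ 2 := by rw [hWd]; push_cast; rw [pow_succ]; linarith
  have hWp : 1 ≤ W := by rw [hWd]; exact Nat.one_le_two_pow
  have hWp' : (1:ℝ) ≤ W := by exact_mod_cast hWp
  obtain ⟨T, hT⟩ : ∃ T, T = N / W := ⟨_, rfl⟩
  have hWT : W * T ≤ N := by rw [hT]; exact Nat.mul_div_le _ _
  have hWT' : (W:ℝ) * T ≤ N := by exact_mod_cast hWT
  have hNW : (N:ℝ) < W * (T + 1) := by
    have : N < W * (T + 1) := by rw [hT]; exact Nat.lt_mul_div_succ _ hWp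
    exact_mod_cast this
  set m := 2 ^ (α+1) * (J+3) with hm
  have hbig : (W:ℝ) * (2 * H ^ (2 * m) + 1) ≤ N := by
    have a1 : 1 ≤ H ^ (2 * m) := one_le_pow₀ hH1
    calc (W:ℝ) * (2 * H ^ (2 * m) + 1) ≤ (2 * H ^ 2) * (3 * H ^ (2 * m)) := by gcongr; linarith
      _ = 6 * (H ^ 2 * H ^ (2 * m)) := by ring
      _ ≤ H * (H ^ 2 * H ^ (2 * m)) := by gcongr; linarith
      _ = H ^ (2 * m + 3) := by ring
      _ = Real.exp (s ^ 2 * (2 * m + 3)) := by rw [R.hH, ← Real.exp_nat_mul]; push_cast; ring_nf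
      _ ≤ Real.exp (K * L * s ^ 4) := by
        refine Real.exp_le_exp.2 ?_
        calc s ^ 2 * (2 * m + 3) ≤ s ^ 2 * (2.7 * s ^ 2) := by gcongr; linarith
          _ = 2.7 * s ^ 4 := by ring
          _ ≤ _ := by gcongr
      _ ≤ N := hN
  have hTT : 2 * H ^ (2 * m) ≤ T := by
    have := lt_of_mul_lt_mul_left (hbig.trans_lt hNW) (by positivity)
    linarith
  have hHm : H ^ m ≤ H ^ (2 * m) := pow_le_pow_right₀ hH1 (by omega)
  have hm1 : 1 ≤ m := Nat.mul_pos (by positivity) (by omega)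
  have hHm1 : H ≤ H ^ m := le_self_pow₀ hH1 (by omega)
  have hM1 : H ^ m ≤ (W * T : ℕ) := by
    push_cast
    have : (1:ℝ) * T ≤ W * T := by gcongr
    linarith
  have hM2 : Real.exp (s ^ 2 * (K * L + 1)) ≤ (W * T : ℕ) := by
    push_cast
    have a1 : (W:ℝ) ≤ Real.exp (s ^ 2 * (K * L + 1)) := by
      refine hW2.trans ?_
      calc 2 * H ^ 2 ≤ H * H ^ 2 := by gcongr; linarith
        _ = Real.exp (s ^ 2 * 3) := by rw [R.hH, ← pow_succ', ← Real.exp_nat_mul]; push_cast; ring_nf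
        _ ≤ _ := Real.exp_le_exp.2 (by gcongr; linarith)
    have a2 : 2 * Real.exp (s ^ 2 * (K * L + 1)) ≤ N := by
      refine le_trans ?_ hN
      calc _ ≤ Real.exp 1 * Real.exp (s ^ 2 * (K * L + 1)) := by gcongr; linarith
        _ = Real.exp (1 + s ^ 2 * (K * L + 1)) := by rw [Real.exp_add]
        _ ≤ _ := by
          refine Real.exp_le_exp.2 ?_
          calc 1 + s ^ 2 * (K * L + 1) ≤ 5000 * s ^ 2 * (K * L) := by
                have : s ^ 2 * 2.7 ≤ s ^ 2 * (K * L) := by gcongr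
                linarith
            _ ≤ s ^ 4 * (K * L) := by rw [hs4]; gcongr
            _ = _ := by ring
    linarith
  have hcop : ∀ p ∈ P, p.Coprime W := by
    intro p hp
    rw [hWd]
    refine Nat.Coprime.pow_right _ ((Nat.coprime_primes (R.hP p hp).1 Nat.prime_two).2 ?_)
    rintro rfl
    have h1 := (R.hP 2 hp).2.1
    have h2 := R.hH0
    have h3 := Real.add_one_le_exp (200 * (s * l))
    norm_num at h1
    linarith
  set Hn := ⌊H⌋₊ with hHn
  have hHnle : (Hn:ℝ) ≤ H := Nat.floor_le (by linarith)
  set X := XX P (N:ℤ) W T J Hn (s ^ 4) (Real.exp (-15 * (s * l))) (10 * Real.exp 8 * Real.sqrt L) (3 * (K * L)) with hX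
  have hNN : (2 * N : ℤ) = N + N := by ring
  have hsub : Ioc (N:ℤ) (N + (W * T : ℕ)) ⊆ Ioc (N:ℤ) (2 * N) := Ioc_subset_Ioc le_rfl (by linarith [(show ((W * T : ℕ):ℤ) ≤ N by exact_mod_cast hWT)])
  refine ⟨X, (filter_subset _ _).trans hsub, ?_, ?_⟩
  · rw [hNN]
    refine (XX_card (P := P) (N:ℤ) W T J Hn N hWT ?_ _ _ _ _).trans ?_
    · have : (2:ℝ) * Hn ≤ W := by
        have : 2 * H ≤ H ^ 2 := by rw [sq]; gcongr; linarith
        linarith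
      exact_mod_cast this
    have hMN : ((W * T : ℕ):ℝ) ≤ N := by exact_mod_cast hWT
    have hN0 : (0:ℝ) ≤ N := by positivity
    have hq : Real.sqrt H0 ≤ H := by
      rw [Real.sqrt_le_left (by linarith)]
      exact R.hH0H.trans (le_self_pow₀ hH1 (by norm_num))
    have hq0 : 0 < Real.sqrt H0 := Real.sqrt_pos.2 R.H0p
    have hNH : (N:ℝ) / H ≤ N / Real.sqrt H0 := div_le_div_of_nonneg_left hN0 hq0 hq
    have hMH : ((W * T : ℕ):ℝ) / H ≤ N / Real.sqrt H0 := (div_le_div_of_nonneg_right hMN (by linarith)).trans hNH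
    have b1 : ((N - W * T : ℕ):ℝ) ≤ N / H := by
      rw [Nat.cast_sub hWT, le_div_iff₀ (by linarith)]
      calc ((N:ℝ) - (W * T : ℕ)) * H ≤ W * H := by push_cast; gcongr; linarith
        _ ≤ W * (2 * H ^ (2 * m) + 1) := by gcongr; linarith
        _ ≤ _ := hbig
    have b2 : 2 * (Hn:ℝ) * T ≤ 2 * (N / H) := by
      rw [mul_assoc]
      gcongr
      rw [le_div_iff₀ (by linarith)]
      calc (Hn:ℝ) * T * H ≤ H * T * H := by gcongr
        _ = H ^ 2 * T := by ring
        _ ≤ W * T := by gcongr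
        _ ≤ N := hWT'
    have b3 := R.c_d (N:ℤ) (W * T) K hK hM2
    have b4 := fun b => (R.c_Y (N:ℤ) (W * T) hM1 b).trans (div_le_div_of_nonneg_right hMN hq0.le)
    have b5 := R.c_D (N:ℤ) (W * T) hM1 W (by positivity) hW2
    have b6 := R.c_T (N:ℤ) (W * T) hM1 W (by positivity) hW2
    have b7 := sum_le_sum (R.c_N (N:ℤ) W T hcop hTT hWp hW2)
    rw [sum_const, Nat.card_Icc, show J + 3 + 1 - (J + 1) = 3 by omega, ← mul_sum] at b7
    have b3' : 2 * ((W * T : ℕ):ℝ) * Real.exp (-(K * L) * Real.log K) ≤ 2 * N * Real.exp (-(K * L) * Real.log K) := by gcongr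
    have b8 := b4 true
    have b9 := b4 false
    rw [mul_add, mul_add, Nat.cast_sum]
    grind
  · intro f hf
    rw [hNN]
    set x := Real.sqrt (K * L) with hx
    have hx2 : x ^ 2 = K * L := Real.sq_sqrt (by linarith)
    have hx1 : 1 ≤ x := Real.one_le_sqrt.2 (by linarith)
    obtain ⟨r, hr⟩ : ∃ r, r = 10 * Real.exp 8 := ⟨_, rfl⟩
    have hr1 : 10 ≤ r := by rw [hr]; linarith [Real.one_le_exp (show (0:ℝ) ≤ 8 by norm_num)]
    set t := 1 / (2 * r * x) with ht
    have htp : 0 < t := by positivity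
    have htx : t * (2 * r * x) = 1 := by rw [ht]; field_simp
    have hsL : Real.sqrt L ≤ x := Real.sqrt_le_sqrt hLK
    have hH0 := R.H0p
    have h1 := XX_form (P := P) (N:ℤ) W T J Hn N hWT H0 (s ^ 4) (Real.exp (-15 * (s * l))) (10 * Real.exp 8 * Real.sqrt L) (3 * (K * L)) L t
      (fun p hp => Nat.le_floor (R.hP p hp).2.2) R.hL (by linarith) (by linarith) (by linarith) R.H0p (fun p hp => (R.hP p hp).2.1) (Real.exp_pos _).le
      (by rw [← hr]; exact one_le_mul_of_one_le_of_one_le (by linarith) (Real.one_le_sqrt.2 hL1)) R.hsm R.hJJ htp.le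
      (by rw [← hr]
          calc t * (2 * (r * Real.sqrt L)) ≤ t * (2 * (r * x)) := by gcongr
            _ = 1 := by rw [← htx]; ring) f hf
    rw [← hr]
    have y : t * x ≤ 1 / 20 := by
      have : 20 * (t * x) ≤ t * (2 * r * x) := by
        calc 20 * (t * x) = t * (2 * 10 * x) := by ring
          _ ≤ _ := by gcongr
      linarith
    have y1 : t ^ 2 * (3 * (K * L)) ≤ 1 := by
      rw [← hx2, show t ^ 2 * (3 * x ^ 2) = 3 * (t * x) ^ 2 by ring]
      have : (t * x) ^ 2 ≤ (1 / 20) ^ 2 := pow_le_pow_left₀ (by positivity) y 2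
      linarith
    have y2 : t ^ 3 * L ≤ 1 := by
      have z1 : t ≤ 1 := by linarith [mul_le_mul_of_nonneg_left hx1 htp.le]
      have z2 : t ^ 2 * L ≤ t ^ 2 * (3 * (K * L)) := by gcongr; linarith
      have z3 : 0 ≤ t ^ 2 * L := by positivity
      calc t ^ 3 * L = t * (t ^ 2 * L) := by ring
        _ ≤ 1 * 1 := mul_le_mul z1 (by linarith) z3 (by norm_num)
        _ = 1 := by norm_num
    have hS : 0 ≤ ∑ n ∈ Ioc (N:ℤ) (N + N), f n ^ 2 := sum_nonneg fun _ _ => sq_nonneg _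
    set S := ∑ n ∈ Ioc (N:ℤ) (N + N), f n ^ 2
    refine le_of_mul_le_mul_left ?_ htp
    refine h1.trans ?_
    calc _ ≤ 2 * (1 + 1 + 1) * S := by gcongr
      _ = 6 * (t * (2 * r * x)) * S := by rw [htx]; ring
      _ = _ := by ring
theorem mkReg (P : Finset ℕ) (H0 H L : ℝ) (hP : ∀ p ∈ P, Nat.Prime p ∧ H0 ≤ (p : ℝ) ∧ (p : ℝ) ≤ H)
    (hH0 : 1 ≤ H0) (hH0H : H0 ≤ H) (hH : 3 ≤ H) (hlog : Real.sqrt (Real.log H) * (Real.log (Real.log H)) ^ 2 ≤ Real.log H0)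
    (hL : L = ∑ p ∈ P, (1:ℝ) / p) (hL1 : Real.exp 1 ≤ L) (hl : 200 ≤ Real.log (Real.log H)) :
    ∃ α J, Reg P H0 H (Real.sqrt (Real.log H)) (Real.log (Real.log H)) L α J := by
  set κ := Real.log H with hκ
  have hκ1 : 1 ≤ κ := by
    rw [hκ, Real.le_log_iff_exp_le (by linarith)]; linarith [Real.exp_one_lt_d9]
  set l := Real.log κ with hld
  set s := Real.sqrt κ with hs
  have hs2 : s ^ 2 = κ := Real.sq_sqrt (by linarith)
  have hexp : Real.exp l = κ := Real.exp_log (by linarith)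
  have hs0 : 0 ≤ s := Real.sqrt_nonneg _
  have hse : s = Real.exp (l / 2) := by
    rw [hs, ← hexp, Real.exp_half]
  have hsl8 : l ^ 2 / 8 ≤ s := by
    rw [hse]; have := Real.quadratic_le_exp_of_nonneg (show 0 ≤ l / 2 by linarith); nlinarith
  have hs5 : 5000 ≤ s := by nlinarith
  have hsl : 25 * l ≤ s := by nlinarith
  have hsp : P ⊆ Icc 1 ⌊H⌋₊ := fun p hp => mem_Icc.2 ⟨(hP p hp).1.one_le, Nat.le_floor (hP p hp).2.2⟩
  obtain ⟨α, ha1, ha2⟩ := exists_nat_pow_near (show 1 ≤ s by linarith) (one_lt_two : (1:ℝ) < 2)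
  have hg2 : (2:ℝ) ^ (α+1) ≤ 2 * s := by rw [pow_succ]; linarith
  have hg0 : (0:ℝ) < 2 ^ (α+1) := by positivity
  set g : ℝ := 2 ^ (α+1) with hg
  have hgs : s ^ 2 / g ≤ s := by rw [div_le_iff₀ hg0, sq]; gcongr
  obtain ⟨J, hJ⟩ : ∃ J, ⌈s ^ 2 / g⌉₊ = J + 1 := ⟨⌈s ^ 2 / g⌉₊ - 1, by have : 0 < ⌈s ^ 2 / g⌉₊ := Nat.ceil_pos.2 (by positivity)
                                                                      omega⟩
  have hJ1 : s ^ 2 / g ≤ J + 1 := by have := Nat.le_ceil (s ^ 2 / g); rw [hJ] at this; exact_mod_cast this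
  have hJ2 : (J:ℝ) + 1 < s ^ 2 / g + 1 := by have := Nat.ceil_lt_add_one (show 0 ≤ s ^ 2 / g by positivity); rw [hJ] at this; exact_mod_cast this
  have hJ1' := (div_le_iff₀ hg0).1 hJ1
  have hJ2' : (J:ℝ) * g < s ^ 2 := by rw [← lt_div_iff₀ hg0]; linarith
  refine ⟨α, J, ⟨hP, hs5, hl, hsl, by rw [hs2, hexp], ?_, hH0H, ?_, hL, hL1, ?_, ?_, ha2.le, hg2, ?_, ?_, ?_, ?_, ?_⟩⟩
  · rw [← Real.le_log_iff_exp_le (by linarith)]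
    refine le_trans ?_ hlog
    rw [show s * l ^ 2 = l * (s * l) by ring]
    gcongr
  · rw [hs2, hκ, Real.exp_log (by linarith)]
  · have h1 : L ≤ 1 + κ := by
      have h2 : (harmonic ⌊H⌋₊ : ℝ) ≤ 1 + Real.log ⌊H⌋₊ := harmonic_le_one_add_log _
      have h3 : Real.log ⌊H⌋₊ ≤ κ := Real.log_le_log (by have : 0 < ⌊H⌋₊ := Nat.floor_pos.2 (by linarith)
                                                         exact_mod_cast this) (Nat.floor_le (by linarith))
      have h4 : L ≤ (harmonic ⌊H⌋₊ : ℝ) := by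
        rw [hL, harmonic_eq_sum_Icc]
        push_cast
        simp only [one_div]
        gcongr
      linarith
    rw [hs2]; linarith
  · calc (P.card:ℝ) ≤ ((Icc 1 ⌊H⌋₊).card : ℝ) := by exact_mod_cast card_le_card hsp
      _ = ⌊H⌋₊ := by simp
      _ ≤ H := Nat.floor_le (by linarith)
  · by_contra hc
    have : α = 0 := by omega
    rw [hg, this] at ha2; norm_num at ha2; linarith
  · linarith
  · nlinarith
  · linarith
  · refine le_trans ?_ hJ1
    rw [div_le_div_iff₀ (by norm_num) hg0]
    nlinarith
end fin
end TB
open scoped ComplexOrder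
theorem trace_bound :
    ∃ C : ℝ, 0 < C ∧
      ∀ (N : ℕ) (H0 H : ℝ), 1 ≤ N → 1 ≤ H0 → H0 ≤ H → 3 ≤ H →
        Real.sqrt (Real.log H) * (Real.log (Real.log H)) ^ 2 ≤ Real.log H0 →
        ∀ NN : Finset ℤ, NN = Finset.Ioc (N : ℤ) (2 * N) →
        ∀ P : Finset ℕ, (∀ p ∈ P, Nat.Prime p ∧ H0 ≤ (p : ℝ) ∧ (p : ℝ) ≤ H) →
        ∀ L : ℝ, L = ∑ p ∈ P, (1 : ℝ) / p →
        Real.exp 1 ≤ L →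
        Real.log H ≤ Real.sqrt (Real.log N / L) →
        ∀ A : ({n : ℤ // n ∈ NN} → ℂ) →ₗ[ℂ] ({n : ℤ // n ∈ NN} → ℂ),
        (∀ (f : {n : ℤ // n ∈ NN} → ℂ) (n : {n : ℤ // n ∈ NN}),
          A f n = ∑ p ∈ P,
            ((if (p : ℤ) ∣ (n : ℤ) then (1 : ℂ) else 0) - 1 / (p : ℂ)) *
              ((if h : (n : ℤ) + (p : ℤ) ∈ NN then f ⟨(n : ℤ) + (p : ℤ), h⟩ else 0) +
               (if h : (n : ℤ) - (p : ℤ) ∈ NN then f ⟨(n : ℤ) - (p : ℤ), h⟩ else 0))) →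
        ∀ K : ℝ, 1 ≤ K → K ≤ Real.log N / (L * (Real.log H) ^ 2) →
        ∃ X ⊆ NN,
          ((NN \ X).card : ℝ) ≤
            C * ((N : ℝ) * Real.exp (-(K * L) * Real.log K) + (N : ℝ) / Real.sqrt H0) ∧
          ∃ k : ℕ, Real.log H ≤ (k : ℝ) ∧
            ∀ AX : ({n : ℤ // n ∈ NN} → ℂ) →ₗ[ℂ] ({n : ℤ // n ∈ NN} → ℂ),
              (∀ (f : {n : ℤ // n ∈ NN} → ℂ) (n : {n : ℤ // n ∈ NN}),
                AX f n = if (n : ℤ) ∈ X then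
                    A (fun m : {n : ℤ // n ∈ NN} => if (m : ℤ) ∈ X then f m else 0) n
                  else 0) →
              LinearMap.trace ℂ ({n : ℤ // n ∈ NN} → ℂ) (AX ^ (2 * k)) ≤
                ((((C * K * L) ^ k * (N : ℝ)) : ℝ) : ℂ) := by
  obtain ⟨r, hr⟩ : ∃ r, r = 10 * Real.exp 8 := ⟨_, rfl⟩
  have hr0 : 0 < r := by rw [hr]; positivity
  have hE : 0 < Real.exp (Real.exp 200) := Real.exp_pos _
  refine ⟨144 * r ^ 2 + 10 + Real.exp (Real.exp 200), by positivity, ?_⟩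
  set C := 144 * r ^ 2 + 10 + Real.exp (Real.exp 200) with hC
  have hC0 : 0 < C := by positivity
  intro N H0 H hN hH0 hH0H hH hlog NN hNN P hP L hL hL1 _ A hA K hK hK2
  have hN1 : (1:ℝ) ≤ N := by exact_mod_cast hN
  have hκ : 1 ≤ Real.log H := by
    rw [Real.le_log_iff_exp_le (by linarith)]; linarith [Real.exp_one_lt_d9]
  have hL0 : 0 < L := (Real.exp_pos _).trans_le hL1
  have hcard : (NN.card : ℝ) = N := by
    rw [hNN, Int.card_Ioc, show (2 * (N:ℤ) - N) = N by ring]; simp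
  by_cases hl : 200 ≤ Real.log (Real.log H)
  · obtain ⟨α, J, R⟩ := TB.mkReg P H0 H L hP hH0 hH0H hH hlog hL hL1 hl
    obtain ⟨X, hX1, hX2, hX3⟩ := TB.core R N K hK (by
      rw [← Real.le_log_iff_exp_le (by linarith)]
      rw [le_div_iff₀ (by positivity)] at hK2
      refine le_trans (le_of_eq ?_) hK2
      rw [show ∀ x : ℝ, x ^ 4 = (x ^ 2) ^ 2 from fun x => by ring, Real.sq_sqrt (by linarith)]; ring)
    rw [← hNN] at hX1 hX2 hX3
    refine ⟨X, hX1, ?_, ⌈Real.log H⌉₊, Nat.le_ceil _, ?_⟩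
    · have : 0 ≤ (N:ℝ) * Real.exp (-(K * L) * Real.log K) + N / Real.sqrt H0 := by positivity
      convert hX2.trans (mul_le_mul_of_nonneg_right (show (10:ℝ) ≤ C by rw [hC]; nlinarith [sq_nonneg r]) this) using 3
    · intro AX hAX
      refine (TB.trace_red NN P X hX1 _ (by positivity) ⌈Real.log H⌉₊ hX3 A AX hA (fun f n => by convert hAX f n)).trans ?_
      rw [Complex.real_le_real, hcard, mul_comm, pow_mul, ← hr]
      refine mul_le_mul_of_nonneg_right (pow_le_pow_left₀ (by positivity) ?_ _) (by positivity)
      rw [mul_pow, Real.sq_sqrt (by positivity), mul_assoc C]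
      refine mul_le_mul_of_nonneg_right ?_ (by positivity)
      rw [hC]; linarith [show (12 * r) ^ 2 = 144 * r ^ 2 by ring]
  · refine ⟨∅, Finset.empty_subset _, ?_, ⌈Real.log H⌉₊, Nat.le_ceil _, ?_⟩
    · have h1 : Real.sqrt H0 ≤ C := by
        have h2 : Real.log H ≤ Real.exp 200 := by
          rw [← Real.log_le_iff_le_exp (by linarith)]; linarith
        have h3 : H ≤ Real.exp (Real.exp 200) := by
          rw [← Real.log_le_iff_le_exp (by linarith)]; exact h2
        have h4 : Real.sqrt H0 ≤ H := by
          rw [Real.sqrt_le_left (by linarith)]; nlinarith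
        rw [hC]; nlinarith [sq_nonneg r]
      have hq : 0 < Real.sqrt H0 := Real.sqrt_pos.2 (by linarith)
      rw [Finset.sdiff_empty, hcard]
      calc (N:ℝ) = Real.sqrt H0 * (N / Real.sqrt H0) := by field_simp
        _ ≤ C * (N / Real.sqrt H0) := by gcongr
        _ ≤ _ := by
          refine mul_le_mul_of_nonneg_left ?_ hC0.le
          have : 0 ≤ (N:ℝ) * Real.exp (-(K * L) * Real.log K) := by positivity
          linarith
    · intro AX hAX
      refine (TB.trace_red NN P ∅ (Finset.empty_subset _) 0 le_rfl ⌈Real.log H⌉₊ ?_ A AX hA (fun f n => by convert hAX f n)).trans ?_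
      · intro f hf
        have : ∀ n, f n = 0 := fun n => by by_contra h; simpa using hf n h
        simp [this]
      · rw [Complex.real_le_real]
        have : 0 < ⌈Real.log H⌉₊ := Nat.ceil_pos.2 (by linarith)
        rw [zero_pow (by omega), mul_zero]
        positivity
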